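/- Let f(n) be the maximum of s_r(X) over all pairs of disjoint finite sets of primes P_−, P_+ and all positive integers r with r·∏_{p ∈ P_− ∪ P_+} p ≤ n, where X = (∏_{p ∈ P_−} C_{p−1}) × (∏_{p ∈ P_+} C_{p+1}). Then limsup_{n→∞} (log f(n)) / ((log n)^2 / log log n) = (3 − 2√2)/4. -/

import Mathlib

open Filter

/-- `s_r(X)`: the number of subgroups of `X` of index at most `r`. -/
noncomputable def subCount (r : ℕ) (X : Type) [Group X] : ℕ :=
  Nat.card {H : Subgroup X // H.index ≤ r}

/-- The extremal function `f(n)`: the maximum of `s_r(X)` over disjoint finite sets of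
primes `P₋, P₊` and positive integers `r` with `r · ∏_{p ∈ P₋ ∪ P₊} p ≤ n`, where
`X = (∏_{p ∈ P₋} C_{p-1}) × (∏_{p ∈ P₊} C_{p+1})`. -/
noncomputable def extremalF (n : ℕ) : ℕ :=
  sSup {k : ℕ | ∃ Pm Pp : Finset ℕ, (∀ p ∈ Pm, p.Prime) ∧ (∀ p ∈ Pp, p.Prime) ∧
    Disjoint Pm Pp ∧ ∃ r : ℕ, 0 < r ∧ r * ∏ p ∈ Pm ∪ Pp, p ≤ n ∧
    k = subCount r
      ((∀ p : Pm, Multiplicative (ZMod (p.1 - 1))) ×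
       (∀ p : Pp, Multiplicative (ZMod (p.1 + 1))))}


lemma homcard_zmod (m n : ℕ) [NeZero n] :
    Nat.card (Multiplicative (ZMod m) →* Multiplicative (ZMod n)) = Nat.gcd m n := by
  have e1 : (Multiplicative (ZMod m) →* Multiplicative (ZMod n)) ≃ (ZMod m →+ ZMod n) :=
    AddMonoidHom.toMultiplicative.symm
  have e2 := (ZMod.lift (A := ZMod n) m).symm
  have e3 : {f : ℤ →+ ZMod n // f m = 0} ≃ (powMonoidHom (α := Multiplicative (ZMod n)) m).ker :=
    { toFun := fun f => ⟨Multiplicative.ofAdd (f.1 1), by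
        rw [MonoidHom.mem_ker, powMonoidHom_apply, ← ofAdd_nsmul, ← map_nsmul]
        simpa using f.2⟩
      invFun := fun a => ⟨zmultiplesHom _ (Multiplicative.toAdd a.1), by
        have := a.2
        rw [MonoidHom.mem_ker, powMonoidHom_apply] at this
        have h2 := congrArg Multiplicative.toAdd this
        simpa using h2⟩
      left_inv := fun f => by
        ext; simp
      right_inv := fun a => by
        ext; simp }
  rw [Nat.card_congr (e1.trans (e2.trans e3)), IsCyclic.card_powMonoidHom_ker, Nat.gcd_comm]
  simp

def homPiEquiv {ι : Type*} (A : Type*) [CommGroup A] (B : ι → Type*) [∀ i, CommGroup (B i)] :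
    (A →* (∀ i, B i)) ≃ (∀ i, A →* B i) :=
  { toFun := fun f i => (Pi.evalMonoidHom B i).comp f
    invFun := fun g => MonoidHom.mk' (fun a i => g i a) (by intro a b; ext i; simp)
    left_inv := fun f => by ext a; rfl
    right_inv := fun g => by ext i a; rfl }

lemma homcard_pi {ι κ : Type*} [Fintype ι] [Fintype κ] (x : ι → ℕ) (q : κ → ℕ)
    [∀ k, NeZero (q k)] :
    Nat.card ((∀ i, Multiplicative (ZMod (x i))) →* (∀ k, Multiplicative (ZMod (q k))))
      = ∏ k, ∏ i, Nat.gcd (x i) (q k) := by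
  classical
  rw [Nat.card_congr (homPiEquiv _ _), Nat.card_pi]
  refine Finset.prod_congr rfl fun k _ => ?_
  rw [Nat.card_congr (Pi.monoidHomMulEquiv (fun i => Multiplicative (ZMod (x i)))
    (Multiplicative (ZMod (q k)))).toEquiv.symm.symm, Nat.card_pi]
  exact Finset.prod_congr rfl fun i _ => homcard_zmod _ _

lemma homcard_prod_le (A B C : Type*) [CommGroup A] [CommGroup B] [CommGroup C]
    [Finite A] [Finite B] [Finite C] :
    Nat.card (A × B →* C) ≤ Nat.card (A →* C) * Nat.card (B →* C) := by
  rw [← Nat.card_prod]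
  have : Finite (A →* C) := Finite.of_injective (fun f => (f : A → C)) DFunLike.coe_injective
  have : Finite (B →* C) := Finite.of_injective (fun f => (f : B → C)) DFunLike.coe_injective
  refine Nat.card_le_card_of_injective
    (fun f => (f.comp (MonoidHom.inl A B), f.comp (MonoidHom.inr A B))) ?_
  intro f g h
  simp only [Prod.mk.injEq] at h
  refine MonoidHom.ext fun p => ?_
  have hp : p = (p.1, 1) * (1, p.2) := by ext <;> simp
  rw [hp, map_mul, map_mul]
  have h1 := DFunLike.congr_fun h.1 p.1
  have h2 := DFunLike.congr_fun h.2 p.2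
  simp only [MonoidHom.comp_apply, MonoidHom.inl_apply, MonoidHom.inr_apply] at h1 h2
  rw [h1, h2]

lemma homcard_to_prod_le (A B C : Type*) [CommGroup A] [CommGroup B] [CommGroup C]
    [Finite A] [Finite B] [Finite C] :
    Nat.card (C →* A × B) ≤ Nat.card (C →* A) * Nat.card (C →* B) := by
  rw [← Nat.card_prod]
  have : Finite (C →* A) := Finite.of_injective (fun f => (f : C → A)) DFunLike.coe_injective
  have : Finite (C →* B) := Finite.of_injective (fun f => (f : C → B)) DFunLike.coe_injective
  refine Nat.card_le_card_of_injective
    (fun f => ((MonoidHom.fst A B).comp f, (MonoidHom.snd A B).comp f)) ?_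
  intro f g h
  simp only [Prod.mk.injEq] at h
  ext c
  · exact DFunLike.congr_fun h.1 c
  · exact DFunLike.congr_fun h.2 c

/-- lower triangular times diagonal times upper triangular. -/
def shearL {B C : Type*} [CommGroup B] [CommGroup C] (f : B →* C) : B × C ≃* B × C :=
  { toFun := fun p => (p.1, p.2 * f p.1)
    invFun := fun p => (p.1, p.2 * (f p.1)⁻¹)
    left_inv := fun p => by simp
    right_inv := fun p => by simp
    map_mul' := fun p q => by
      ext
      · simp
      · simp [mul_mul_mul_comm] }

def shearU {B C : Type*} [CommGroup B] [CommGroup C] (f : C →* B) : B × C ≃* B × C :=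
  { toFun := fun p => (p.1 * f p.2, p.2)
    invFun := fun p => (p.1 * (f p.2)⁻¹, p.2)
    left_inv := fun p => by simp
    right_inv := fun p => by simp
    map_mul' := fun p q => by
      ext
      · simp [mul_mul_mul_comm]
      · simp }

def AutBig (A : Type) [CommGroup A] : Prop :=
  Nat.card (A →* A) ≤ Nat.card (A ≃* A) * Nat.card A

lemma finite_mulEquiv (A B : Type*) [CommGroup A] [CommGroup B] [Finite A] [Finite B] :
    Finite (A ≃* B) := Finite.of_injective (fun f => (f : A → B)) DFunLike.coe_injective

lemma AutBig.prod {B C : Type} [CommGroup B] [CommGroup C] [Finite B] [Finite C]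
    (hB : AutBig B) (hC : AutBig C) : AutBig (B × C) := by
  unfold AutBig at *
  have h1 : Nat.card (B →* C) * Nat.card (B ≃* B) * Nat.card (C ≃* C) * Nat.card (C →* B)
      ≤ Nat.card (B × C ≃* B × C) := by
    have : Finite (B × C ≃* B × C) := finite_mulEquiv _ _
    rw [← Nat.card_prod, ← Nat.card_prod, ← Nat.card_prod]
    refine Nat.card_le_card_of_injective
      (fun t => (shearU t.2).trans ((MulEquiv.prodCongr t.1.1.2 t.1.2).trans (shearL t.1.1.1))) ?_
    rintro ⟨⟨⟨f, σ⟩, τ⟩, g⟩ ⟨⟨⟨f', σ'⟩, τ'⟩, g'⟩ h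
    have key : ∀ b c, (σ (b * g c), τ c * f (σ (b * g c)))
        = (σ' (b * g' c), τ' c * f' (σ' (b * g' c))) := by
      intro b c
      have := DFunLike.congr_fun h (b, c)
      exact this
    have hσ : σ = σ' := by
      ext b
      have := congrArg Prod.fst (key b 1)
      simpa using this
    subst hσ
    have hf : f = f' := by
      ext b
      have := congrArg Prod.snd (key (σ.symm b) 1)
      simpa using this
    subst hf
    have hg : g = g' := by
      ext c
      have := congrArg Prod.fst (key 1 c)
      simpa using this
    subst hg
    have ht : τ = τ' := by
      ext c
      have := congrArg Prod.snd (key 1 c)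
      simpa using this
    subst ht
    rfl
  calc Nat.card (B × C →* B × C) ≤ Nat.card (B →* B × C) * Nat.card (C →* B × C) :=
        homcard_prod_le _ _ _
    _ ≤ (Nat.card (B →* B) * Nat.card (B →* C)) * (Nat.card (C →* B) * Nat.card (C →* C)) :=
        Nat.mul_le_mul (homcard_to_prod_le _ _ _) (homcard_to_prod_le _ _ _)
    _ ≤ ((Nat.card (B ≃* B) * Nat.card B) * Nat.card (B →* C)) * (Nat.card (C →* B) *
          (Nat.card (C ≃* C) * Nat.card C)) := by gcongr
    _ = (Nat.card (B →* C) * Nat.card (B ≃* B) * Nat.card (C ≃* C) * Nat.card (C →* B))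
          * (Nat.card B * Nat.card C) := by ring
    _ ≤ Nat.card (B × C ≃* B × C) * (Nat.card B * Nat.card C) := by gcongr
    _ = _ := by rw [Nat.card_prod]

lemma AutBig.congr {B C : Type} [CommGroup B] [CommGroup C] (e : B ≃* C)
    (hB : AutBig B) : AutBig C := by
  unfold AutBig at *
  rw [← Nat.card_congr e.toEquiv]
  have h1 : Nat.card (C →* C) = Nat.card (B →* B) := Nat.card_congr
    { toFun := fun f => (e.symm.toMonoidHom.comp f).comp e.toMonoidHom
      invFun := fun f => (e.toMonoidHom.comp f).comp e.symm.toMonoidHom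
      left_inv := fun f => by ext; simp
      right_inv := fun f => by ext; simp }
  have h2 : Nat.card (C ≃* C) = Nat.card (B ≃* B) := Nat.card_congr (MulAut.congr e).toEquiv.symm
  rw [h1, h2]; exact hB

lemma AutBig.zmod (n : ℕ) [NeZero n] : AutBig (Multiplicative (ZMod n)) := by
  unfold AutBig
  rw [homcard_zmod]
  have : Finite (Multiplicative (ZMod n) ≃* Multiplicative (ZMod n)) := finite_mulEquiv _ _
  have h : 0 < Nat.card (Multiplicative (ZMod n) ≃* Multiplicative (ZMod n)) := Nat.card_pos
  have : Nat.card (Multiplicative (ZMod n)) = n := by simp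
  rw [this, Nat.gcd_self]
  nlinarith

abbrev LG (l : List ℕ) : Type := ∀ i : Fin l.length, Multiplicative (ZMod (l.get i))

def consEquivLG (a : ℕ) (l : List ℕ) :
    (Multiplicative (ZMod a) × LG l) ≃* LG (a :: l) :=
  { toFun := fun p => Fin.cons (α := fun i : Fin (l.length + 1) => Multiplicative (ZMod ((a :: l).get i))) p.1 p.2
    invFun := fun g => (g 0, fun i => g i.succ)
    left_inv := fun p => by ext <;> rfl
    right_inv := fun g => by
      funext i
      refine Fin.cases ?_ (fun j => ?_) i <;> rfl
    map_mul' := fun p q => by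
      funext i
      refine Fin.cases ?_ (fun j => ?_) i <;> rfl }

lemma LG_finite (l : List ℕ) (h : ∀ a ∈ l, 0 < a) : Finite (LG l) := by
  have : ∀ i : Fin l.length, NeZero (l.get i) := fun i => ⟨(h _ (List.get_mem l i)).ne'⟩
  infer_instance

lemma AutBig.list (l : List ℕ) (h : ∀ a ∈ l, 0 < a) : AutBig (LG l) := by
  induction l with
  | nil =>
    unfold AutBig
    have h1 : Subsingleton (LG []) := ⟨fun a b => by funext i; exact i.elim0⟩
    have : Subsingleton (LG [] →* LG []) := ⟨fun f g => by
      refine MonoidHom.ext fun a => ?_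
      exact Subsingleton.elim _ _⟩
    have : Finite (LG [] ≃* LG []) := finite_mulEquiv _ _
    have h2 : 0 < Nat.card (LG [] ≃* LG []) := Nat.card_pos
    have h3 : 0 < Nat.card (LG []) := Nat.card_pos
    have h4 : Nat.card (LG [] →* LG []) ≤ 1 := Finite.card_le_one_iff_subsingleton.mpr inferInstance
    nlinarith
  | cons a l ih =>
    have ha : NeZero a := ⟨(h a (by simp)).ne'⟩
    have := LG_finite l (fun b hb => h b (by simp [hb]))
    exact ((AutBig.zmod a).prod (ih (fun b hb => h b (by simp [hb])))).congr (consEquivLG a l)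

/-- number of normal subgroups with given quotient -/
lemma count_quot (X A : Type) [CommGroup X] [CommGroup A] [Finite X] [Finite A] :
    Nat.card {H : Subgroup X // Nonempty (X ⧸ H ≃* A)} * Nat.card (A ≃* A)
      ≤ Nat.card (X →* A) := by
  have : Finite (X →* A) := Finite.of_injective (fun f => (f : X → A)) DFunLike.coe_injective
  rw [← Nat.card_prod]
  refine Nat.card_le_card_of_injective
    (fun t => (t.2.toMonoidHom.comp (t.1.2.some.toMonoidHom)).comp (QuotientGroup.mk' t.1.1)) ?_
  rintro ⟨⟨H, hH⟩, σ⟩ ⟨⟨H', hH'⟩, σ'⟩ h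
  have ker : ∀ (K : Subgroup X) (e : X ⧸ K ≃* A) (s : A ≃* A),
      ((s.toMonoidHom.comp e.toMonoidHom).comp (QuotientGroup.mk' K)).ker = K := by
    intro K e s
    ext x
    simp [MonoidHom.mem_ker]
  have hk := congrArg MonoidHom.ker h
  simp only [ker] at hk
  subst hk
  simp only [Prod.mk.injEq, true_and]
  ext a
  obtain ⟨x, hx⟩ := QuotientGroup.mk'_surjective H (hH.some.symm a)
  have := DFunLike.congr_fun h x
  simp only [MonoidHom.comp_apply, hx] at this
  simpa using this


/-- lists with entries at least two and product at most `r` -/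
def Lst : ℕ → ℕ → Finset (List ℕ)
  | 0, _ => {[]}
  | k + 1, r => {[]} ∪ (Finset.Icc 2 r).biUnion (fun m => (Lst k (r / m)).image (List.cons m))

lemma mem_Lst (k : ℕ) : ∀ (r : ℕ) (l : List ℕ), l.length ≤ k → (∀ a ∈ l, 2 ≤ a) → l.prod ≤ r →
    l ∈ Lst k r := by
  induction k with
  | zero =>
    intro r l hl _ _
    simp at hl
    simp [Lst, hl]
  | succ k ih =>
    intro r l hl h2 hp
    cases l with
    | nil => simp [Lst]
    | cons a l =>
      have ha : 2 ≤ a := h2 a (by simp)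
      have hl0 : 0 < l.prod := List.prod_pos (fun b hb => by
        have := h2 b (by simp [hb]); omega)
      rw [List.prod_cons] at hp
      simp only [Lst, Finset.mem_union, Finset.mem_biUnion, Finset.mem_image, Finset.mem_Icc]
      right
      refine ⟨a, ⟨ha, by nlinarith⟩, l, ih _ _ (by simpa using hl)
        (fun b hb => h2 b (by simp [hb])) ?_, rfl⟩
      rw [Nat.le_div_iff_mul_le (by omega)]
      linarith

lemma sum_inv_sq (r : ℕ) (hr : 1 ≤ r) :
    ∑ m ∈ Finset.Icc 2 r, (1 / (m : ℝ) ^ 2) ≤ 1 - 1 / (r : ℝ) := by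
  induction r, hr using Nat.le_induction with
  | base => simp
  | succ r hr ih =>
    rw [Finset.sum_Icc_succ_top (by omega)]
    have hr' : (1 : ℝ) ≤ r := by exact_mod_cast hr
    have : (1 : ℝ) / ((r + 1 : ℕ) : ℝ) ^ 2 ≤ 1 / r - 1 / ((r + 1 : ℕ) : ℝ) := by
      push_cast
      rw [div_sub_div _ _ (by positivity) (by positivity), div_le_div_iff₀ (by positivity) (by positivity)]
      nlinarith
    linarith

lemma card_Lst (k : ℕ) : ∀ r : ℕ, 1 ≤ r → ((Lst k r).card : ℝ) ≤ (r : ℝ) ^ 2 := by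
  induction k with
  | zero =>
    intro r hr
    have hr' : (1 : ℝ) ≤ r := by exact_mod_cast hr
    simp [Lst]
    nlinarith
  | succ k ih =>
    intro r hr
    have hr' : (1 : ℝ) ≤ r := by exact_mod_cast hr
    have h1 : (Lst (k + 1) r).card ≤ 1 + ∑ m ∈ Finset.Icc 2 r, (Lst k (r / m)).card := by
      rw [Lst]
      refine (Finset.card_union_le _ _).trans ?_
      refine Nat.add_le_add (by simp) ?_
      refine Finset.card_biUnion_le.trans ?_
      exact Finset.sum_le_sum fun m _ => Finset.card_image_le
    have h2 : ((Lst (k + 1) r).card : ℝ) ≤ 1 + ∑ m ∈ Finset.Icc 2 r, ((Lst k (r / m)).card : ℝ) := by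
      exact_mod_cast h1
    have h3 : ∑ m ∈ Finset.Icc 2 r, ((Lst k (r / m)).card : ℝ)
        ≤ ∑ m ∈ Finset.Icc 2 r, (r : ℝ) ^ 2 * (1 / (m : ℝ) ^ 2) := by
      refine Finset.sum_le_sum fun m hm => ?_
      rw [Finset.mem_Icc] at hm
      have h4 := ih (r / m) (Nat.div_pos hm.2 (by omega))
      have h5 : ((r / m : ℕ) : ℝ) ≤ r / m := Nat.cast_div_le
      refine h4.trans ?_
      calc ((r / m : ℕ) : ℝ) ^ 2 ≤ ((r : ℝ) / m) ^ 2 := by gcongr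
        _ = _ := by rw [div_pow]; ring
    rw [← Finset.mul_sum] at h3
    have h6 := sum_inv_sq r hr
    have h7 : (r : ℝ) ^ 2 * ∑ m ∈ Finset.Icc 2 r, (1 / (m : ℝ) ^ 2) ≤ r ^ 2 * (1 - 1 / r) := by
      gcongr
    have h8 : (r : ℝ) ^ 2 * (1 - 1 / r) = r ^ 2 - r := by field_simp
    linarith

lemma length_le_prod (l : List ℕ) (h : ∀ a ∈ l, 2 ≤ a) : l.length ≤ l.prod := by
  induction l with
  | nil => simp
  | cons a l ih =>
    have h1 := ih (fun b hb => h b (by simp [hb]))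
    have ha := h a (by simp)
    have : 0 < l.prod := List.prod_pos (fun b hb => by
        have := h b (by simp [hb]); omega)
    simp only [List.length_cons, List.prod_cons]
    nlinarith

lemma card_LG (l : List ℕ) : Nat.card (LG l) = l.prod := by
  rw [Nat.card_pi]
  have : ∀ i : Fin l.length, Nat.card (Multiplicative (ZMod (l.get i))) = l[(i : ℕ)] := fun i => by
    rw [Nat.card_congr Multiplicative.toAdd, Nat.card_zmod]; rfl
  rw [Finset.prod_congr rfl fun i _ => this i, Fin.prod_univ_getElem]

lemma exists_list_of_finite (G : Type) [CommGroup G] [Finite G] :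
    ∃ l : List ℕ, (∀ a ∈ l, 2 ≤ a) ∧ l.prod = Nat.card G ∧ Nonempty (G ≃* LG l) := by
  obtain ⟨ι, _, n, hn, ⟨e⟩⟩ := CommGroup.equiv_prod_multiplicative_zmod_of_finite G
  let f := (Fintype.equivFin ι).symm
  let l := List.ofFn (fun i => n (f i))
  have hlen : l.length = Fintype.card ι := by simp [l]
  let f' : Fin l.length ≃ ι := (finCongr hlen).trans f
  have hf' : ∀ i, l.get i = n (f' i) := by
    intro i
    simp [l, f']
    rfl
  have e2 : ((i : ι) → Multiplicative (ZMod (n i))) ≃* LG l :=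
    { toFun := fun g i => Multiplicative.ofAdd ((ZMod.ringEquivCongr (hf' i).symm) (Multiplicative.toAdd (g (f' i))))
      invFun := fun g i => Multiplicative.ofAdd
        ((ZMod.ringEquivCongr (by rw [hf', Equiv.apply_symm_apply])) (Multiplicative.toAdd (g (f'.symm i))))
      left_inv := fun g => by
        funext i
        obtain ⟨j, rfl⟩ := f'.surjective i
        apply Multiplicative.toAdd.injective
        simp only [toAdd_ofAdd]
        have : ∀ (k : Fin l.length) (hk : k = j) (h1) (h2), (ZMod.ringEquivCongr h1 : ZMod (l.get k) ≃+* ZMod (n (f' j)))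
          ((ZMod.ringEquivCongr h2 : ZMod (n (f' k)) ≃+* ZMod (l.get k)) (Multiplicative.toAdd (g (f' k)))) = Multiplicative.toAdd (g (f' j)) := by
          intro k hk h1 h2
          subst hk
          rw [← RingEquiv.trans_apply, ZMod.ringEquivCongr_trans]
          simp
        exact this _ (by simp) _ _
      right_inv := fun g => by
        funext j
        apply Multiplicative.toAdd.injective
        simp only [toAdd_ofAdd]
        have : ∀ (k : Fin l.length) (hk : k = j) (h1) (h2), (ZMod.ringEquivCongr h1 : ZMod (n (f' j)) ≃+* ZMod (l.get j))
          ((ZMod.ringEquivCongr h2 : ZMod (l.get k) ≃+* ZMod (n (f' j))) (Multiplicative.toAdd (g k))) = Multiplicative.toAdd (g j) := by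
          intro k hk h1 h2
          subst hk
          rw [← RingEquiv.trans_apply, ZMod.ringEquivCongr_trans]
          simp
        exact this _ (by simp) _ _
      map_mul' := fun g h => by
        funext i
        simp }
  have e3 := e.trans e2
  refine ⟨l, ?_, ?_, ⟨e3⟩⟩
  · intro a ha
    obtain ⟨i, rfl⟩ := (List.mem_ofFn' _ _).mp ha
    exact hn _
  · rw [Nat.card_congr e3.toEquiv, card_LG]

lemma subCount_le_sum (r : ℕ) (X : Type) [CommGroup X] [Finite X] :
    subCount r X ≤ ∑ l ∈ Lst r r, Nat.card {H : Subgroup X // Nonempty (X ⧸ H ≃* LG l)} := by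
  classical
  have hfin : Finite (Subgroup X) := inferInstance
  have := Fintype.ofFinite (Subgroup X)
  unfold subCount
  have hc : ∀ p : Subgroup X → Prop, Nat.card {H : Subgroup X // p H} = (Finset.univ.filter p).card := by
    intro p
    rw [Nat.card_eq_fintype_card, Fintype.card_subtype]
  simp only [hc]
  refine le_trans (Finset.card_le_card ?_) Finset.card_biUnion_le
  intro H hH
  simp only [Finset.mem_filter, Finset.mem_univ, true_and] at hH
  obtain ⟨l, h2, hp, he⟩ := exists_list_of_finite (X ⧸ H)
  simp only [Finset.mem_biUnion, Finset.mem_filter, Finset.mem_univ, true_and]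
  have : l.prod ≤ r := by rw [hp]; exact hH
  exact ⟨l, mem_Lst r r l ((length_le_prod l h2).trans this) h2 this, he⟩

lemma Lst_prop (k : ℕ) : ∀ (r : ℕ) (l : List ℕ), 1 ≤ r → l ∈ Lst k r → (∀ a ∈ l, 2 ≤ a) ∧ l.prod ≤ r := by
  induction k with
  | zero =>
    intro r l hr hl
    simp [Lst] at hl
    simp [hl, hr]
  | succ k ih =>
    intro r l hr hl
    simp only [Lst, Finset.mem_union, Finset.mem_biUnion, Finset.mem_image, Finset.mem_Icc,
      Finset.mem_singleton] at hl
    rcases hl with rfl | ⟨m, ⟨h1, h2⟩, l', hl', rfl⟩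
    · simp [hr]
    · obtain ⟨h3, h4⟩ := ih _ _ (Nat.div_pos h2 (by omega)) hl'
      refine ⟨?_, ?_⟩
      · intro a ha
        rcases List.mem_cons.mp ha with rfl | h
        · exact h1
        · exact h3 a h
      · rw [List.prod_cons]
        calc m * l'.prod ≤ m * (r / m) := by gcongr
          _ ≤ r := Nat.mul_div_le r m

/-- `∏_{a ∈ l} ∏_{b ∈ l} gcd(a,b)` -/
def gcdSq (l : List ℕ) : ℕ := (l.map fun a => (l.map (Nat.gcd a)).prod).prod

lemma endcard (l : List ℕ) (h : ∀ a ∈ l, 2 ≤ a) : Nat.card (LG l →* LG l) = gcdSq l := by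
  have : ∀ i : Fin l.length, NeZero (l.get i) := fun i => ⟨by
    have := (h _ (List.get_mem l i)); omega⟩
  rw [homcard_pi (fun i => l.get i) (fun i => l.get i)]
  unfold gcdSq
  rw [← Fin.prod_univ_fun_getElem]
  refine Finset.prod_congr rfl fun k _ => ?_
  rw [← Fin.prod_univ_fun_getElem]
  refine Finset.prod_congr rfl fun i _ => ?_
  rw [Nat.gcd_comm]; rfl

lemma exists_list_bound (r : ℕ) (hr : 1 ≤ r) (X : Type) [CommGroup X] [Finite X] :
    ∃ l : List ℕ, (∀ a ∈ l, 2 ≤ a) ∧ l.prod ≤ r ∧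
      subCount r X * gcdSq l ≤ r ^ 3 * Nat.card (X →* LG l) := by
  have hne : (Lst r r).Nonempty := ⟨[], mem_Lst r r [] (by simp) (by simp) (by simpa using hr)⟩
  obtain ⟨l, hl, hmax⟩ := Finset.exists_max_image (Lst r r)
    (fun l => Nat.card {H : Subgroup X // Nonempty (X ⧸ H ≃* LG l)}) hne
  obtain ⟨h2, hp⟩ := Lst_prop r r l hr hl
  refine ⟨l, h2, hp, ?_⟩
  set c := Nat.card {H : Subgroup X // Nonempty (X ⧸ H ≃* LG l)} with hc
  have h1 : subCount r X ≤ (Lst r r).card * c := by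
    refine (subCount_le_sum r X).trans ?_
    refine (Finset.sum_le_card_nsmul _ _ c hmax).trans ?_
    simp
  have h3 : (Lst r r).card ≤ r ^ 2 := by exact_mod_cast card_Lst r r hr
  have hpos : ∀ a ∈ l, 0 < a := fun a ha => by have := h2 a ha; omega
  have := LG_finite l hpos
  have h4 := count_quot X (LG l)
  have h5 := AutBig.list l hpos
  unfold AutBig at h5
  rw [endcard l h2, card_LG] at h5
  calc subCount r X * gcdSq l ≤ (r ^ 2 * c) * (Nat.card (LG l ≃* LG l) * r) := by
        refine Nat.mul_le_mul (h1.trans (by gcongr)) (h5.trans (by gcongr))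
    _ = r ^ 3 * (c * Nat.card (LG l ≃* LG l)) := by ring
    _ ≤ _ := by gcongr

/-- inserting into an invariant factor chain -/
def chIns : ℕ → List ℕ → List ℕ
  | b, [] => [b]
  | b, d :: l => Nat.lcm d b :: chIns (Nat.gcd d b) l

def toChain : List ℕ → List ℕ
  | [] => []
  | b :: l => chIns b (toChain l)

lemma gcd_lcm_gcd (x a b : ℕ) (hx : 0 < x) (ha : 0 < a) (hb : 0 < b) :
    Nat.gcd x (Nat.lcm a b) * Nat.gcd x (Nat.gcd a b) = Nat.gcd x a * Nat.gcd x b := by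
  have h1 : Nat.gcd x (Nat.lcm a b) = Nat.lcm (Nat.gcd x a) (Nat.gcd x b) := by
    apply Nat.eq_of_factorization_eq
    · exact (Nat.gcd_pos_of_pos_left _ hx).ne'
    · exact Nat.lcm_ne_zero (Nat.gcd_pos_of_pos_left _ hx).ne' (Nat.gcd_pos_of_pos_left _ hx).ne'
    · intro p
      rw [Nat.factorization_gcd hx.ne' (Nat.lcm_ne_zero ha.ne' hb.ne'),
        Nat.factorization_lcm ha.ne' hb.ne', Nat.factorization_lcm (Nat.gcd_pos_of_pos_left _ hx).ne' (Nat.gcd_pos_of_pos_left _ hx).ne',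
        Nat.factorization_gcd hx.ne' ha.ne', Nat.factorization_gcd hx.ne' hb.ne']
      simp only [Finsupp.inf_apply, Finsupp.sup_apply]
      exact inf_sup_left _ _ _
  have h2 : Nat.gcd x (Nat.gcd a b) = Nat.gcd (Nat.gcd x a) (Nat.gcd x b) := by
    apply Nat.dvd_antisymm
    · exact Nat.dvd_gcd (Nat.gcd_dvd_gcd_of_dvd_right _ (Nat.gcd_dvd_left _ _))
        (Nat.gcd_dvd_gcd_of_dvd_right _ (Nat.gcd_dvd_right _ _))
    · refine Nat.dvd_gcd ((Nat.gcd_dvd_left _ _).trans (Nat.gcd_dvd_left _ _)) (Nat.dvd_gcd ((Nat.gcd_dvd_left _ _).trans (Nat.gcd_dvd_right _ _)) ((Nat.gcd_dvd_right _ _).trans (Nat.gcd_dvd_right _ _)))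
  rw [h1, h2, mul_comm, Nat.gcd_mul_lcm]

lemma chIns_spec (l : List ℕ) : ∀ b, 0 < b → (∀ a ∈ l, 0 < a) →
    List.Pairwise (fun a c => c ∣ a) l →
    (∀ a ∈ chIns b l, 0 < a) ∧ List.Pairwise (fun a c => c ∣ a) (chIns b l) ∧
    (chIns b l).prod = b * l.prod ∧
    (∀ x, 0 < x → ((chIns b l).map (Nat.gcd x)).prod = Nat.gcd x b * (l.map (Nat.gcd x)).prod) ∧
    (∀ y, b ∣ y → (∀ a ∈ l, a ∣ y) → ∀ a ∈ chIns b l, a ∣ y) := by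
  induction l with
  | nil =>
    intro b hb _ _
    simp [chIns, hb]
  | cons d l ih =>
    intro b hb hpos hch
    rw [List.pairwise_cons] at hch
    have hd : 0 < d := hpos d (by simp)
    obtain ⟨i1, i2, i3, i4, i5⟩ := ih (Nat.gcd d b) (Nat.gcd_pos_of_pos_left _ hd)
      (fun a ha => hpos a (by simp [ha])) hch.2
    refine ⟨?_, ?_, ?_, ?_, ?_⟩
    · intro a ha
      simp only [chIns, List.mem_cons] at ha
      rcases ha with rfl | ha
      · exact Nat.lcm_pos hd hb
      · exact i1 a ha
    · simp only [chIns, List.pairwise_cons]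
      refine ⟨?_, i2⟩
      intro a ha
      exact i5 _ ((Nat.gcd_dvd_left _ _).trans (Nat.dvd_lcm_left _ _))
        (fun c hc => (hch.1 c hc).trans (Nat.dvd_lcm_left _ _)) a ha
    · simp only [chIns, List.prod_cons, i3]
      have := Nat.gcd_mul_lcm d b
      calc d.lcm b * (d.gcd b * l.prod) = (d.gcd b * d.lcm b) * l.prod := by ring
        _ = _ := by rw [this]; ring
    · intro x hx
      simp only [chIns, List.map_cons, List.prod_cons, i4 x hx]
      have := gcd_lcm_gcd x d b hx hd hb
      calc _ = (Nat.gcd x (Nat.lcm d b) * Nat.gcd x (Nat.gcd d b)) * (l.map (Nat.gcd x)).prod := by ring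
        _ = _ := by rw [this]; ring
    · intro y hby hy a ha
      simp only [chIns, List.mem_cons] at ha
      rcases ha with rfl | ha
      · exact Nat.lcm_dvd (hy d (by simp)) hby
      · exact i5 y ((Nat.gcd_dvd_right _ _).trans hby) (fun c hc => hy c (by simp [hc])) a ha

lemma toChain_spec (l : List ℕ) : (∀ a ∈ l, 0 < a) →
    (∀ a ∈ toChain l, 0 < a) ∧ List.Pairwise (fun a c => c ∣ a) (toChain l) ∧
    (toChain l).prod = l.prod ∧
    (∀ x, 0 < x → ((toChain l).map (Nat.gcd x)).prod = (l.map (Nat.gcd x)).prod) := by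
  induction l with
  | nil => intro _; simp [toChain]
  | cons b l ih =>
    intro h
    obtain ⟨h1, h2, h3, h4⟩ := ih (fun a ha => h a (by simp [ha]))
    obtain ⟨i1, i2, i3, i4, -⟩ := chIns_spec (toChain l) b (h b (by simp)) h1 h2
    refine ⟨i1, i2, ?_, ?_⟩
    · simp [toChain, i3, h3]
    · intro x hx
      simp [toChain, i4 x hx, h4 x hx]

lemma list_prod_swap (l m : List ℕ) (f : ℕ → ℕ → ℕ) :
    (l.map fun a => (m.map (f a)).prod).prod = (m.map fun b => (l.map fun a => f a b).prod).prod := by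
  induction l with
  | nil => simp
  | cons a l ih => simp [ih, List.prod_map_mul]

lemma gcdSq_toChain (l : List ℕ) (h : ∀ a ∈ l, 0 < a) : gcdSq (toChain l) = gcdSq l := by
  obtain ⟨h1, h2, h3, h4⟩ := toChain_spec l h
  unfold gcdSq
  have e1 : (toChain l).map (fun a => ((toChain l).map (Nat.gcd a)).prod)
      = (toChain l).map (fun a => (l.map (Nat.gcd a)).prod) :=
    List.map_congr_left fun a ha => h4 a (h1 a ha)
  have e2 : l.map (fun a => (l.map (Nat.gcd a)).prod)
      = l.map (fun a => ((toChain l).map (Nat.gcd a)).prod) :=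
    List.map_congr_left fun a ha => (h4 a (h a ha)).symm
  rw [e1, e2, list_prod_swap l]
  simp only [Nat.gcd_comm]

/-- the integers `p ± 1` -/
def xval (Pm : Finset ℕ) (p : ℕ) : ℕ := if p ∈ Pm then p - 1 else p + 1

lemma xval_pos (Pm : Finset ℕ) (hm : ∀ p ∈ Pm, p.Prime) (p : ℕ) : 0 < xval Pm p := by
  unfold xval
  split_ifs with h
  · have := (hm p h).two_le; omega
  · omega

theorem upper_algebra (Pm Pp : Finset ℕ) (hm : ∀ p ∈ Pm, p.Prime) 
    (hd : Disjoint Pm Pp) (r : ℕ) (hr : 1 ≤ r) :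
    ∃ D : List ℕ, (∀ a ∈ D, 0 < a) ∧ List.Pairwise (fun a c => c ∣ a) D ∧ D.prod ≤ r ∧
      subCount r ((∀ p : Pm, Multiplicative (ZMod (p.1 - 1))) ×
       (∀ p : Pp, Multiplicative (ZMod (p.1 + 1)))) * gcdSq D
       ≤ r ^ 3 * (D.map fun a => ∏ p ∈ Pm ∪ Pp, Nat.gcd (xval Pm p) a).prod := by
  classical
  have i1 : ∀ p : Pm, NeZero (p.1 - 1) := fun p => ⟨by
    have := (hm p.1 p.2).two_le; omega⟩
  obtain ⟨l, h2, hp, hb⟩ := exists_list_bound r hr ((∀ p : Pm, Multiplicative (ZMod (p.1 - 1))) ×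
       (∀ p : Pp, Multiplicative (ZMod (p.1 + 1))))
  have hpos : ∀ a ∈ l, 0 < a := fun a ha => by have := h2 a ha; omega
  obtain ⟨c1, c2, c3, c4⟩ := toChain_spec l hpos
  refine ⟨toChain l, c1, c2, c3 ▸ hp, ?_⟩
  rw [gcdSq_toChain l hpos]
  refine hb.trans ?_
  gcongr
  have : ∀ i : Fin l.length, NeZero (l.get i) := fun i => ⟨by
    have := (h2 _ (List.get_mem l i)); omega⟩
  refine (homcard_prod_le _ _ _).trans ?_
  rw [homcard_pi (fun p : Pm => p.1 - 1) (fun i => l.get i), homcard_pi (fun p : Pp => p.1 + 1) (fun i => l.get i),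
    ← Finset.prod_mul_distrib]
  have e1 : ((toChain l).map fun a => ∏ p ∈ Pm ∪ Pp, Nat.gcd (xval Pm p) a).prod
      = (l.map fun a => ∏ p ∈ Pm ∪ Pp, Nat.gcd (xval Pm p) a).prod := by
    have key : ∀ (S : Finset ℕ) (m : List ℕ), (m.map fun a => ∏ p ∈ S, Nat.gcd (xval Pm p) a).prod
        = ∏ p ∈ S, (m.map fun a => Nat.gcd (xval Pm p) a).prod := by
      intro S m
      induction m with
      | nil => simp
      | cons a m ih => simp [ih, Finset.prod_mul_distrib]
    rw [key, key]
    exact Finset.prod_congr rfl fun p _ => c4 _ (xval_pos Pm hm p)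
  rw [e1, ← Fin.prod_univ_fun_getElem]
  refine le_of_eq (Finset.prod_congr rfl fun k _ => ?_)
  rw [Finset.prod_union hd]
  congr 1
  · rw [← Finset.prod_coe_sort Pm]
    refine Finset.prod_congr rfl fun p _ => ?_
    simp [xval]
  · rw [← Finset.prod_coe_sort Pp]
    refine Finset.prod_congr rfl fun p _ => ?_
    have : p.1 ∉ Pm := fun h => Finset.disjoint_left.mp hd h p.2
    simp [xval, this]


lemma divisor_bound (ε : ℝ) (hε : 0 < ε) :
    ∃ C : ℝ, 1 ≤ C ∧ ∀ D : ℕ, D ≠ 0 → (D.divisors.card : ℝ) ≤ C * (D : ℝ) ^ ε := by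
  have hl2 : 0 < Real.log 2 := Real.log_pos (by norm_num)
  set K : ℝ := max 1 (1 / (ε * Real.log 2)) with hK
  have hK1 : 1 ≤ K := le_max_left _ _
  have hK2 : 1 ≤ K * (ε * Real.log 2) := by
    have : 1 / (ε * Real.log 2) ≤ K := le_max_right _ _
    rwa [div_le_iff₀ (by positivity)] at this
  set B : ℕ := ⌈(2 : ℝ) ^ (1 / ε)⌉₊ with hB
  refine ⟨K ^ B, one_le_pow₀ hK1, ?_⟩
  intro D hD
  have hsmall : ∀ p e : ℕ, 2 ≤ p → ((e : ℝ) + 1) ≤ K * ((p : ℝ) ^ e) ^ ε := by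
    intro p e hp
    have hp' : (2 : ℝ) ≤ p := by exact_mod_cast hp
    have h1 : (2 : ℝ) ^ ((e : ℝ) * ε) ≤ ((p : ℝ) ^ e) ^ ε := by
      rw [← Real.rpow_natCast, ← Real.rpow_mul (by positivity)]
      exact Real.rpow_le_rpow (by norm_num) hp' (by positivity)
    have h2 : 1 + (e : ℝ) * ε * Real.log 2 ≤ (2 : ℝ) ^ ((e : ℝ) * ε) := by
      rw [Real.rpow_def_of_pos (by norm_num)]
      have := Real.add_one_le_exp (Real.log 2 * ((e : ℝ) * ε))
      linarith
    have he : (0 : ℝ) ≤ e := by positivity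
    calc (e : ℝ) + 1 ≤ K * (1 + (e : ℝ) * ε * Real.log 2) := by nlinarith
      _ ≤ K * ((p : ℝ) ^ e) ^ ε := by gcongr; linarith
  have hlarge : ∀ p e : ℕ, B ≤ p → ((e : ℝ) + 1) ≤ ((p : ℝ) ^ e) ^ ε := by
    intro p e hp
    have hp' : (2 : ℝ) ^ (1 / ε) ≤ p := (Nat.le_ceil _).trans (by exact_mod_cast hp)
    have h1 : (2 : ℝ) ^ e ≤ ((p : ℝ) ^ e) ^ ε := by
      calc (2 : ℝ) ^ e = (((2 : ℝ) ^ (1 / ε)) ^ e) ^ ε := by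
            rw [← Real.rpow_natCast (2 ^ (1 / ε)), ← Real.rpow_mul (by positivity),
              ← Real.rpow_mul (by positivity), ← Real.rpow_natCast]
            congr 1
            field_simp
        _ ≤ _ := by gcongr
    have h2 : (e : ℝ) + 1 ≤ 2 ^ e := by
      have := Nat.lt_two_pow_self (n := e)
      exact_mod_cast this
    linarith
  have hDε : (D : ℝ) ^ ε = ∏ p ∈ D.primeFactors, ((p : ℝ) ^ (D.factorization p)) ^ ε := by
    rw [Real.finsetProd_rpow _ _ (fun i _ => by positivity)]
    congr 1
    have := Nat.prod_factorization_pow_eq_self hD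
    rw [Nat.prod_factorization_eq_prod_primeFactors] at this
    exact_mod_cast this.symm
  rw [Nat.card_divisors hD, hDε]
  push_cast
  have hc : ∏ p ∈ D.primeFactors, (if p < B then K else 1) ≤ K ^ B := by
    rw [Finset.prod_ite, Finset.prod_const, Finset.prod_const_one, mul_one]
    refine pow_le_pow_right₀ hK1 ?_
    calc _ ≤ (Finset.range B).card := Finset.card_le_card (by
            intro p hp; simp at hp; simp [hp.2])
      _ = B := by simp
  calc ∏ p ∈ D.primeFactors, ((D.factorization p : ℝ) + 1)
      ≤ ∏ p ∈ D.primeFactors, ((if p < B then K else 1) * ((p : ℝ) ^ (D.factorization p)) ^ ε) := by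
        refine Finset.prod_le_prod (fun i _ => by positivity) fun p hp => ?_
        split_ifs with h
        · exact hsmall p _ (Nat.prime_of_mem_primeFactors hp).two_le
        · rw [one_mul]; exact hlarge p _ (by omega)
    _ = (∏ p ∈ D.primeFactors, (if p < B then K else 1)) * ∏ p ∈ D.primeFactors, ((p : ℝ) ^ (D.factorization p)) ^ ε := Finset.prod_mul_distrib
    _ ≤ _ := by gcongr

lemma xval_le (Pm : Finset ℕ) (p : ℕ) : xval Pm p ≤ p + 1 := by
  unfold xval; split_ifs <;> omega

lemma card_close (Pm J : Finset ℕ) (hm : ∀ p ∈ Pm, p.Prime) (D : ℕ) (hD : D ≠ 0)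
    (Y : ℝ) (hY : 0 ≤ Y) :
    (((J.filter fun p => (xval Pm p : ℝ) ≤ (Nat.gcd (xval Pm p) D) * Y).card : ℕ) : ℝ)
      ≤ 2 * Y * D.divisors.card := by
  have h1 : (J.filter fun p => (xval Pm p : ℝ) ≤ (Nat.gcd (xval Pm p) D) * Y).card
      ≤ (D.divisors ×ˢ (Finset.Icc 1 ⌊Y⌋₊ ×ˢ (Finset.univ : Finset Bool))).card := by
    refine Finset.card_le_card_of_injOn
      (fun p => (Nat.gcd (xval Pm p) D, xval Pm p / Nat.gcd (xval Pm p) D, decide (p ∈ Pm))) ?_ ?_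
    · intro p hp
      simp only [Finset.coe_filter, Set.mem_ofPred_eq] at hp
      have hx := xval_pos Pm hm p
      have hg : 0 < Nat.gcd (xval Pm p) D := Nat.gcd_pos_of_pos_left _ hx
      simp only [Finset.coe_product, Set.mem_prod, Finset.mem_coe, Nat.mem_divisors, Finset.mem_Icc,
        Finset.mem_univ, and_true]
      refine ⟨⟨Nat.gcd_dvd_right _ _, hD⟩, Nat.div_pos (Nat.le_of_dvd hx (Nat.gcd_dvd_left _ _)) hg, ?_⟩
      apply Nat.le_floor
      refine Nat.cast_div_le.trans ?_
      rw [div_le_iff₀ (by exact_mod_cast hg)]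
      linarith [hp.2]
    · intro p hp p' hp' h
      simp only [Prod.mk.injEq] at h
      obtain ⟨h1, h2, h3⟩ := h
      have hx : xval Pm p = xval Pm p' := by
        rw [← Nat.div_mul_cancel (Nat.gcd_dvd_left (xval Pm p) D),
          ← Nat.div_mul_cancel (Nat.gcd_dvd_left (xval Pm p') D), h2, h1]
      have h3' : p ∈ Pm ↔ p' ∈ Pm := by simpa using h3
      unfold xval at hx
      by_cases hq : p ∈ Pm
      · have hq' := h3'.mp hq
        rw [if_pos hq, if_pos hq'] at hx
        have := (hm p hq).two_le
        have := (hm p' hq').two_le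
        omega
      · have hq' : p' ∉ Pm := fun h => hq (h3'.mpr h)
        rw [if_neg hq, if_neg hq'] at hx
        omega
  rw [Finset.card_product, Finset.card_product] at h1
  simp only [Nat.card_Icc, Finset.card_univ, Fintype.card_bool] at h1
  have h2 : ((⌊Y⌋₊ : ℕ) : ℝ) ≤ Y := Nat.floor_le hY
  calc _ ≤ ((D.divisors.card * ((⌊Y⌋₊ + 1 - 1) * 2) : ℕ) : ℝ) := by exact_mod_cast h1
    _ = D.divisors.card * (⌊Y⌋₊ * 2) := by push_cast [Nat.add_sub_cancel]; ring
    _ ≤ D.divisors.card * (Y * 2) := by gcongr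
    _ = _ := by ring

/-- `y_D` -/
noncomputable def yv (Pm J : Finset ℕ) (D : ℕ) : ℝ := ∑ p ∈ J, Real.log (Nat.gcd (xval Pm p) D)

lemma per_D (Pm J : Finset ℕ) (hm : ∀ p ∈ Pm, p.Prime) (D : ℕ) (hD : D ≠ 0)
    (Y : ℝ) (hY : 1 ≤ Y) :
    yv Pm J D + (J.card - 2 * Y * D.divisors.card) * Real.log Y
      ≤ ∑ p ∈ J, Real.log (xval Pm p) := by
  have hlY : 0 ≤ Real.log Y := Real.log_nonneg hY
  have h1 := card_close Pm J hm D hD Y (by linarith)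
  set S := J.filter fun p => (xval Pm p : ℝ) ≤ (Nat.gcd (xval Pm p) D) * Y with hS
  have h2 : ∀ p ∈ J, Real.log (Nat.gcd (xval Pm p) D) + Real.log Y - (if p ∈ S then Real.log Y else 0)
      ≤ Real.log (xval Pm p) := by
    intro p hp
    have hx := xval_pos Pm hm p
    have hg : 0 < Nat.gcd (xval Pm p) D := Nat.gcd_pos_of_pos_left _ hx
    have hg' : (0 : ℝ) < Nat.gcd (xval Pm p) D := by exact_mod_cast hg
    split_ifs with h
    · have : Real.log (Nat.gcd (xval Pm p) D) ≤ Real.log (xval Pm p) :=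
        Real.log_le_log hg' (by exact_mod_cast Nat.le_of_dvd hx (Nat.gcd_dvd_left _ _))
      linarith
    · have h3 : ((Nat.gcd (xval Pm p) D) : ℝ) * Y < xval Pm p := by
        by_contra hc
        exact h (by simp only [hS, Finset.mem_filter]; exact ⟨hp, not_lt.mp hc⟩)
      rw [sub_zero, ← Real.log_mul hg'.ne' (by linarith)]
      exact Real.log_le_log (by positivity) h3.le
  have h3 := Finset.sum_le_sum h2
  rw [Finset.sum_sub_distrib, Finset.sum_add_distrib, Finset.sum_const, ← Finset.sum_filter,
    Finset.sum_const, nsmul_eq_mul, nsmul_eq_mul] at h3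
  have h4 : (J.filter (fun p => p ∈ S)).card ≤ S.card :=
    Finset.card_le_card (fun p hp => (Finset.mem_filter.mp hp).2)
  have h5 : ((J.filter (fun p => p ∈ S)).card : ℝ) ≤ 2 * Y * D.divisors.card :=
    le_trans (by exact_mod_cast h4) h1
  have h6 := mul_le_mul_of_nonneg_right h5 hlY
  unfold yv
  linarith

lemma log_list_prod (l : List ℕ) (h : ∀ b ∈ l, 0 < b) :
    Real.log (l.prod : ℕ) = (l.map fun b : ℕ => Real.log (b : ℝ)).sum := by
  induction l with
  | nil => simp
  | cons b l ih =>
    have hl : 0 < l.prod := List.prod_pos (fun c hc => h c (by simp [hc]))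
    have hb := h b (by simp)
    rw [List.prod_cons, Nat.cast_mul, Real.log_mul (by positivity) (by positivity), ih (fun c hc => h c (by simp [hc]))]
    simp

lemma logE_ge (U : ℝ) (u : ℕ → ℝ) (D : List ℕ) (hpos : ∀ a ∈ D, 0 < a)
    (hch : List.Pairwise (fun a c => c ∣ a) D)
    (hu0 : ∀ a ∈ D, 0 ≤ u a) (huU : ∀ a ∈ D, u a ≤ U) (hul : ∀ a ∈ D, u a ≤ Real.log a) :
    0 < gcdSq D ∧ (D.map u).sum ^ 2 ≤ U * Real.log (gcdSq D) := by
  induction D with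
  | nil => simp [gcdSq]
  | cons a D ih =>
    rw [List.pairwise_cons] at hch
    obtain ⟨i0, i1⟩ := ih (fun b hb => hpos b (by simp [hb])) hch.2 (fun b hb => hu0 b (by simp [hb]))
      (fun b hb => huU b (by simp [hb])) (fun b hb => hul b (by simp [hb]))
    have ha : 0 < a := hpos a (by simp)
    have hDp : 0 < D.prod := List.prod_pos (fun b hb => hpos b (by simp [hb]))
    have e1 : gcdSq (a :: D) = a * D.prod ^ 2 * gcdSq D := by
      unfold gcdSq
      have h1 : D.map (Nat.gcd a) = D := by
        conv_rhs => rw [← List.map_id D]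
        exact List.map_congr_left fun b hb => by
          simpa using Nat.gcd_eq_right (hch.1 b hb)
      have h2 : D.map (fun b => ((a :: D).map (Nat.gcd b)).prod)
          = D.map (fun b => b * (D.map (Nat.gcd b)).prod) := by
        refine List.map_congr_left fun b hb => ?_
        simp only [List.map_cons, List.prod_cons]
        rw [Nat.gcd_eq_left (hch.1 b hb)]
      simp only [List.map_cons, List.prod_cons]
      simp only [List.map_cons, List.prod_cons] at h2
      rw [h2, List.prod_map_mul, h1, List.map_id']
      simp only [Nat.gcd_self]
      ring
    have hpos' : 0 < gcdSq (a :: D) := by rw [e1]; positivity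
    refine ⟨hpos', ?_⟩
    have e2 : Real.log (gcdSq (a :: D)) = Real.log a + 2 * Real.log D.prod + Real.log (gcdSq D) := by
      rw [e1, Nat.cast_mul, Nat.cast_mul, Nat.cast_pow]
      have : (0 : ℝ) < a := by exact_mod_cast ha
      have : (0 : ℝ) < D.prod := by exact_mod_cast hDp
      have : (0 : ℝ) < gcdSq D := by exact_mod_cast i0
      rw [Real.log_mul (by positivity) (by positivity), Real.log_mul (by positivity) (by positivity), Real.log_pow]
      simp
    have e3 : Real.log (D.prod : ℕ) = (D.map fun b : ℕ => Real.log (b : ℝ)).sum :=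
      log_list_prod D (fun b hb => hpos b (by simp [hb]))
    have e4 : (D.map u).sum ≤ Real.log (D.prod : ℕ) := by
      rw [e3]
      exact List.sum_le_sum fun b hb => hul b (by simp [hb])
    have s0 : 0 ≤ (D.map u).sum := List.sum_nonneg (by
      intro x hx
      obtain ⟨b, hb, rfl⟩ := List.mem_map.mp hx
      exact hu0 b (by simp [hb]))
    have a1 := hu0 a (by simp)
    have a2 := huU a (by simp)
    have a3 := hul a (by simp)
    rw [e2, List.map_cons, List.sum_cons]
    have hU : 0 ≤ U := a1.trans a2
    have q1 : u a * u a ≤ U * Real.log a := mul_le_mul a2 a3 a1 hU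
    have q2 : u a * (D.map u).sum ≤ U * Real.log (D.prod : ℕ) := mul_le_mul a2 e4 s0 hU
    nlinarith

lemma opt_ineq (T R Y N : ℝ) (hT : 0 ≤ T) (hR : 0 ≤ R) (hY : 0 < Y) (h : T + R + Y ≤ N) :
    T * R - R ^ 2 * T / Y ≤ (3 - 2 * Real.sqrt 2) / 4 * N ^ 2 := by
  have hs : Real.sqrt 2 ^ 2 = 2 := Real.sq_sqrt (by norm_num)
  set s := Real.sqrt 2
  have hs0 : 0 ≤ s := Real.sqrt_nonneg 2
  have hs1 : s ≤ 3 / 2 := by nlinarith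
  set τ := R / Y with hτ
  have hRτ : R = τ * Y := by rw [hτ]; field_simp
  have hτ0 : 0 ≤ τ := by positivity
  have e1 : T * R - R ^ 2 * T / Y = T * Y * (τ * (1 - τ)) := by
    rw [hRτ]; field_simp
  rw [e1]
  have h1 : τ * (1 - τ) ≤ (3 - 2 * s) * (1 + τ) := by nlinarith [sq_nonneg (τ - (s - 1))]
  have h2 : T * Y * (1 + τ) ≤ N ^ 2 / 4 := by
    have : T + (1 + τ) * Y ≤ N := by rw [hRτ] at h; linarith
    have h0 : 0 ≤ T + (1 + τ) * Y := by positivity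
    nlinarith [sq_nonneg (T - (1 + τ) * Y)]
  have hTY : 0 ≤ T * Y := by positivity
  calc T * Y * (τ * (1 - τ)) ≤ T * Y * ((3 - 2 * s) * (1 + τ)) := by gcongr
    _ = (3 - 2 * s) * (T * Y * (1 + τ)) := by ring
    _ ≤ (3 - 2 * s) * (N ^ 2 / 4) := by
        apply mul_le_mul_of_nonneg_left h2; linarith
    _ = _ := by ring


lemma upper_core (Pm J : Finset ℕ) (hm : ∀ p ∈ Pm, p.Prime) (hJ : ∀ p ∈ J, p.Prime)
    (D : List ℕ) (hpos : ∀ a ∈ D, 0 < a) (hch : List.Pairwise (fun a c => c ∣ a) D)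
    (N L ε R : ℝ) (hN : 1 ≤ N) (hLN : Real.log N = L) (hε : 0 < ε) (hε8 : ε ≤ 1 / 8)
    (hL : 1 ≤ ε * L) (hR : Real.log (D.prod : ℕ) ≤ R)
    (hW : (∑ p ∈ J, Real.log p) + R ≤ N)
    (hdiv : ∀ a : ℕ, a ≠ 0 → Real.log a ≤ L / ε →
      2 * N ^ (1 - ε) * (a.divisors.card : ℝ) * ((1 - ε) * L) ≤ ε * N) :
    0 < gcdSq D ∧ (D.map (yv Pm J)).sum - Real.log (gcdSq D)
      ≤ ((3 - 2 * Real.sqrt 2) / 4 + 4 * ε) * (N ^ 2 / L) := by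
  have hs : Real.sqrt 2 ^ 2 = 2 := Real.sq_sqrt (by norm_num)
  have hs0 : 0 ≤ Real.sqrt 2 := Real.sqrt_nonneg 2
  have hs1 : Real.sqrt 2 ≤ 3 / 2 := by nlinarith
  have hs2 : 7 / 5 ≤ Real.sqrt 2 := by nlinarith
  set c := (3 - 2 * Real.sqrt 2) / 4 with hc
  have hc0 : 0 ≤ c := by rw [hc]; linarith
  have hc1 : c ≤ 1 / 20 := by rw [hc]; linarith
  have hL0 : 0 < L := by
    by_contra h; push Not at h; nlinarith
  set t : ℝ := (J.card : ℝ) with ht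
  set W := ∑ p ∈ J, Real.log (p : ℝ) with hWdef
  have hDp : 1 ≤ D.prod := List.prod_pos (fun b hb => hpos b hb)
  have hDl0 : 0 ≤ Real.log (D.prod : ℕ) := Real.log_nonneg (by exact_mod_cast hDp)
  have hR0 : 0 ≤ R := hDl0.trans hR
  have hW0 : 0 ≤ W := Finset.sum_nonneg fun p hp => Real.log_nonneg (by exact_mod_cast (hJ p hp).one_lt.le)
  have htW : t ≤ 2 * W := by
    have : ∑ p ∈ J, (1 / 2 : ℝ) ≤ W := Finset.sum_le_sum fun p hp => by
      have h2 : Real.log 2 ≤ Real.log p := Real.log_le_log (by norm_num) (by exact_mod_cast (hJ p hp).two_le)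
      linarith [Real.log_two_gt_d9]
    rw [Finset.sum_const, nsmul_eq_mul] at this
    linarith
  have hX : ∑ p ∈ J, Real.log (xval Pm p) ≤ W + t := by
    have : ∑ p ∈ J, Real.log (xval Pm p) ≤ ∑ p ∈ J, (Real.log p + 1) := Finset.sum_le_sum fun p hp => by
      have hp2 : (2 : ℝ) ≤ p := by exact_mod_cast (hJ p hp).two_le
      have h1 : (xval Pm p : ℝ) ≤ p * Real.exp 1 := by
        have h2 : (xval Pm p : ℝ) ≤ p + 1 := by exact_mod_cast xval_le Pm p
        have h3 := Real.add_one_le_exp 1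
        nlinarith
      have h4 : (0 : ℝ) < xval Pm p := by exact_mod_cast xval_pos Pm hm p
      have := Real.log_le_log h4 h1
      rwa [Real.log_mul (by linarith) (Real.exp_pos 1).ne', Real.log_exp] at this
    rw [Finset.sum_add_distrib, Finset.sum_const, nsmul_eq_mul, mul_one] at this
    exact this
  have ht0 : 0 ≤ t := by positivity
  have htL : t ≤ ε * L * t := by nlinarith
  set θ := 1 - 2 * ε with hθ
  have hθ0 : 0 < θ := by rw [hθ]; linarith
  have hsmall : ∀ a : ℕ, a ≠ 0 → Real.log a ≤ L / ε → yv Pm J a ≤ W - θ * L * t + ε * N := by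
    intro a ha hal
    have h1 := per_D Pm J hm a ha (N ^ (1 - ε)) (Real.one_le_rpow hN (by linarith))
    rw [Real.log_rpow (by linarith), hLN] at h1
    have h2 := hdiv a ha hal
    rw [hθ]
    nlinarith
  have hy1 : yv Pm J 1 = 0 := by simp [yv]
  have hY0 := hsmall 1 one_ne_zero (by simp; positivity)
  rw [hy1] at hY0
  set Y0 := W - θ * L * t + 2 * ε * N with hY0d
  have hY0p : 0 < Y0 := by
    have : 0 < ε * N := by positivity
    rw [hY0d]; linarith
  have hyt : ∀ a : ℕ, 0 < a → yv Pm J a ≤ t * Real.log a := by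
    intro a ha
    unfold yv
    rw [ht, ← nsmul_eq_mul, ← Finset.sum_const]
    refine Finset.sum_le_sum fun p hp => ?_
    have hg : 0 < Nat.gcd (xval Pm p) a := Nat.gcd_pos_of_pos_right _ ha
    exact Real.log_le_log (by exact_mod_cast hg) (by exact_mod_cast Nat.le_of_dvd ha (Nat.gcd_dvd_right _ _))
  have hyb : ∀ a : ℕ, 0 < a → yv Pm J a ≤ 3 * N := by
    intro a ha
    have : yv Pm J a ≤ ∑ p ∈ J, Real.log (xval Pm p) := by
      refine Finset.sum_le_sum fun p hp => ?_
      have hx := xval_pos Pm hm p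
      have hg : 0 < Nat.gcd (xval Pm p) a := Nat.gcd_pos_of_pos_right _ ha
      exact Real.log_le_log (by exact_mod_cast hg) (by exact_mod_cast Nat.le_of_dvd hx (Nat.gcd_dvd_left _ _))
    linarith
  have hlpos : ∀ a ∈ D, 0 ≤ Real.log a := fun a ha => Real.log_nonneg (by exact_mod_cast hpos a ha)
  rcases ht0.eq_or_lt with h0 | h0
  · have hJe : J = ∅ := by
      rw [← Finset.card_eq_zero]; rw [ht] at h0; exact_mod_cast h0.symm
    have hge := logE_ge 0 (fun _ => 0) D hpos hch (by simp) (by simp) hlpos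
    refine ⟨hge.1, ?_⟩
    have : (D.map (yv Pm J)).sum = 0 := by
      refine List.sum_eq_zero ?_
      intro x hx
      obtain ⟨a, ha, rfl⟩ := List.mem_map.mp hx
      simp [yv, hJe]
    rw [this]
    have h1 : 0 ≤ Real.log (gcdSq D) := Real.log_nonneg (by exact_mod_cast hge.1)
    have : 0 ≤ (c + 4 * ε) * (N ^ 2 / L) := by positivity
    linarith
  · set u : ℕ → ℝ := fun a => if Real.log a ≤ L / ε then min (Real.log a) (Y0 / t) else 0 with hu
    have hu0 : ∀ a ∈ D, 0 ≤ u a := by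
      intro a ha
      simp only [hu]; split_ifs
      · exact le_min (hlpos a ha) (by positivity)
      · exact le_rfl
    have huU : ∀ a ∈ D, u a ≤ Y0 / t := by
      intro a ha
      simp only [hu]; split_ifs
      · exact min_le_right _ _
      · positivity
    have hul : ∀ a ∈ D, u a ≤ Real.log a := by
      intro a ha
      simp only [hu]; split_ifs
      · exact min_le_left _ _
      · exact hlpos a ha
    obtain ⟨hg, hge⟩ := logE_ge (Y0 / t) u D hpos hch hu0 huU hul
    refine ⟨hg, ?_⟩
    set R1 := (D.map u).sum with hR1
    have hR10 : 0 ≤ R1 := List.sum_nonneg (by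
      intro x hx
      obtain ⟨b, hb, rfl⟩ := List.mem_map.mp hx
      exact hu0 b hb)
    have hR1R : R1 ≤ R := by
      refine le_trans ?_ hR
      rw [log_list_prod D hpos]
      exact List.sum_le_sum fun b hb => hul b hb
    have hsum : (D.map (yv Pm J)).sum ≤ t * R1 + 3 * ε * N / L * R := by
      have h1 : (D.map (yv Pm J)).sum ≤ (D.map fun a => t * u a + 3 * ε * N / L * Real.log a).sum := by
        refine List.sum_le_sum fun a ha => ?_
        by_cases h : Real.log a ≤ L / ε
        · have h3 : yv Pm J a ≤ t * u a := by
            simp only [hu, if_pos h]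
            rcases le_total (Real.log a) (Y0 / t) with h4 | h4
            · rw [min_eq_left h4]; exact hyt a (hpos a ha)
            · rw [min_eq_right h4, mul_div_cancel₀ _ h0.ne']
              have := hsmall a (hpos a ha).ne' h
              have h5 : 0 < ε * N := by positivity
              rw [hY0d]; linarith
          have : 0 ≤ 3 * ε * N / L * Real.log a := mul_nonneg (by positivity) (hlpos a ha)
          linarith
        · simp only [hu, if_neg h, mul_zero, zero_add]
          push Not at h
          refine (hyb a (hpos a ha)).trans ?_
          calc 3 * N = 3 * ε * N / L * (L / ε) := by field_simp
            _ ≤ _ := by gcongr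
      refine h1.trans ?_
      rw [List.sum_map_add, List.sum_map_mul_left, List.sum_map_mul_left, ← log_list_prod D hpos]
      gcongr
    have hopt := opt_ineq (θ * L * t) R1 Y0 (N * (1 + 2 * ε)) (by positivity) hR10 hY0p (by
      rw [hY0d]; nlinarith)
    have hge2 : R1 ^ 2 * t / Y0 ≤ Real.log (gcdSq D) := by
      rw [div_le_iff₀ hY0p]
      have := mul_le_mul_of_nonneg_right hge h0.le
      calc R1 ^ 2 * t ≤ Y0 / t * Real.log (gcdSq D) * t := this
        _ = _ := by field_simp
    have hRN : R ≤ N := by linarith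
    have h2 : 3 * ε * N / L * R ≤ 3 * ε * (N ^ 2 / L) := by
      calc 3 * ε * N / L * R ≤ 3 * ε * N / L * N := by gcongr
        _ = _ := by ring
    have h3 : t * R1 - R1 ^ 2 * t / Y0 ≤ c * (1 + 2 * ε) ^ 2 / θ * (N ^ 2 / L) := by
      have : (θ * L) * (t * R1 - R1 ^ 2 * t / Y0) ≤ (θ * L) * (c * (1 + 2 * ε) ^ 2 / θ * (N ^ 2 / L)) := by
        calc (θ * L) * (t * R1 - R1 ^ 2 * t / Y0) = θ * L * t * R1 - R1 ^ 2 * (θ * L * t) / Y0 := by ring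
          _ ≤ _ := hopt
          _ = _ := by rw [← hc]; field_simp
      exact le_of_mul_le_mul_left this (by positivity)
    have h4 : c * (1 + 2 * ε) ^ 2 / θ ≤ c + ε := by
      rw [div_le_iff₀ hθ0, hθ]
      have k1 : c * ε ≤ 1 / 20 * ε := by gcongr
      have k2 : ε * ε ≤ 1 / 8 * ε := by gcongr
      have k3 : c * ε * ε ≤ 1 / 20 * ε * (1 / 8) := by gcongr
      linarith
    have h5 : 0 ≤ N ^ 2 / L := by positivity
    have h6 := mul_le_mul_of_nonneg_right h4 h5
    linarith

lemma upper_eventually (η : ℝ) (hη : 0 < η) : ∀ᶠ n : ℕ in atTop,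
    ∀ Pm Pp : Finset ℕ, (∀ p ∈ Pm, p.Prime) → (∀ p ∈ Pp, p.Prime) → Disjoint Pm Pp →
    ∀ r : ℕ, 0 < r → r * ∏ p ∈ Pm ∪ Pp, p ≤ n →
    Real.log (subCount r
      ((∀ p : Pm, Multiplicative (ZMod (p.1 - 1))) ×
       (∀ p : Pp, Multiplicative (ZMod (p.1 + 1))))) ≤
      ((3 - 2 * Real.sqrt 2) / 4 + η) * ((Real.log n) ^ 2 / Real.log (Real.log n)) := by
  obtain ⟨ε, hε, hε8, hεη⟩ : ∃ ε : ℝ, 0 < ε ∧ ε ≤ 1 / 8 ∧ 5 * ε ≤ η :=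
    ⟨min (η / 5) (1 / 8), by positivity, min_le_right _ _, by
      have := min_le_left (η / 5) (1 / 8); linarith⟩
  obtain ⟨C, hC1, hC⟩ := divisor_bound (ε ^ 2 / 2) (by positivity)
  have hlogn : Tendsto (fun n : ℕ => Real.log (n : ℝ)) atTop atTop :=
    Real.tendsto_log_atTop.comp tendsto_natCast_atTop_atTop
  have e1 : ∀ᶠ N : ℝ in atTop, 1 ≤ ε * Real.log N := by
    filter_upwards [Real.tendsto_log_atTop.eventually_ge_atTop (1 / ε)] with N hN
    rw [div_le_iff₀ hε] at hN; linarith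
  have e2 : ∀ᶠ N : ℝ in atTop, 2 * C * Real.log N ≤ ε * N ^ (ε / 2) := by
    have := (isLittleO_log_rpow_atTop (r := ε / 2) (by positivity)).bound
      (show (0 : ℝ) < ε / (2 * C) by positivity)
    filter_upwards [this, eventually_ge_atTop 1] with N hN hN1
    rw [Real.norm_of_nonneg (Real.log_nonneg hN1), Real.norm_of_nonneg (by positivity)] at hN
    calc 2 * C * Real.log N ≤ 2 * C * (ε / (2 * C) * N ^ (ε / 2)) := by gcongr
      _ = _ := by field_simp
  have e3 : ∀ᶠ N : ℝ in atTop, 3 * Real.log N ≤ ε * N := by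
    have := Real.isLittleO_log_id_atTop.bound (show (0 : ℝ) < ε / 3 by positivity)
    filter_upwards [this, eventually_ge_atTop 1] with N hN hN1
    rw [Real.norm_of_nonneg (Real.log_nonneg hN1), id, Real.norm_of_nonneg (by positivity)] at hN
    linarith
  filter_upwards [hlogn.eventually (e1.and (e2.and (e3.and (eventually_ge_atTop 1))))] with n hn
  obtain ⟨f1, f2, f3, f4⟩ := hn
  intro Pm Pp hm hp hd r hr hrn
  obtain ⟨D, hpos, hch, hprod, hle⟩ := upper_algebra Pm Pp hm hd r hr
  set k := subCount r
      ((∀ p : Pm, Multiplicative (ZMod (p.1 - 1))) ×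
       (∀ p : Pp, Multiplicative (ZMod (p.1 + 1)))) with hk
  set N := Real.log (n : ℝ) with hN
  set L := Real.log N with hL
  have hL0 : 0 < L := by
    by_contra h; push Not at h; nlinarith
  have hJ : ∀ p ∈ Pm ∪ Pp, p.Prime := by
    intro p h
    rcases Finset.mem_union.mp h with h | h
    · exact hm p h
    · exact hp p h
  have hr' : (0 : ℝ) < r := by exact_mod_cast hr
  have hDp : 1 ≤ D.prod := List.prod_pos (fun b hb => hpos b hb)
  have hPpos : 0 < ∏ p ∈ Pm ∪ Pp, p := Finset.prod_pos fun p h => (hJ p h).pos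
  have hW : (∑ p ∈ Pm ∪ Pp, Real.log p) + Real.log r ≤ N := by
    have h1 : Real.log ((r * ∏ p ∈ Pm ∪ Pp, p : ℕ) : ℝ) ≤ N :=
      Real.log_le_log (by exact_mod_cast Nat.mul_pos hr hPpos) (by exact_mod_cast hrn)
    rw [Nat.cast_mul, Real.log_mul hr'.ne' (by exact_mod_cast hPpos.ne'), Nat.cast_prod,
      Real.log_prod (fun p h => by exact_mod_cast (hJ p h).ne_zero)] at h1
    linarith
  obtain ⟨hg, hcore⟩ := upper_core Pm (Pm ∪ Pp) hm hJ D hpos hch N L ε (Real.log r) f4 rfl hε hε8 f1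
    (Real.log_le_log (by exact_mod_cast hDp) (by exact_mod_cast hprod)) hW (by
      intro a ha hal
      have ha' : (0 : ℝ) < a := by exact_mod_cast Nat.pos_of_ne_zero ha
      have hN0 : 0 < N := by linarith
      have h1 : (a : ℝ) ^ (ε ^ 2 / 2) ≤ N ^ (ε / 2) := by
        rw [Real.rpow_def_of_pos ha', Real.rpow_def_of_pos hN0]
        apply Real.exp_le_exp.mpr
        calc Real.log a * (ε ^ 2 / 2) ≤ L / ε * (ε ^ 2 / 2) := by gcongr
          _ = L * (ε / 2) := by field_simp
      have h2 : (a.divisors.card : ℝ) ≤ C * N ^ (ε / 2) := (hC a ha).trans (by gcongr)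
      calc 2 * N ^ (1 - ε) * (a.divisors.card : ℝ) * ((1 - ε) * L)
          ≤ 2 * N ^ (1 - ε) * (C * N ^ (ε / 2)) * (1 * L) := by
            have h8 : (0 : ℝ) ≤ 1 - ε := by linarith
            gcongr
            linarith
        _ = N ^ (1 - ε) * N ^ (ε / 2) * (2 * C * L) := by ring
        _ ≤ N ^ (1 - ε) * N ^ (ε / 2) * (ε * N ^ (ε / 2)) := by gcongr
        _ = ε * (N ^ (1 - ε) * N ^ (ε / 2) * N ^ (ε / 2)) := by ring
        _ = ε * N := by
          rw [← Real.rpow_add hN0, ← Real.rpow_add hN0]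
          ring_nf
          rw [Real.rpow_one])
  have hs : Real.sqrt 2 ^ 2 = 2 := Real.sq_sqrt (by norm_num)
  have hs0 : 0 ≤ Real.sqrt 2 := Real.sqrt_nonneg 2
  have hs1 : Real.sqrt 2 ≤ 3 / 2 := by nlinarith
  rcases Nat.eq_zero_or_pos k with h0 | h0
  · rw [h0, Nat.cast_zero, Real.log_zero]
    apply mul_nonneg
    · linarith
    · positivity
  have hlist : Real.log (((D.map fun a => ∏ p ∈ Pm ∪ Pp, Nat.gcd (xval Pm p) a).prod : ℕ) : ℝ)
      = (D.map (yv Pm (Pm ∪ Pp))).sum := by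
    rw [log_list_prod]
    · rw [List.map_map]
      congr 1
      refine List.map_congr_left fun a ha => ?_
      simp only [Function.comp, yv]
      rw [Nat.cast_prod, Real.log_prod]
      intro p _
      have := Nat.gcd_pos_of_pos_right (xval Pm p) (hpos a ha)
      exact_mod_cast this.ne'
    · intro b hb
      obtain ⟨a, ha, rfl⟩ := List.mem_map.mp hb
      exact Finset.prod_pos fun p _ => Nat.gcd_pos_of_pos_right _ (hpos a ha)
  have hlogle : Real.log k + Real.log (gcdSq D) ≤ 3 * Real.log r + (D.map (yv Pm (Pm ∪ Pp))).sum := by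
    have hk0 : (0 : ℝ) < k := by exact_mod_cast h0
    have hg0 : (0 : ℝ) < gcdSq D := by exact_mod_cast hg
    have hl0 : 0 < (D.map fun a => ∏ p ∈ Pm ∪ Pp, Nat.gcd (xval Pm p) a).prod := by
      apply List.prod_pos
      intro b hb
      obtain ⟨a, ha, rfl⟩ := List.mem_map.mp hb
      exact Finset.prod_pos fun p _ => Nat.gcd_pos_of_pos_right _ (hpos a ha)
    rw [← hlist, ← Real.log_mul hk0.ne' hg0.ne']
    have h3 : 3 * Real.log r = Real.log ((r : ℝ) ^ 3) := by rw [Real.log_pow]; norm_num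
    rw [h3, ← Real.log_mul (by positivity) (by exact_mod_cast hl0.ne')]
    exact Real.log_le_log (by positivity) (by exact_mod_cast hle)
  have hWn : 0 ≤ ∑ p ∈ Pm ∪ Pp, Real.log (p : ℝ) :=
    Finset.sum_nonneg fun p h => Real.log_nonneg (by exact_mod_cast (hJ p h).one_lt.le)
  have h3N : 3 * N ≤ ε * (N ^ 2 / L) := by
    rw [← mul_div_assoc, le_div_iff₀ hL0]
    nlinarith
  have h5 : 0 ≤ N ^ 2 / L := by positivity
  have h6 := mul_le_mul_of_nonneg_right hεη h5
  linarith

lemma upper_final (η : ℝ) (hη : 0 < η) : ∀ᶠ n : ℕ in atTop,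
    Real.log (extremalF n) / ((Real.log n) ^ 2 / Real.log (Real.log n))
      ≤ (3 - 2 * Real.sqrt 2) / 4 + η := by
  have hlogn : Tendsto (fun n : ℕ => Real.log (n : ℝ)) atTop atTop :=
    Real.tendsto_log_atTop.comp tendsto_natCast_atTop_atTop
  filter_upwards [upper_eventually η hη, hlogn.eventually_ge_atTop 3,
    eventually_ge_atTop 1] with n hn h3 hn1
  have hL : 0 < Real.log (Real.log n) := Real.log_pos (by linarith)
  have hpos : 0 < (Real.log n) ^ 2 / Real.log (Real.log n) := by positivity
  rw [div_le_iff₀ hpos]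
  set B := ((3 - 2 * Real.sqrt 2) / 4 + η) * ((Real.log n) ^ 2 / Real.log (Real.log n)) with hB
  have hbound : ∀ k ∈ {k : ℕ | ∃ Pm Pp : Finset ℕ, (∀ p ∈ Pm, p.Prime) ∧ (∀ p ∈ Pp, p.Prime) ∧
    Disjoint Pm Pp ∧ ∃ r : ℕ, 0 < r ∧ r * ∏ p ∈ Pm ∪ Pp, p ≤ n ∧
    k = subCount r
      ((∀ p : Pm, Multiplicative (ZMod (p.1 - 1))) ×
       (∀ p : Pp, Multiplicative (ZMod (p.1 + 1))))}, Real.log k ≤ B := by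
    rintro k ⟨Pm, Pp, h1, h2, h3, r, h4, h5, rfl⟩
    exact hn Pm Pp h1 h2 h3 r h4 h5
  refine hbound _ (Nat.sSup_mem ?_ ?_)
  · exact ⟨_, ∅, ∅, by simp, by simp, by simp, 1, one_pos, by simpa using hn1, rfl⟩
  · refine ⟨⌈Real.exp B⌉₊, ?_⟩
    intro k hk
    have h1 := hbound k hk
    rcases Nat.eq_zero_or_pos k with h0 | h0
    · omega
    · have : (k : ℝ) ≤ Real.exp B := by
        rw [← Real.log_le_iff_le_exp (by exact_mod_cast h0)]; exact h1
      exact_mod_cast this.trans (Nat.le_ceil _)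


lemma lower_algebra (q : ℕ) (hq : q.Prime) (P : Finset ℕ) (hP : ∀ p ∈ P, p.Prime)
    (hPq : ∀ p ∈ P, q ∣ p - 1) (t : ℕ) (ht : t ≤ P.card) :
    q ^ (t * (P.card - t)) ≤ subCount (q ^ t)
      ((∀ p : P, Multiplicative (ZMod (p.1 - 1))) ×
       (∀ p : (∅ : Finset ℕ), Multiplicative (ZMod (p.1 + 1)))) := by
  classical
  have : Fact q.Prime := ⟨hq⟩
  have i1 : ∀ p : P, NeZero (p.1 - 1) := fun p => ⟨by
    have := (hP p.1 p.2).two_le; omega⟩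
  obtain ⟨T, hT⟩ : ∃ T : Finset P, T.card = t := by
    obtain ⟨T, -, hT⟩ := Finset.exists_subset_card_eq (s := (Finset.univ : Finset P)) (n := t) (by simpa using ht)
    exact ⟨T, hT⟩
  let X := ((∀ p : P, Multiplicative (ZMod (p.1 - 1))) ×
       (∀ p : (∅ : Finset ℕ), Multiplicative (ZMod (p.1 + 1))))
  let φ : ∀ p : P, ZMod (p.1 - 1) →+* ZMod q := fun p => ZMod.castHom (hPq p.1 p.2) (ZMod q)
  have hφ : ∀ p : P, Function.Surjective (φ p) := fun p => ZMod.ringHom_surjective _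
  choose g hg using hφ
  let Φ : ({p : P // p ∈ T} → {p : P // p ∉ T} → ZMod q) → (X →* Multiplicative ({p : P // p ∈ T} → ZMod q)) :=
    fun M =>
    { toFun := fun x => Multiplicative.ofAdd (fun i => φ i.1 (x.1 i.1).toAdd - ∑ j, M i j * φ j.1 (x.1 j.1).toAdd)
      map_one' := by
        rw [← ofAdd_zero]
        congr 1
        funext i
        simp [X]
      map_mul' := by
        intro x y
        rw [← ofAdd_add]
        congr 1
        funext i
        simp only [X, Prod.fst_mul, Pi.mul_apply, toAdd_mul, map_add, mul_add, Finset.sum_add_distrib, Pi.add_apply]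
        ring }
  have hmem : ∀ M x, x ∈ (Φ M).ker ↔ ∀ i : {p : P // p ∈ T}, φ i.1 (x.1 i.1).toAdd = ∑ j, M i j * φ j.1 (x.1 j.1).toAdd := by
    intro M x
    rw [MonoidHom.mem_ker]
    constructor
    · intro h i
      have h2 : (Multiplicative.toAdd (Φ M x)) i = 0 := by rw [h]; rfl
      exact sub_eq_zero.mp h2
    · intro h
      apply Multiplicative.toAdd.injective
      funext i
      exact sub_eq_zero.mpr (h i)
  have hidx : ∀ M, (Φ M).ker.index ≤ q ^ t := by
    intro M
    rw [Subgroup.index_ker]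
    refine (Nat.card_le_card_of_injective _ Subtype.val_injective).trans ?_
    rw [Nat.card_congr Multiplicative.toAdd, Nat.card_pi]
    simp [hT]
  have hinj : Function.Injective (fun M => (⟨(Φ M).ker, hidx M⟩ : {H : Subgroup X // H.index ≤ q ^ t})) := by
    intro M M' h
    simp only [Subtype.mk.injEq] at h
    funext i j
    have hj : j.1 ∉ T := j.2
    let x : X := (fun p => Multiplicative.ofAdd (if h : p ∈ T then g p (M ⟨p, h⟩ j) else if p = j.1 then g p 1 else 0), 1)
    have hx1 : ∀ i : {p : P // p ∈ T}, φ i.1 (x.1 i.1).toAdd = M i j := by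
      intro i
      have hi : i.1 ∈ T := i.2
      simp only [x, toAdd_ofAdd, dif_pos hi]
      exact hg _ _
    have hx2 : ∀ M : ({p : P // p ∈ T} → {p : P // p ∉ T} → ZMod q), ∀ i, ∑ k, M i k * φ k.1 (x.1 k.1).toAdd = M i j := by
      intro M i
      rw [Finset.sum_eq_single j]
      · simp only [x, toAdd_ofAdd, dif_neg hj, if_true, hg, mul_one]
      · intro k _ hk
        have hk' : k.1 ∉ T := k.2
        have hk2 : k.1 ≠ j.1 := fun h => hk (Subtype.ext h)
        simp only [x, toAdd_ofAdd, dif_neg hk', if_neg hk2, map_zero, mul_zero]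
      · simp
    have h1 : x ∈ (Φ M).ker := by
      rw [hmem]; intro i; rw [hx1, hx2]
    rw [h, hmem] at h1
    have := h1 i
    rw [hx1, hx2] at this
    exact this
  have : Finite X := by
    refine @Finite.instProd _ _ ?_ ?_ <;> exact inferInstance
  have := Nat.card_le_card_of_injective _ hinj
  refine le_trans (le_of_eq ?_) this
  rw [Nat.card_pi]
  simp only [Nat.card_pi, Nat.card_zmod, Finset.prod_const, Finset.card_univ, Fintype.card_ofFinset]
  rw [← pow_mul]
  congr 1
  have h9 : Fintype.card {p : P // p ∉ T} = P.card - t := by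
    rw [Fintype.card_subtype_compl]; simp [hT]
  rw [h9]
  simp [hT, mul_comm]


lemma le_extremalF : ∀ᶠ n : ℕ in atTop,
    ∀ Pm Pp : Finset ℕ, (∀ p ∈ Pm, p.Prime) → (∀ p ∈ Pp, p.Prime) → Disjoint Pm Pp →
    ∀ r : ℕ, 0 < r → r * ∏ p ∈ Pm ∪ Pp, p ≤ n →
    subCount r
      ((∀ p : Pm, Multiplicative (ZMod (p.1 - 1))) ×
       (∀ p : Pp, Multiplicative (ZMod (p.1 + 1)))) ≤ extremalF n := by
  filter_upwards [upper_eventually 1 one_pos] with n hn Pm Pp h1 h2 h3 r h4 h5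
  refine le_csSup ?_ ⟨Pm, Pp, h1, h2, h3, r, h4, h5, rfl⟩
  refine ⟨⌈Real.exp (((3 - 2 * Real.sqrt 2) / 4 + 1) * ((Real.log n) ^ 2 / Real.log (Real.log n)))⌉₊, ?_⟩
  rintro k ⟨Pm, Pp, h1, h2, h3, r, h4, h5, rfl⟩
  have h6 := hn Pm Pp h1 h2 h3 r h4 h5
  rcases Nat.eq_zero_or_pos (subCount r
      ((∀ p : Pm, Multiplicative (ZMod (p.1 - 1))) ×
       (∀ p : Pp, Multiplicative (ZMod (p.1 + 1))))) with h0 | h0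
  · omega
  · rw [Real.log_le_iff_le_exp (by exact_mod_cast h0)] at h6
    exact_mod_cast h6.trans (Nat.le_ceil _)

/-- Many primes congruent to one modulo a suitable prime of size about `x ^ ρ`. -/
def PrimesAP (ρ : ℝ) : Prop := ∀ ε : ℝ, 0 < ε → ∀ᶠ x : ℕ in atTop, ∃ q : ℕ, q.Prime ∧
  (x : ℝ) ^ (ρ - ε) ≤ q ∧ (q : ℝ) ≤ (x : ℝ) ^ ρ ∧
  (x : ℝ) ^ (1 - ρ - ε) ≤ ((Finset.range (x + 1)).filter fun p => p.Prime ∧ q ∣ p - 1).card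

set_option maxHeartbeats 800000 in
lemma lower_freq (h : PrimesAP (Real.sqrt 2 - 1)) (η : ℝ) (hη : 0 < η) : ∃ᶠ n : ℕ in atTop,
    (3 - 2 * Real.sqrt 2) / 4 - η ≤
    Real.log (extremalF n) / ((Real.log n) ^ 2 / Real.log (Real.log n)) := by
  have hs : Real.sqrt 2 ^ 2 = 2 := Real.sq_sqrt (by norm_num)
  have hs0 : 0 ≤ Real.sqrt 2 := Real.sqrt_nonneg 2
  have hs1 : Real.sqrt 2 ≤ 71 / 50 := by nlinarith
  have hs2 : 7 / 5 ≤ Real.sqrt 2 := by nlinarith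
  set ρ := Real.sqrt 2 - 1 with hρ
  have hρ1 : ρ ≤ 21 / 50 := by linarith
  have hρ2 : 2 / 5 ≤ ρ := by linarith
  obtain ⟨ε, hε, hε8, hval⟩ : ∃ ε : ℝ, 0 < ε ∧ ε ≤ 1 / 10 ∧
      (3 - 2 * Real.sqrt 2) / 4 - η ≤ (ρ - ε) * (1 - ρ) * (ρ - ε) * (1 - ρ - 2 * ε) / (1 + ρ * ρ) ^ 2 := by
    have hcont : Continuous fun ε : ℝ => (ρ - ε) * (1 - ρ) * (ρ - ε) * (1 - ρ - 2 * ε) / (1 + ρ * ρ) ^ 2 := by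
      fun_prop
    have h0 : (ρ - 0) * (1 - ρ) * (ρ - 0) * (1 - ρ - 2 * 0) / (1 + ρ * ρ) ^ 2 = (3 - 2 * Real.sqrt 2) / 4 := by
      have : (0 : ℝ) < (1 + ρ * ρ) ^ 2 := by positivity
      rw [div_eq_iff this.ne', hρ]
      set s := Real.sqrt 2
      have hs3 : s ^ 3 = 2 * s := by rw [pow_succ, hs]
      have hs4 : s ^ 4 = 4 := by nlinarith
      have hs5 : s ^ 5 = 4 * s := by rw [pow_succ, hs4]
      ring_nf
      rw [hs5, hs4, hs3, hs]
      ring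
    have ht := hcont.tendsto 0
    simp only [h0] at ht
    have h1 : ∀ᶠ ε : ℝ in nhdsWithin 0 (Set.Ioi 0), (3 - 2 * Real.sqrt 2) / 4 - η ≤
        (ρ - ε) * (1 - ρ) * (ρ - ε) * (1 - ρ - 2 * ε) / (1 + ρ * ρ) ^ 2 :=
      nhdsWithin_le_nhds ((ht.eventually (eventually_gt_nhds (by linarith : _ - η < _))).mono fun _ h => h.le)
    have h2 : ∀ᶠ ε : ℝ in nhdsWithin 0 (Set.Ioi 0), ε ≤ 1 / 10 :=
      nhdsWithin_le_nhds ((eventually_lt_nhds (by norm_num)).mono fun _ h => h.le)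
    obtain ⟨ε, h3, h4, h5⟩ := (h1.and (h2.and self_mem_nhdsWithin)).exists
    exact ⟨ε, h5, h4, h3⟩
  rw [frequently_atTop]
  intro n0
  obtain ⟨n1, hn1⟩ := eventually_atTop.mp le_extremalF
  have hα : 0 < 1 - ρ - ε := by linarith
  have t1 : Tendsto (fun x : ℕ => (x : ℝ) ^ (1 - ρ - ε)) atTop atTop :=
    (tendsto_rpow_atTop hα).comp tendsto_natCast_atTop_atTop
  have t2 : Tendsto (fun n : ℕ => Real.log (n : ℝ)) atTop atTop :=
    Real.tendsto_log_atTop.comp tendsto_natCast_atTop_atTop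
  obtain ⟨x, hx, hx1, hx2⟩ := ((h ε hε).and ((t1.eventually_ge_atTop (n0 + n1 + 1 / ε + 20)).and
    (t2.eventually_ge_atTop (2 / ε)))).exists
  obtain ⟨q, hq, hq1, hq2, hcard⟩ := hx
  set l := Real.log (x : ℝ) with hl
  have hl0 : 0 < l := lt_of_lt_of_le (by positivity) hx2
  have hx0 : (0 : ℝ) < x := by
    rcases Nat.eq_zero_or_pos x with h0 | h0
    · rw [hl, h0] at hl0; simp at hl0
    · exact_mod_cast h0
  have hinv : 0 < 1 / ε := by positivity
  set K := ⌊(x : ℝ) ^ (1 - ρ - ε)⌋₊ with hK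
  have hK1 : (K : ℝ) ≤ (x : ℝ) ^ (1 - ρ - ε) := Nat.floor_le (by positivity)
  have hK2 : (x : ℝ) ^ (1 - ρ - ε) < K + 1 := Nat.lt_floor_add_one _
  obtain ⟨P, hPs, hPc⟩ := Finset.exists_subset_card_eq (s := (Finset.range (x + 1)).filter fun p => p.Prime ∧ q ∣ p - 1)
    (n := K) (by exact_mod_cast hK1.trans hcard)
  have hP : ∀ p ∈ P, p ≤ x ∧ p.Prime ∧ q ∣ p - 1 := by
    intro p hp
    have := hPs hp
    simp only [Finset.mem_filter, Finset.mem_range] at this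
    exact ⟨by omega, this.2⟩
  have hKpos : (0 : ℝ) < K := by
    have : (0 : ℝ) ≤ n0 + n1 := by positivity
    linarith
  set t := ⌊ρ * K⌋₊ with ht
  have ht1 : (t : ℝ) ≤ ρ * K := Nat.floor_le (by positivity)
  have ht2 : ρ * K < t + 1 := Nat.lt_floor_add_one _
  have htK : t ≤ K := by
    have : (t : ℝ) ≤ K := ht1.trans (by nlinarith)
    exact_mod_cast this
  have hlow := lower_algebra q hq P (fun p hp => (hP p hp).2.1) (fun p hp => (hP p hp).2.2) t (by omega)
  rw [hPc] at hlow
  set n := q ^ t * ∏ p ∈ P, p with hn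
  have hprod2 : 2 ^ K ≤ ∏ p ∈ P, p := by
    rw [← hPc]
    exact Finset.pow_card_le_prod _ _ _ fun p hp => (hP p hp).2.1.two_le
  have hqt : 1 ≤ q ^ t := Nat.one_le_pow _ _ hq.pos
  have hn2K : 2 ^ K ≤ n := hprod2.trans (Nat.le_mul_of_pos_left _ hqt)
  have hKn : n0 + n1 ≤ K := by
    have : ((n0 + n1 : ℕ) : ℝ) ≤ K := by push_cast; linarith
    exact_mod_cast this
  have hKlt : K < 2 ^ K := Nat.lt_two_pow_self
  refine ⟨n, by omega, ?_⟩
  have hex := hn1 n (by omega) P ∅ (fun p hp => (hP p hp).2.1) (by simp) (by simp) (q ^ t) hqt (by simp [hn])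
  have hge : q ^ (t * (K - t)) ≤ extremalF n := hlow.trans hex
  have hqpos : (0 : ℝ) < q := by exact_mod_cast hq.pos
  -- the logarithm of q
  have hlq1 : (ρ - ε) * l ≤ Real.log q := by
    rw [hl, ← Real.log_rpow hx0]
    exact Real.log_le_log (by positivity) hq1
  have hlq2 : Real.log q ≤ ρ * l := by
    rw [hl, ← Real.log_rpow hx0]
    exact Real.log_le_log hqpos hq2
  have hS : (t : ℝ) * (K - t) * Real.log q ≤ Real.log (extremalF n) := by
    have h1 : Real.log ((q ^ (t * (K - t)) : ℕ) : ℝ) ≤ Real.log (extremalF n) :=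
      Real.log_le_log (by exact_mod_cast Nat.pow_pos hq.pos) (by exact_mod_cast hge)
    rw [Nat.cast_pow, Real.log_pow, Nat.cast_mul, Nat.cast_sub htK] at h1
    exact h1
  have hlogn1 : Real.log n ≤ (1 + ρ * ρ) * (K * l) := by
    have hPr : (∏ p ∈ P, (p : ℝ)) ≤ (x : ℝ) ^ K := by
      rw [← hPc, ← Finset.prod_const]
      exact Finset.prod_le_prod (fun p _ => by positivity) fun p hp => by exact_mod_cast (hP p hp).1
    have hPr0 : 0 < ∏ p ∈ P, (p : ℝ) := Finset.prod_pos fun p hp => by exact_mod_cast (hP p hp).2.1.pos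
    have h1 : Real.log n = t * Real.log q + Real.log (∏ p ∈ P, (p : ℝ)) := by
      rw [hn]
      push_cast
      rw [Real.log_mul (by positivity) hPr0.ne', Real.log_pow]
    have h2 : Real.log (∏ p ∈ P, (p : ℝ)) ≤ K * l := by
      have := Real.log_le_log hPr0 hPr
      rwa [Real.log_pow] at this
    have h3 : t * Real.log q ≤ (ρ * K) * (ρ * l) := by
      apply mul_le_mul ht1 hlq2 (Real.log_nonneg (by exact_mod_cast hq.one_lt.le)) (by positivity)
    rw [h1]; linarith
  have hlogn2 : (K : ℝ) / 2 ≤ Real.log n := by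
    have h1 : Real.log ((2 ^ K : ℕ) : ℝ) ≤ Real.log n :=
      Real.log_le_log (by positivity) (by exact_mod_cast hn2K)
    rw [Nat.cast_pow, Real.log_pow, Nat.cast_ofNat] at h1
    have := Real.log_two_gt_d9
    nlinarith
  have hK20 : (19 : ℝ) ≤ K := by
    have : (0 : ℝ) ≤ n0 + n1 := by positivity
    linarith
  have hll : (1 - ρ - 2 * ε) * l ≤ Real.log (Real.log n) := by
    have h1 : Real.log ((x : ℝ) ^ (1 - ρ - ε) / 4) ≤ Real.log (Real.log n) := by
      apply Real.log_le_log (by positivity)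
      linarith
    rw [Real.log_div (by positivity) (by norm_num), Real.log_rpow hx0] at h1
    have h2 : Real.log 4 ≤ 2 := by
      rw [show (4 : ℝ) = 2 ^ 2 by norm_num, Real.log_pow]
      have := Real.log_two_lt_d9
      push_cast
      linarith
    have h3 : 2 ≤ ε * l := by
      rw [div_le_iff₀ hε] at hx2; linarith
    have : (1 - ρ - 2 * ε) * l = (1 - ρ - ε) * l - ε * l := by ring
    linarith
  have hlln0 : 0 < Real.log (Real.log n) := lt_of_lt_of_le (mul_pos (by linarith) hl0) hll
  have hn0' : 0 < Real.log n := by linarith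
  have hεK : 1 ≤ ε * K := by
    have : (0 : ℝ) ≤ n0 + n1 := by positivity
    have : 1 / ε ≤ K := by linarith
    rw [div_le_iff₀ hε] at this; linarith
  refine hval.trans ?_
  rw [div_div_eq_mul_div]
  have hnum : ((ρ - ε) * K) * ((1 - ρ) * K) * ((ρ - ε) * l) * ((1 - ρ - 2 * ε) * l) ≤ Real.log (extremalF n) * Real.log (Real.log n) := by
    have k1 : 0 ≤ (ρ - ε) * K := mul_nonneg (by linarith) hKpos.le
    have k2 : 0 ≤ (1 - ρ) * K := mul_nonneg (by linarith) hKpos.le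
    have k3 : 0 ≤ (ρ - ε) * l := mul_nonneg (by linarith) hl0.le
    have k4 : 0 ≤ (1 - ρ - 2 * ε) * l := mul_nonneg (by linarith) hl0.le
    have k5 : (ρ - ε) * K ≤ t := by rw [sub_mul]; linarith
    have k6 : (1 - ρ) * K ≤ K - t := by rw [sub_mul]; linarith
    refine mul_le_mul (le_trans ?_ hS) hll k4 (le_trans ?_ hS)
    · exact mul_le_mul (mul_le_mul k5 k6 k2 (by linarith)) hlq1 k3 (mul_nonneg (by positivity) (by linarith))
    · exact mul_nonneg (mul_nonneg (by positivity) (by linarith)) (by linarith)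
  calc (ρ - ε) * (1 - ρ) * (ρ - ε) * (1 - ρ - 2 * ε) / (1 + ρ * ρ) ^ 2
      = (((ρ - ε) * K) * ((1 - ρ) * K) * ((ρ - ε) * l) * ((1 - ρ - 2 * ε) * l)) / ((1 + ρ * ρ) * (K * l)) ^ 2 := by
        field_simp
    _ ≤ (Real.log (extremalF n) * Real.log (Real.log n)) / (Real.log n) ^ 2 := by
        have k1 : 0 ≤ (ρ - ε) * K := mul_nonneg (by linarith) hKpos.le
        have k2 : 0 ≤ (1 - ρ) * K := mul_nonneg (by linarith) hKpos.le
        have k3 : 0 ≤ (ρ - ε) * l := mul_nonneg (by linarith) hl0.le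
        have k4 : 0 ≤ (1 - ρ - 2 * ε) * l := mul_nonneg (by linarith) hl0.le
        have k7 : 0 ≤ ((ρ - ε) * K) * ((1 - ρ) * K) * ((ρ - ε) * l) * ((1 - ρ - 2 * ε) * l) := by positivity
        exact div_le_div₀ (k7.trans hnum) hnum (by positivity) (by gcongr)

lemma limsup_of_primesAP (h : PrimesAP (Real.sqrt 2 - 1)) :
    limsup
        (fun n : ℕ => Real.log (extremalF n) / ((Real.log n) ^ 2 / Real.log (Real.log n)))
        atTop = (3 - 2 * Real.sqrt 2) / 4 := by
  have hb : IsBoundedUnder (· ≤ ·) atTop (fun n : ℕ => Real.log (extremalF n) / ((Real.log n) ^ 2 / Real.log (Real.log n))) :=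
    ⟨_, eventually_map.mpr (upper_final 1 one_pos)⟩
  have hcb : IsCoboundedUnder (· ≤ ·) atTop (fun n : ℕ => Real.log (extremalF n) / ((Real.log n) ^ 2 / Real.log (Real.log n))) :=
    IsCoboundedUnder.of_frequently_ge (lower_freq h 1 one_pos)
  apply le_antisymm
  · refine le_of_forall_pos_le_add fun η hη => ?_
    exact limsup_le_of_le hcb (upper_final η hη)
  · refine le_of_forall_pos_le_add fun η hη => ?_
    have := le_limsup_of_frequently_le (lower_freq h η hη) hb
    linarith


/-- The additive character `e(β)`. -/
noncomputable def ee (β : ℝ) : ℂ := Complex.exp (((2 * Real.pi * β : ℝ) : ℂ) * Complex.I)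

lemma ee_add (a b : ℝ) : ee (a + b) = ee a * ee b := by
  unfold ee; rw [← Complex.exp_add]; push_cast; ring_nf

lemma norm_ee (a : ℝ) : ‖ee a‖ = 1 := Complex.norm_exp_ofReal_mul_I _

lemma ee_conj (a : ℝ) : (starRingEnd ℂ) (ee a) = ee (-a) := by
  unfold ee
  rw [← Complex.exp_conj]
  congr 1
  rw [map_mul, Complex.conj_ofReal, Complex.conj_I]
  push_cast
  ring

lemma ee_zero : ee 0 = 1 := by simp [ee]

lemma ee_nat_mul (n : ℕ) (b : ℝ) : ee (n * b) = ee b ^ n := by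
  unfold ee; rw [← Complex.exp_nat_mul]; push_cast; ring_nf

lemma ee_int (n : ℤ) : ee n = 1 := by
  unfold ee
  rw [Complex.exp_eq_one_iff]
  exact ⟨n, by push_cast; ring⟩

noncomputable def KK (N : ℕ) (β : ℝ) : ℂ := ∑ n ∈ Finset.range N, ee (n * β)

lemma KK_le (N : ℕ) (β : ℝ) : ‖KK N β‖ ≤ N := by
  unfold KK
  refine (norm_sum_le _ _).trans ?_
  simp [norm_ee]

lemma KK_neg (N : ℕ) (β : ℝ) : ‖KK N (-β)‖ = ‖KK N β‖ := by
  rw [← Complex.norm_conj (KK N β)]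
  unfold KK
  rw [map_sum]
  congr 1
  refine Finset.sum_congr rfl fun n _ => ?_
  rw [ee_conj]; ring_nf

lemma ee_sub_one (β : ℝ) : ‖ee β - 1‖ = 2 * |Real.sin (Real.pi * β)| := by
  unfold ee
  rw [mul_comm, Complex.norm_exp_I_mul_ofReal_sub_one]
  rw [norm_mul, Real.norm_eq_abs, Real.norm_eq_abs]
  congr 1
  · simp
  · ring_nf

lemma sin_lower (β d : ℝ) (h0 : 0 ≤ d) (h1 : d ≤ β) (h2 : d ≤ 1 - β) :
    2 * d ≤ Real.sin (Real.pi * β) := by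
  have hpi := Real.pi_pos
  have key : ∀ b : ℝ, 0 ≤ b → b ≤ 1 / 2 → 2 * b ≤ Real.sin (Real.pi * b) := by
    intro b hb hb2
    have := Real.mul_le_sin (x := Real.pi * b) (by positivity) (by nlinarith)
    calc 2 * b = 2 / Real.pi * (Real.pi * b) := by field_simp
      _ ≤ _ := this
  rcases le_total β (1 / 2) with h | h
  · have := key β (by linarith) h
    linarith
  · have := key (1 - β) (by linarith) (by linarith)
    rw [show Real.pi * (1 - β) = Real.pi - Real.pi * β by ring, Real.sin_pi_sub] at this
    linarith

lemma KK_le' (N : ℕ) (β d : ℝ) (h0 : 0 < d) (h1 : d ≤ |β|) (h2 : d ≤ 1 - |β|) :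
    ‖KK N β‖ ≤ 1 / (2 * d) := by
  wlog hβ : 0 ≤ β generalizing β
  · rw [← KK_neg]
    exact this (-β) (by rwa [abs_neg]) (by rwa [abs_neg]) (by linarith)
  rw [abs_of_nonneg hβ] at h1 h2
  have hs := sin_lower β d h0.le h1 h2
  have h3 : ‖ee β - 1‖ ≥ 4 * d := by
    rw [ee_sub_one, abs_of_nonneg (by linarith)]; linarith
  have h4 : KK N β * (ee β - 1) = ee β ^ N - 1 := by
    unfold KK
    simp only [ee_nat_mul]
    exact geom_sum_mul _ _
  have h5 : ‖KK N β‖ * ‖ee β - 1‖ ≤ 2 := by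
    rw [← norm_mul, h4]
    refine (norm_sub_le _ _).trans ?_
    rw [norm_pow, norm_ee, norm_one]; norm_num
  rw [le_div_iff₀ (by positivity)]
  have := norm_nonneg (KK N β)
  nlinarith

lemma schur {ι : Type*} (I : Finset ι) (α : ι → ℝ) (N : ℕ) (Δ : ℝ)
    (h : ∀ r ∈ I, ∑ s ∈ I, ‖KK N (α r - α s)‖ ≤ Δ) (c : ι → ℂ) :
    ∑ n ∈ Finset.range N, ‖∑ r ∈ I, c r * ee (n * α r)‖ ^ 2 ≤ Δ * ∑ r ∈ I, ‖c r‖ ^ 2 := by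
  have e1 : ((∑ n ∈ Finset.range N, ‖∑ r ∈ I, c r * ee (n * α r)‖ ^ 2 : ℝ) : ℂ)
      = ∑ r ∈ I, ∑ s ∈ I, c r * (starRingEnd ℂ) (c s) * KK N (α r - α s) := by
    push_cast
    have : ∀ n ∈ Finset.range N, ((‖∑ r ∈ I, c r * ee (n * α r)‖ : ℂ)) ^ 2 =
        ∑ r ∈ I, ∑ s ∈ I, c r * (starRingEnd ℂ) (c s) * ee (n * (α r - α s)) := by
      intro n _
      rw [← Complex.mul_conj', map_sum, Finset.sum_mul_sum]
      refine Finset.sum_congr rfl fun r _ => Finset.sum_congr rfl fun s _ => ?_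
      rw [map_mul, ee_conj, mul_sub, sub_eq_add_neg, ee_add]
      ring
    rw [Finset.sum_congr rfl this, Finset.sum_comm]
    refine Finset.sum_congr rfl fun r _ => ?_
    rw [Finset.sum_comm]
    refine Finset.sum_congr rfl fun s _ => ?_
    rw [KK, Finset.mul_sum]
  have e2 : ∑ n ∈ Finset.range N, ‖∑ r ∈ I, c r * ee (n * α r)‖ ^ 2 ≤
      ∑ r ∈ I, ∑ s ∈ I, ‖c r‖ * ‖c s‖ * ‖KK N (α r - α s)‖ := by
    have h0 : 0 ≤ ∑ n ∈ Finset.range N, ‖∑ r ∈ I, c r * ee (n * α r)‖ ^ 2 := by positivity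
    rw [← Complex.norm_of_nonneg h0, e1]
    refine (norm_sum_le _ _).trans (Finset.sum_le_sum fun r _ => (norm_sum_le _ _).trans (Finset.sum_le_sum fun s _ => ?_))
    rw [norm_mul, norm_mul, Complex.norm_conj]
  refine e2.trans ?_
  have e3 : ∑ r ∈ I, ∑ s ∈ I, ‖c r‖ * ‖c s‖ * ‖KK N (α r - α s)‖ ≤
      ∑ r ∈ I, ∑ s ∈ I, (‖c r‖ ^ 2 / 2 * ‖KK N (α r - α s)‖ + ‖c s‖ ^ 2 / 2 * ‖KK N (α s - α r)‖) := by
    refine Finset.sum_le_sum fun r _ => Finset.sum_le_sum fun s _ => ?_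
    rw [← neg_sub (α r) (α s), KK_neg, ← add_mul]
    gcongr
    nlinarith [sq_nonneg (‖c r‖ - ‖c s‖)]
  have e4 : ∑ r ∈ I, ∑ s ∈ I, (‖c r‖ ^ 2 / 2 * ‖KK N (α r - α s)‖) ≤ Δ / 2 * ∑ r ∈ I, ‖c r‖ ^ 2 := by
    rw [Finset.mul_sum]
    refine Finset.sum_le_sum fun r hr => ?_
    rw [← Finset.mul_sum]
    calc _ ≤ ‖c r‖ ^ 2 / 2 * Δ := by gcongr; exact h r hr
      _ = _ := by ring
  simp only [Finset.sum_add_distrib] at e3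
  rw [Finset.sum_comm (f := fun r s => ‖c s‖ ^ 2 / 2 * ‖KK N (α s - α r)‖)] at e3
  linarith

lemma dual_sieve {ι : Type*} (I : Finset ι) (α : ι → ℝ) (N : ℕ) (Δ : ℝ)
    (h : ∀ r ∈ I, ∑ s ∈ I, ‖KK N (α r - α s)‖ ≤ Δ) (hΔ : 0 ≤ Δ) (a : ℕ → ℝ) :
    ∑ r ∈ I, ‖∑ n ∈ Finset.range N, (a n : ℂ) * ee (n * α r)‖ ^ 2
      ≤ Δ * ∑ n ∈ Finset.range N, a n ^ 2 := by
  set S : ι → ℂ := fun r => ∑ n ∈ Finset.range N, (a n : ℂ) * ee (n * α r) with hS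
  set X := ∑ r ∈ I, ‖S r‖ ^ 2 with hX
  have hX0 : 0 ≤ X := by positivity
  have e1 : (X : ℂ) = ∑ n ∈ Finset.range N, (a n : ℂ) * ∑ r ∈ I, (starRingEnd ℂ) (S r) * ee (n * α r) := by
    rw [hX]
    push_cast
    simp only [Finset.mul_sum]
    rw [Finset.sum_comm]
    refine Finset.sum_congr rfl fun r _ => ?_
    rw [← Complex.conj_mul']
    conv_lhs => rw [hS]
    simp only
    rw [Finset.mul_sum]
    refine Finset.sum_congr rfl fun n _ => ?_
    simp only [hS]
    ring
  have e2 : X ≤ ∑ n ∈ Finset.range N, |a n| * ‖∑ r ∈ I, (starRingEnd ℂ) (S r) * ee (n * α r)‖ := by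
    rw [← Complex.norm_of_nonneg hX0, e1]
    refine (norm_sum_le _ _).trans (Finset.sum_le_sum fun n _ => ?_)
    rw [norm_mul, Complex.norm_real, Real.norm_eq_abs]
  have e3 := Finset.sum_mul_sq_le_sq_mul_sq (Finset.range N) (fun n => |a n|)
    (fun n => ‖∑ r ∈ I, (starRingEnd ℂ) (S r) * ee (n * α r)‖)
  have e4 := schur I α N Δ h (fun r => (starRingEnd ℂ) (S r))
  simp only [Complex.norm_conj] at e4
  simp only [sq_abs] at e3
  have e5 : X ^ 2 ≤ (∑ n ∈ Finset.range N, a n ^ 2) * (Δ * X) := by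
    calc X ^ 2 ≤ _ := by gcongr
      _ ≤ _ := e3
      _ ≤ _ := by gcongr
  rcases hX0.eq_or_lt with h0 | h0
  · rw [← h0]; positivity
  · have : X * X ≤ (Δ * ∑ n ∈ Finset.range N, a n ^ 2) * X := by nlinarith
    exact le_of_mul_le_mul_right this h0

/-- Majorant of the kernel in terms of bucket distance. -/
noncomputable def gg (N R d : ℕ) : ℝ := if d ≤ 1 then N else R / (2 * ((d : ℝ) - 1))

lemma gg_nonneg (N R d : ℕ) : 0 ≤ gg N R d := by
  unfold gg
  split_ifs with h
  · positivity
  · have : (2 : ℝ) ≤ d := by exact_mod_cast (by omega : 2 ≤ d)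
    have : 0 < (d : ℝ) - 1 := by linarith
    positivity

lemma sum_gg (N R : ℕ) (hR : 1 ≤ R) : ∑ d ∈ Finset.range (R + 1), gg N R d ≤ 2 * N + R / 2 * (1 + Real.log R) := by
  have h1 : ∑ d ∈ Finset.range (R + 1), gg N R d ≤ ∑ d ∈ Finset.range (R + 2), gg N R d :=
    Finset.sum_le_sum_of_subset_of_nonneg (by intro d; simp; omega) fun d _ _ => gg_nonneg _ _ _
  refine h1.trans ?_
  rw [Finset.sum_range_succ', Finset.sum_range_succ']
  have h2 : ∑ k ∈ Finset.range R, gg N R (k + 1 + 1) = R / 2 * ((harmonic R : ℚ) : ℝ) := by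
    rw [harmonic, Rat.cast_sum, Finset.mul_sum]
    refine Finset.sum_congr rfl fun k _ => ?_
    unfold gg
    rw [if_neg (by omega)]
    push_cast
    have : (0 : ℝ) < k + 1 := by positivity
    rw [show (k : ℝ) + 1 + 1 - 1 = k + 1 by ring]
    field_simp
  rw [h2]
  have h3 := harmonic_le_one_add_log R
  have h4 : gg N R (0 + 1) = N := by simp [gg]
  have h5 : gg N R 0 = N := by simp [gg]
  rw [h4, h5]
  have : (R : ℝ) / 2 * ((harmonic R : ℚ) : ℝ) ≤ R / 2 * (1 + Real.log R) := by gcongr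
  linarith

lemma KK_bucket (N R : ℕ) (hR : 1 ≤ R) (a b : ℝ) (ha : 0 ≤ a) (ha1 : a < 1) (hb : 0 ≤ b) (hb1 : b < 1) :
    ‖KK N (a - b)‖ ≤ gg N R (Nat.dist ⌊a * R⌋₊ ⌊b * R⌋₊) + gg N R (R - Nat.dist ⌊a * R⌋₊ ⌊b * R⌋₊) := by
  have hR0 : (0 : ℝ) < R := by exact_mod_cast hR
  set i := ⌊a * R⌋₊ with hi
  set j := ⌊b * R⌋₊ with hj
  have i1 : (i : ℝ) ≤ a * R := Nat.floor_le (by positivity)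
  have i2 : a * R < i + 1 := Nat.lt_floor_add_one _
  have j1 : (j : ℝ) ≤ b * R := Nat.floor_le (by positivity)
  have j2 : b * R < j + 1 := Nat.lt_floor_add_one _
  have iR : i < R := by
    have : (i : ℝ) < R := by nlinarith
    exact_mod_cast this
  have jR : j < R := by
    have : (j : ℝ) < R := by nlinarith
    exact_mod_cast this
  set d := Nat.dist i j with hd
  have hdR : d < R := by rw [hd, Nat.dist]; omega
  have hdr : (d : ℝ) = |(i : ℝ) - j| := by
    rw [hd, Nat.dist]
    rcases le_total i j with h | h
    · have h' : (i : ℝ) ≤ j := by exact_mod_cast h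
      rw [Nat.sub_eq_zero_of_le h, zero_add, Nat.cast_sub h, abs_of_nonpos (by linarith)]; ring
    · have h' : (j : ℝ) ≤ i := by exact_mod_cast h
      rw [Nat.sub_eq_zero_of_le h, add_zero, Nat.cast_sub h, abs_of_nonneg (by linarith)]
  have g1 := gg_nonneg N R d
  have g2 := gg_nonneg N R (R - d)
  have hN := KK_le N (a - b)
  by_cases h1 : d ≤ 1
  · have : gg N R d = N := by simp [gg, h1]
    linarith
  by_cases h2 : R - d ≤ 1
  · have : gg N R (R - d) = N := by simp [gg, h2]
    linarith
  have hab1 : ((d : ℝ) - 1) / R ≤ |a - b| := by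
    rw [div_le_iff₀ hR0, ← abs_of_pos hR0, ← abs_mul, sub_mul, hdr]
    have : |(i : ℝ) - j| ≤ |a * R - b * R| + 1 := by
      rw [abs_le]
      have h3 := abs_le.mp (le_refl |a * R - b * R|)
      constructor <;> linarith [h3.1, h3.2]
    linarith
  have hab2 : (((R - d : ℕ) : ℝ) - 1) / R ≤ 1 - |a - b| := by
    rw [div_le_iff₀ hR0, sub_mul, Nat.cast_sub hdR.le, one_mul]
    rw [show |a - b| * R = |a * R - b * R| by rw [← sub_mul, abs_mul, abs_of_pos hR0], hdr]
    have : |a * R - b * R| ≤ |(i : ℝ) - j| + 1 := by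
      rw [abs_le]
      have h3 := abs_le.mp (le_refl |(i : ℝ) - j|)
      constructor <;> linarith [h3.1, h3.2]
    linarith
  have d2 : (0 : ℝ) < (d : ℝ) - 1 := by
    have : (1 : ℝ) < d := by exact_mod_cast (by omega : 1 < d)
    linarith
  have d3 : (0 : ℝ) < ((R - d : ℕ) : ℝ) - 1 := by
    have : (1 : ℝ) < ((R - d : ℕ) : ℝ) := by exact_mod_cast (by omega : 1 < R - d)
    linarith
  rcases le_total ((d : ℝ) - 1) (((R - d : ℕ) : ℝ) - 1) with h | h
  · have := KK_le' N (a - b) (((d : ℝ) - 1) / R) (by positivity) hab1 (le_trans (by gcongr) hab2)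
    have e : gg N R d = 1 / (2 * (((d : ℝ) - 1) / R)) := by
      rw [gg, if_neg h1]; field_simp
    linarith
  · have := KK_le' N (a - b) ((((R - d : ℕ) : ℝ) - 1) / R) (by positivity) (le_trans (by gcongr) hab1) hab2
    have e : gg N R (R - d) = 1 / (2 * ((((R - d : ℕ) : ℝ) - 1) / R)) := by
      rw [gg, if_neg h2]; field_simp
    linarith

lemma sum_dist_le (R i : ℕ) (hi : i < R) (g : ℕ → ℝ) (hg : ∀ d, 0 ≤ g d) :
    ∑ j ∈ Finset.range R, g (Nat.dist i j) ≤ 2 * ∑ d ∈ Finset.range R, g d := by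
  have h1 : ∑ j ∈ Finset.range R, g (Nat.dist i j) =
      ∑ j ∈ (Finset.range R).filter (· ≤ i), g (Nat.dist i j) + ∑ j ∈ (Finset.range R).filter (fun j => ¬ j ≤ i), g (Nat.dist i j) :=
    (Finset.sum_filter_add_sum_filter_not _ _ _).symm
  have h2 : ∑ j ∈ (Finset.range R).filter (· ≤ i), g (Nat.dist i j) ≤ ∑ d ∈ Finset.range R, g d := by
    rw [← Finset.sum_image (g := fun j => Nat.dist i j) (f := g)]
    · refine Finset.sum_le_sum_of_subset_of_nonneg ?_ fun d _ _ => hg d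
      intro d; simp only [Finset.mem_image, Finset.mem_filter, Finset.mem_range, Nat.dist]
      rintro ⟨j, hj, rfl⟩; omega
    · intro j hj k hk h
      simp only [Finset.coe_filter, Finset.mem_range, Set.mem_ofPred_eq, Nat.dist] at hj hk h
      omega
  have h3 : ∑ j ∈ (Finset.range R).filter (fun j => ¬ j ≤ i), g (Nat.dist i j) ≤ ∑ d ∈ Finset.range R, g d := by
    rw [← Finset.sum_image (g := fun j => Nat.dist i j) (f := g)]
    · refine Finset.sum_le_sum_of_subset_of_nonneg ?_ fun d _ _ => hg d
      intro d; simp only [Finset.mem_image, Finset.mem_filter, Finset.mem_range, Nat.dist]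
      rintro ⟨j, hj, rfl⟩; omega
    · intro j hj k hk h
      simp only [Finset.coe_filter, Finset.mem_range, Set.mem_ofPred_eq, Nat.dist] at hj hk h
      omega
  linarith

lemma large_sieve_points {ι : Type*} (I : Finset ι) (α : ι → ℝ) (N R : ℕ) (hR : 1 ≤ R)
    (h0 : ∀ r ∈ I, 0 ≤ α r) (h1 : ∀ r ∈ I, α r < 1)
    (hsep : ∀ r ∈ I, ∀ s ∈ I, r ≠ s → 1 ≤ |α r - α s| * R) (a : ℕ → ℝ) :
    ∑ r ∈ I, ‖∑ n ∈ Finset.range N, (a n : ℂ) * ee (n * α r)‖ ^ 2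
      ≤ (8 * N + 2 * R * (1 + Real.log R)) * ∑ n ∈ Finset.range N, a n ^ 2 := by
  classical
  have hR0 : (0 : ℝ) < R := by exact_mod_cast hR
  have hlog : 0 ≤ Real.log R := Real.log_nonneg (by exact_mod_cast hR)
  have hb : ∀ r ∈ I, ⌊α r * R⌋₊ < R := by
    intro r hr
    rw [Nat.floor_lt (mul_nonneg (h0 r hr) hR0.le)]
    have := h1 r hr
    nlinarith
  have hinj : Set.InjOn (fun s => ⌊α s * R⌋₊) I := by
    intro r hr s hs h
    by_contra hne
    have := hsep r hr s hs hne
    simp only at h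
    have i1 : (⌊α r * R⌋₊ : ℝ) ≤ α r * R := Nat.floor_le (mul_nonneg (h0 r hr) hR0.le)
    have i2 : α r * R < ⌊α r * R⌋₊ + 1 := Nat.lt_floor_add_one _
    have j1 : (⌊α s * R⌋₊ : ℝ) ≤ α s * R := Nat.floor_le (mul_nonneg (h0 s hs) hR0.le)
    have j2 : α s * R < ⌊α s * R⌋₊ + 1 := Nat.lt_floor_add_one _
    rw [h] at i1 i2
    rw [← abs_of_pos hR0, ← abs_mul, sub_mul] at this
    have h3 : |α r * R - α s * R| < 1 := by rw [abs_lt]; constructor <;> linarith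
    linarith
  refine dual_sieve I α N _ ?_ (by positivity) a
  intro r hr
  have e1 : ∑ s ∈ I, ‖KK N (α r - α s)‖ ≤ ∑ s ∈ I, (fun j => gg N R (Nat.dist ⌊α r * R⌋₊ j) + gg N R (R - Nat.dist ⌊α r * R⌋₊ j)) ⌊α s * R⌋₊ :=
    Finset.sum_le_sum fun s hs => KK_bucket N R hR _ _ (h0 r hr) (h1 r hr) (h0 s hs) (h1 s hs)
  refine e1.trans ?_
  rw [← Finset.sum_image (g := fun s => ⌊α s * R⌋₊) (f := fun j => gg N R (Nat.dist ⌊α r * R⌋₊ j) + gg N R (R - Nat.dist ⌊α r * R⌋₊ j)) hinj]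
  refine (Finset.sum_le_sum_of_subset_of_nonneg (t := Finset.range R) ?_ ?_).trans ?_
  · intro j hj
    obtain ⟨s, hs, rfl⟩ := Finset.mem_image.mp hj
    exact Finset.mem_range.mpr (hb s hs)
  · intro j _ _
    exact add_nonneg (gg_nonneg _ _ _) (gg_nonneg _ _ _)
  rw [Finset.sum_add_distrib]
  have f1 := sum_dist_le R _ (hb r hr) (gg N R) (gg_nonneg N R)
  have f2 := sum_dist_le R _ (hb r hr) (fun d => gg N R (R - d)) (fun d => gg_nonneg N R _)
  have f3 := sum_gg N R hR
  have f4 : ∑ d ∈ Finset.range R, gg N R d ≤ ∑ d ∈ Finset.range (R + 1), gg N R d :=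
    Finset.sum_le_sum_of_subset_of_nonneg (by intro d; simp; omega) fun d _ _ => gg_nonneg _ _ _
  have f5 : ∑ d ∈ Finset.range R, gg N R (R - d) ≤ ∑ d ∈ Finset.range (R + 1), gg N R d := by
    rw [← Finset.sum_range_reflect (n := R + 1)]
    simp only [Nat.add_sub_cancel]
    exact Finset.sum_le_sum_of_subset_of_nonneg (by intro d; simp; omega) fun d _ _ => gg_nonneg _ _ _
  linarith


lemma ee_eq_one (β : ℝ) (h : ee β = 1) : ∃ k : ℤ, β = k := by
  unfold ee at h
  rw [Complex.exp_eq_one_iff] at h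
  obtain ⟨k, hk⟩ := h
  refine ⟨k, ?_⟩
  have h2 : (((2 * Real.pi * β : ℝ) : ℂ)) = ((k * (2 * Real.pi) : ℝ) : ℂ) := by
    apply mul_right_cancel₀ Complex.I_ne_zero
    rw [hk]; push_cast; ring
  have h3 : 2 * Real.pi * β = k * (2 * Real.pi) := by exact_mod_cast h2
  have := Real.pi_pos
  have h4 : (2 * Real.pi) * β = (2 * Real.pi) * k := by linarith
  exact mul_left_cancel₀ (by positivity) h4

lemma ortho (q : ℕ) (hq : 0 < q) (n m : ℕ) :
    ∑ h ∈ Finset.range q, ee ((n : ℝ) * ((h : ℝ) / q) - (m : ℝ) * ((h : ℝ) / q)) =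
      if (n : ZMod q) = (m : ZMod q) then (q : ℂ) else 0 := by
  have hq0 : (q : ℝ) ≠ 0 := by positivity
  have e0 : ∀ h : ℕ, ee ((n : ℝ) * ((h : ℝ) / q) - (m : ℝ) * ((h : ℝ) / q)) = ee (((n : ℝ) - m) / q) ^ h := by
    intro h
    rw [← ee_nat_mul]
    congr 1
    field_simp
  simp only [e0]
  have hiff : (n : ZMod q) = (m : ZMod q) ↔ (q : ℤ) ∣ (n : ℤ) - m := by
    have := ZMod.intCast_zmod_eq_zero_iff_dvd ((n : ℤ) - m) q
    push_cast at this
    rw [← this.trans Iff.rfl, sub_eq_zero]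
  split_ifs with h
  · obtain ⟨k, hk⟩ := hiff.mp h
    have : ((n : ℝ) - m) / q = (k : ℤ) := by
      have h1 : ((n : ℝ) - m) = q * k := by exact_mod_cast hk
      rw [h1]; field_simp
    rw [this, ee_int]; simp
  · have hne : ee (((n : ℝ) - m) / q) ≠ 1 := by
      intro h1
      obtain ⟨k, hk⟩ := ee_eq_one _ h1
      apply h
      rw [hiff]
      refine ⟨k, ?_⟩
      rw [div_eq_iff hq0] at hk
      have h2 : ((n : ℝ) - m) = q * k := by linarith
      exact_mod_cast h2
    have h1 := geom_sum_mul (ee (((n : ℝ) - m) / q)) q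
    have h2 : ee (((n : ℝ) - m) / q) ^ q = 1 := by
      rw [← ee_nat_mul, mul_div_cancel₀ _ hq0]
      have := ee_int ((n : ℤ) - m)
      push_cast at this
      exact this
    rw [h2, sub_self] at h1
    exact (mul_eq_zero.mp h1).resolve_right (sub_ne_zero.mpr hne)

/-- Residue class sums. -/
noncomputable def AA (q N : ℕ) (a : ℕ → ℝ) (c : ZMod q) : ℝ :=
  ∑ n ∈ Finset.range N, if (n : ZMod q) = c then a n else 0

lemma sum_AA (q N : ℕ) [NeZero q] (a : ℕ → ℝ) : ∑ c, AA q N a c = ∑ n ∈ Finset.range N, a n := by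
  unfold AA
  rw [Finset.sum_comm]
  simp

lemma sum_AA_mul (q N : ℕ) [NeZero q] (a : ℕ → ℝ) (w : ZMod q → ℝ) :
    ∑ c, AA q N a c * w c = ∑ n ∈ Finset.range N, a n * w n := by
  unfold AA
  simp only [Finset.sum_mul]
  rw [Finset.sum_comm]
  simp

/-- Variance over residue classes. -/
noncomputable def VV (q N : ℕ) [NeZero q] (a : ℕ → ℝ) : ℝ :=
  ∑ c : ZMod q, (AA q N a c - (∑ n ∈ Finset.range N, a n) / q) ^ 2

lemma VV_nonneg (q N : ℕ) [NeZero q] (a : ℕ → ℝ) : 0 ≤ VV q N a := by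
  unfold VV; positivity

lemma parseval (q N : ℕ) [NeZero q] (a : ℕ → ℝ) :
    ∑ h ∈ Finset.Ico 1 q, ‖∑ n ∈ Finset.range N, (a n : ℂ) * ee (n * ((h : ℝ) / q))‖ ^ 2
      = q * VV q N a := by
  have hq : 0 < q := Nat.pos_of_ne_zero (NeZero.ne q)
  have hq0 : (q : ℝ) ≠ 0 := by positivity
  set S : ℕ → ℂ := fun h => ∑ n ∈ Finset.range N, (a n : ℂ) * ee (n * ((h : ℝ) / q)) with hS
  have e1 : ((∑ h ∈ Finset.range q, ‖S h‖ ^ 2 : ℝ) : ℂ) = ((q * ∑ c, AA q N a c ^ 2 : ℝ) : ℂ) := by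
    push_cast
    have : ∀ h ∈ Finset.range q, ((‖S h‖ : ℂ)) ^ 2 = ∑ n ∈ Finset.range N, ∑ m ∈ Finset.range N,
        (a n : ℂ) * (a m : ℂ) * ee ((n : ℝ) * ((h : ℝ) / q) - (m : ℝ) * ((h : ℝ) / q)) := by
      intro h _
      rw [← Complex.mul_conj', map_sum, Finset.sum_mul_sum]
      refine Finset.sum_congr rfl fun r _ => Finset.sum_congr rfl fun s _ => ?_
      rw [map_mul, ee_conj, sub_eq_add_neg, ee_add, Complex.conj_ofReal]
      ring
    rw [Finset.sum_congr rfl this, Finset.sum_comm]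
    have h2 : ∀ n ∈ Finset.range N, (∑ h ∈ Finset.range q, ∑ m ∈ Finset.range N,
        (a n : ℂ) * (a m : ℂ) * ee ((n : ℝ) * ((h : ℝ) / q) - (m : ℝ) * ((h : ℝ) / q)))
        = (q : ℂ) * ((a n : ℂ) * ((AA q N a n : ℝ) : ℂ)) := by
      intro n _
      rw [Finset.sum_comm]
      simp only [← Finset.mul_sum, ortho q hq]
      unfold AA
      push_cast
      rw [Finset.mul_sum, Finset.mul_sum]
      refine Finset.sum_congr rfl fun m _ => ?_
      simp only [eq_comm (a := (m : ZMod q))]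
      split_ifs
      · ring
      · simp
    rw [Finset.sum_congr rfl h2, ← Finset.mul_sum]
    congr 1
    have h3 := sum_AA_mul q N a (AA q N a)
    have h4 := congrArg (fun x : ℝ => (x : ℂ)) h3
    push_cast at h4
    simp only [pow_two]
    rw [h4]
  have e2 : ∑ h ∈ Finset.range q, ‖S h‖ ^ 2 = q * ∑ c, AA q N a c ^ 2 := by exact_mod_cast e1
  have e3 : ∑ h ∈ Finset.range q, ‖S h‖ ^ 2 = ‖S 0‖ ^ 2 + ∑ h ∈ Finset.Ico 1 q, ‖S h‖ ^ 2 := by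
    rw [Finset.range_eq_Ico, Finset.sum_eq_sum_Ico_succ_bot hq]
  have e4 : ‖S 0‖ ^ 2 = (∑ n ∈ Finset.range N, a n) ^ 2 := by
    have : S 0 = ((∑ n ∈ Finset.range N, a n : ℝ) : ℂ) := by
      simp [hS, ee_zero]
    rw [this, Complex.norm_real, Real.norm_eq_abs, sq_abs]
  have e5 : VV q N a = ∑ c, AA q N a c ^ 2 - (∑ n ∈ Finset.range N, a n) ^ 2 / q := by
    unfold VV
    simp only [sub_sq]
    rw [Finset.sum_add_distrib, Finset.sum_sub_distrib, ← Finset.sum_mul, ← Finset.mul_sum, sum_AA,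
      Finset.sum_const, Finset.card_univ, ZMod.card, nsmul_eq_mul]
    field_simp
    ring
  change ∑ h ∈ Finset.Ico 1 q, ‖S h‖ ^ 2 = _
  rw [e5, mul_sub, mul_div_cancel₀ _ hq0]
  linarith

lemma frac_sep (q q' h h' : ℕ) (hq : q.Prime) (hq' : q'.Prime) (h1 : 1 ≤ h) (h2 : h < q)
    (h1' : 1 ≤ h') (h2' : h' < q') (hne : ¬ (q = q' ∧ h = h')) (Q : ℕ) (hQ : q ≤ Q) (hQ' : q' ≤ Q) :
    1 ≤ |(h : ℝ) / q - (h' : ℝ) / q'| * ((Q ^ 2 : ℕ) : ℝ) := by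
  have hq0 : (0 : ℝ) < q := by exact_mod_cast hq.pos
  have hq0' : (0 : ℝ) < q' := by exact_mod_cast hq'.pos
  have hz : (h : ℤ) * q' - h' * q ≠ 0 := by
    intro hz
    have he : h * q' = h' * q := by
      have : (h : ℤ) * q' = h' * q := by linarith
      exact_mod_cast this
    by_cases hqq : q = q'
    · subst hqq
      exact hne ⟨rfl, Nat.eq_of_mul_eq_mul_right hq.pos he⟩
    · have hc : Nat.Coprime q q' := (Nat.coprime_primes hq hq').mpr hqq
      have hd : q ∣ h * q' := ⟨h', by rw [he]; ring⟩
      have := hc.dvd_of_dvd_mul_right hd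
      exact absurd (Nat.le_of_dvd h1 this) (by omega)
  have h3 : (1 : ℝ) ≤ |(h : ℝ) * q' - h' * q| := by
    have : (1 : ℤ) ≤ |(h : ℤ) * q' - h' * q| := Int.one_le_abs hz
    exact_mod_cast this
  have h4 : |(h : ℝ) / q - (h' : ℝ) / q'| = |(h : ℝ) * q' - h' * q| / (q * q') := by
    rw [div_sub_div _ _ hq0.ne' hq0'.ne', abs_div, abs_of_pos (by positivity : (0 : ℝ) < q * q')]
    ring_nf
  rw [h4]
  have h5 : (q : ℝ) * q' ≤ ((Q ^ 2 : ℕ) : ℝ) := by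
    have : q * q' ≤ Q ^ 2 := by rw [pow_two]; exact Nat.mul_le_mul hQ hQ'
    exact_mod_cast this
  rw [div_mul_eq_mul_div, le_div_iff₀ (by positivity)]
  nlinarith

/-- Total variance over a prime, zero at non-positive moduli. -/
noncomputable def VQ (q N : ℕ) (a : ℕ → ℝ) : ℝ := if h : q ≠ 0 then @VV q N ⟨h⟩ a else 0

lemma VQ_eq (q N : ℕ) [inst : NeZero q] (a : ℕ → ℝ) : VQ q N a = VV q N a := by
  unfold VQ; rw [dif_pos inst.ne]

lemma VQ_nonneg (q N : ℕ) (a : ℕ → ℝ) : 0 ≤ VQ q N a := by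
  unfold VQ; split_ifs with h
  · exact @VV_nonneg q N ⟨h⟩ a
  · exact le_rfl

lemma large_sieve (Q N : ℕ) (hQ1 : 1 ≤ Q) (S : Finset ℕ) (hS : ∀ q ∈ S, q.Prime) (hQ : ∀ q ∈ S, q ≤ Q)
    (a : ℕ → ℝ) :
    ∑ q ∈ S, q * VQ q N a ≤
      (8 * N + 2 * ((Q ^ 2 : ℕ) : ℝ) * (1 + Real.log ((Q ^ 2 : ℕ) : ℝ))) * ∑ n ∈ Finset.range N, a n ^ 2 := by
  have h := large_sieve_points (S.sigma fun q => Finset.Ico 1 q) (fun r => (r.2 : ℝ) / r.1) N (Q ^ 2)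
    (Nat.one_le_pow _ _ hQ1) (fun r _ => by positivity)
    (fun r hr => by
      simp only [Finset.mem_sigma, Finset.mem_Ico] at hr
      have : (0 : ℝ) < r.1 := by exact_mod_cast (hS _ hr.1).pos
      rw [div_lt_one this]
      exact_mod_cast hr.2.2)
    (fun r hr s hs hne => by
      simp only [Finset.mem_sigma, Finset.mem_Ico] at hr hs
      refine frac_sep r.1 s.1 r.2 s.2 (hS _ hr.1) (hS _ hs.1) hr.2.1 hr.2.2 hs.2.1 hs.2.2 ?_ Q (hQ _ hr.1) (hQ _ hs.1)
      rintro ⟨h1, h2⟩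
      apply hne
      rcases r with ⟨r1, r2⟩
      rcases s with ⟨s1, s2⟩
      simp only at h1 h2
      subst h1; subst h2; rfl) a
  rw [Finset.sum_sigma] at h
  refine le_trans (le_of_eq ?_) h
  refine Finset.sum_congr rfl fun q hq => ?_
  have : NeZero q := ⟨(hS q hq).ne_zero⟩
  rw [VQ_eq, ← parseval]


/-- The balanced indicator of the class `1` modulo `q`. -/
noncomputable def ew (q : ℕ) (c : ZMod q) : ℝ :=
  (if c = 1 then 1 else 0) - (if c = 0 then 0 else 1 / ((q : ℝ) - 1))

lemma ew_sum (q : ℕ) [Fact q.Prime] : ∑ c : ZMod q, ew q c = 0 := by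
  have hq2 : (2 : ℝ) ≤ q := by exact_mod_cast (Fact.out : q.Prime).two_le
  unfold ew
  rw [Finset.sum_sub_distrib]
  have h1 : ∑ c : ZMod q, (if c = 1 then (1 : ℝ) else 0) = 1 := by simp
  have h2 : ∑ c : ZMod q, (if c = 0 then (0 : ℝ) else 1 / ((q : ℝ) - 1))
      = ∑ c : ZMod q, (1 / ((q : ℝ) - 1) - (if c = 0 then 1 / ((q : ℝ) - 1) else 0)) := by
    refine Finset.sum_congr rfl fun c _ => ?_
    split_ifs <;> simp
  rw [h1, h2, Finset.sum_sub_distrib]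
  simp only [Finset.sum_const, Finset.card_univ, ZMod.card, Finset.sum_ite_eq', Finset.mem_univ, if_true, nsmul_eq_mul]
  have : (q : ℝ) - 1 ≠ 0 := by linarith
  field_simp
  ring

lemma ew_abs_le (q : ℕ) [Fact q.Prime] (c : ZMod q) : |ew q c| ≤ 1 := by
  have hq2 : (2 : ℝ) ≤ q := by exact_mod_cast (Fact.out : q.Prime).two_le
  have h1 : 0 ≤ 1 / ((q : ℝ) - 1) := by apply div_nonneg <;> linarith
  have h2 : 1 / ((q : ℝ) - 1) ≤ 1 := by rw [div_le_one] <;> linarith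
  unfold ew
  rw [abs_le]
  split_ifs <;> constructor <;> linarith

lemma ew_mul (q : ℕ) [Fact q.Prime] (c d : ZMod q) :
    ew q (c * d) = (if d = c⁻¹ then 1 else 0) - (if c = 0 then 1 else 0) * (if d = 0 then 1 else 0)
      - 1 / ((q : ℝ) - 1) * ((1 - (if c = 0 then 1 else 0)) * (1 - (if d = 0 then 1 else 0))) := by
  unfold ew
  by_cases hc : c = 0
  · subst hc
    by_cases hd : d = 0
    · subst hd; simp
    · simp [hd]
  · by_cases hd : d = 0
    · subst hd
      have : ¬ (0 : ZMod q) = c⁻¹ := by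
        intro h; exact hc (inv_eq_zero.mp h.symm)
      simp [hc, this]
    · have : c * d = 1 ↔ d = c⁻¹ := by
        rw [eq_comm (a := d), inv_eq_iff_eq_inv, ← mul_eq_one_iff_eq_inv₀ hd]
      simp [hc, hd, this]

lemma bilinear_centered (q : ℕ) [Fact q.Prime] (A B : ZMod q → ℝ) (hA : ∑ c, A c = 0) (hB : ∑ c, B c = 0) :
    |∑ c, ∑ d, A c * B d * ew q (c * d)| ≤ 3 * (Real.sqrt (∑ c, A c ^ 2) * Real.sqrt (∑ c, B c ^ 2)) := by
  have hq2 : (2 : ℝ) ≤ q := by exact_mod_cast (Fact.out : q.Prime).two_le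
  set κ := 1 / ((q : ℝ) - 1) with hκ
  have k1 : 0 ≤ κ := by apply div_nonneg <;> linarith
  have k2 : κ ≤ 1 := by rw [hκ, div_le_one] <;> linarith
  have e1 : ∑ c, ∑ d, A c * B d * ew q (c * d) = ∑ c, A c * B c⁻¹ - A 0 * B 0 - κ * (A 0 * B 0) := by
    have : ∀ c, ∑ d, A c * B d * ew q (c * d) = A c * B c⁻¹ - (if c = 0 then A c else 0) * B 0
        - κ * ((A c - (if c = 0 then A c else 0)) * (∑ d, B d - B 0)) := by
      intro c
      have h1 : ∀ d, A c * B d * ew q (c * d) = (if d = c⁻¹ then A c * B d else 0)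
          - (if c = 0 then A c else 0) * (if d = 0 then B d else 0)
          - κ * ((A c - (if c = 0 then A c else 0)) * (B d - (if d = 0 then B d else 0))) := by
        intro d
        rw [ew_mul]
        split_ifs <;> ring
      simp only [h1]
      rw [Finset.sum_sub_distrib, Finset.sum_sub_distrib, ← Finset.mul_sum, ← Finset.mul_sum, ← Finset.mul_sum, Finset.sum_sub_distrib]
      simp
    simp only [this]
    rw [Finset.sum_sub_distrib, Finset.sum_sub_distrib, ← Finset.mul_sum, ← Finset.sum_mul, ← Finset.sum_mul, Finset.sum_sub_distrib, hA, hB]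
    simp
  set X := Real.sqrt (∑ c, A c ^ 2) with hX
  set Y := Real.sqrt (∑ c, B c ^ 2) with hY
  have hX0 : 0 ≤ X := Real.sqrt_nonneg _
  have hY0 : 0 ≤ Y := Real.sqrt_nonneg _
  have hF : |∑ c, A c * B c⁻¹| ≤ X * Y := by
    have h1 := Finset.sum_mul_sq_le_sq_mul_sq Finset.univ A (fun c => B c⁻¹)
    have h2 : ∑ c, B c⁻¹ ^ 2 = ∑ c, B c ^ 2 :=
      Equiv.sum_comp (Equiv.inv (ZMod q)) (fun c => B c ^ 2)
    rw [h2] at h1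
    rw [hX, hY, ← Real.sqrt_mul (by positivity)]
    exact Real.abs_le_sqrt h1
  have hA0 : |A 0| ≤ X := by
    apply Real.abs_le_sqrt
    exact Finset.single_le_sum (f := fun c => A c ^ 2) (fun c _ => sq_nonneg _) (Finset.mem_univ 0)
  have hB0 : |B 0| ≤ Y := by
    apply Real.abs_le_sqrt
    exact Finset.single_le_sum (f := fun c => B c ^ 2) (fun c _ => sq_nonneg _) (Finset.mem_univ 0)
  have hAB : |A 0 * B 0| ≤ X * Y := by
    rw [abs_mul]; exact mul_le_mul hA0 hB0 (abs_nonneg _) hX0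
  rw [e1]
  have hκAB : |κ * (A 0 * B 0)| ≤ X * Y := by
    rw [abs_mul, abs_of_nonneg k1]
    have := abs_nonneg (A 0 * B 0)
    nlinarith
  have t1 := abs_sub (∑ c, A c * B c⁻¹ - A 0 * B 0) (κ * (A 0 * B 0))
  have t2 := abs_sub (∑ c, A c * B c⁻¹) (A 0 * B 0)
  linarith

lemma bilinear (q M K : ℕ) (hq : q.Prime) (a b : ℕ → ℝ) :
    |∑ m ∈ Finset.range M, ∑ k ∈ Finset.range K, a m * b k * ew q ((m : ZMod q) * (k : ZMod q))|
      ≤ 3 * (Real.sqrt (VQ q M a) * Real.sqrt (VQ q K b)) := by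
  have : Fact q.Prime := ⟨hq⟩
  have : NeZero q := ⟨hq.ne_zero⟩
  have hq0 : (q : ℝ) ≠ 0 := by exact_mod_cast hq.ne_zero
  rw [VQ_eq, VQ_eq]
  unfold VV
  set mA := (∑ n ∈ Finset.range M, a n) / q with hmA
  set mB := (∑ n ∈ Finset.range K, b n) / q with hmB
  have hA : ∑ c, (AA q M a c - mA) = 0 := by
    rw [Finset.sum_sub_distrib, sum_AA, Finset.sum_const, Finset.card_univ, ZMod.card, nsmul_eq_mul, hmA]
    field_simp; ring
  have hB : ∑ c, (AA q K b c - mB) = 0 := by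
    rw [Finset.sum_sub_distrib, sum_AA, Finset.sum_const, Finset.card_univ, ZMod.card, nsmul_eq_mul, hmB]
    field_simp; ring
  have hrow : ∀ c : ZMod q, ∑ d, ew q (c * d) = 0 := by
    intro c
    by_cases hc : c = 0
    · subst hc
      simp [ew]
    · rw [← ew_sum q]
      exact Equiv.sum_comp (Equiv.mulLeft₀ c hc) (ew q)
  have hcol : ∀ d : ZMod q, ∑ c, ew q (c * d) = 0 := by
    intro d
    simp only [mul_comm _ d]
    exact hrow d
  refine le_trans (le_of_eq ?_) (bilinear_centered q _ _ hA hB)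
  congr 1
  have e1 : ∑ m ∈ Finset.range M, ∑ k ∈ Finset.range K, a m * b k * ew q ((m : ZMod q) * (k : ZMod q))
      = ∑ c, ∑ d, AA q M a c * AA q K b d * ew q (c * d) := by
    have h1 : ∀ c, ∑ d, AA q M a c * AA q K b d * ew q (c * d) = AA q M a c * ∑ k ∈ Finset.range K, b k * ew q (c * k) := by
      intro c
      rw [← sum_AA_mul q K b (fun d => ew q (c * d)), Finset.mul_sum]
      refine Finset.sum_congr rfl fun d _ => by ring
    simp only [h1]
    rw [sum_AA_mul q M a (fun c => ∑ k ∈ Finset.range K, b k * ew q (c * k))]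
    refine Finset.sum_congr rfl fun m _ => ?_
    rw [Finset.mul_sum]
    refine Finset.sum_congr rfl fun k _ => by ring
  rw [e1]
  have h1 : ∀ c d, (AA q M a c - mA) * (AA q K b d - mB) * ew q (c * d) =
      AA q M a c * AA q K b d * ew q (c * d) - AA q M a c * mB * ew q (c * d) - mA * (AA q K b d - mB) * ew q (c * d) := by
    intro c d; ring
  simp only [h1, Finset.sum_sub_distrib]
  have h2 : ∑ c, ∑ d, AA q M a c * mB * ew q (c * d) = 0 := by
    refine Finset.sum_eq_zero fun c _ => ?_
    rw [← Finset.mul_sum, hrow, mul_zero]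
  have h3 : ∑ c, ∑ d, mA * (AA q K b d - mB) * ew q (c * d) = 0 := by
    rw [Finset.sum_comm]
    refine Finset.sum_eq_zero fun d _ => ?_
    rw [← Finset.mul_sum, hcol, mul_zero]
  rw [h2, h3]; ring

lemma binary_lt (J : ℕ) : ∀ k y : ℕ, k < 2 ^ J → y < 2 ^ J →
    (if k < y then (1 : ℝ) else 0) =
      ∑ j ∈ Finset.range J, if y / 2 ^ j = k / 2 ^ j + 1 ∧ k / 2 ^ j % 2 = 0 then (1 : ℝ) else 0 := by
  induction J with
  | zero => intro k y hk hy; simp at hk hy; subst hk; subst hy; simp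
  | succ J ih =>
    intro k y hk hy
    rw [Finset.sum_range_succ']
    have h1 := ih (k / 2) (y / 2) (by rw [pow_succ] at hk; omega) (by rw [pow_succ] at hy; omega)
    simp only [pow_succ, mul_comm _ 2, ← Nat.div_div_eq_div_mul]
    rw [← h1]
    simp only [pow_zero, Nat.div_one]
    split_ifs <;> first | (exfalso; omega) | norm_num

lemma type_two (Q M K J : ℕ) (hQ1 : 1 ≤ Q) (S : Finset ℕ) (hS : ∀ q ∈ S, q.Prime) (hQ : ∀ q ∈ S, q ≤ Q)
    (Q0 : ℝ) (hQ0 : 0 < Q0) (hSQ0 : ∀ q ∈ S, Q0 ≤ q) (a b : ℕ → ℝ) (y : ℕ → ℕ)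
    (hy : ∀ m < M, y m < 2 ^ J) (hK : K ≤ 2 ^ J) (ΔM ΔK : ℝ)
    (hΔM : 8 * M + 2 * ((Q ^ 2 : ℕ) : ℝ) * (1 + Real.log ((Q ^ 2 : ℕ) : ℝ)) ≤ ΔM)
    (hΔK : 8 * K + 2 * ((Q ^ 2 : ℕ) : ℝ) * (1 + Real.log ((Q ^ 2 : ℕ) : ℝ)) ≤ ΔK) :
    ∑ q ∈ S, |∑ m ∈ Finset.range M, ∑ k ∈ Finset.range K,
      if k < y m then a m * b k * ew q ((m : ZMod q) * (k : ZMod q)) else 0| ≤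
    J * (3 / Q0 * (Real.sqrt (ΔM * ∑ m ∈ Finset.range M, a m ^ 2) * Real.sqrt (ΔK * ∑ k ∈ Finset.range K, b k ^ 2))) := by
  have hl : 0 ≤ Real.log ((Q ^ 2 : ℕ) : ℝ) := Real.log_nonneg (by exact_mod_cast Nat.one_le_pow _ _ hQ1)
  have hΔM0 : 0 ≤ ΔM := le_trans (by positivity) hΔM
  have hΔK0 : 0 ≤ ΔK := le_trans (by positivity) hΔK
  -- restricted sequences
  set aa : ℕ → ℕ → ℕ → ℝ := fun j h m => if y m / 2 ^ j = 2 * h + 1 then a m else 0 with haa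
  set bb : ℕ → ℕ → ℕ → ℝ := fun j h k => if k / 2 ^ j = 2 * h then b k else 0 with hbb
  set H := Finset.range (2 ^ J) with hH
  have e1 : ∀ q, ∑ m ∈ Finset.range M, ∑ k ∈ Finset.range K,
      (if k < y m then a m * b k * ew q ((m : ZMod q) * (k : ZMod q)) else 0) =
      ∑ j ∈ Finset.range J, ∑ h ∈ H, ∑ m ∈ Finset.range M, ∑ k ∈ Finset.range K,
        aa j h m * bb j h k * ew q ((m : ZMod q) * (k : ZMod q)) := by
    intro q
    have h1 : ∀ m ∈ Finset.range M, ∀ k ∈ Finset.range K,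
        (if k < y m then a m * b k * ew q ((m : ZMod q) * (k : ZMod q)) else 0) =
        ∑ j ∈ Finset.range J, ∑ h ∈ H, aa j h m * bb j h k * ew q ((m : ZMod q) * (k : ZMod q)) := by
      intro m hm k hk
      rw [Finset.mem_range] at hm hk
      have h2 := binary_lt J k (y m) (by omega) (hy m hm)
      have h3 : (if k < y m then a m * b k * ew q ((m : ZMod q) * (k : ZMod q)) else 0) =
        (if k < y m then (1 : ℝ) else 0) * (a m * b k * ew q ((m : ZMod q) * (k : ZMod q))) := by
        split_ifs <;> simp
      rw [h3, h2, Finset.sum_mul]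
      refine Finset.sum_congr rfl fun j _ => ?_
      rw [Finset.sum_eq_single (k / 2 ^ j / 2)]
      · simp only [haa, hbb]
        by_cases c1 : k / 2 ^ j % 2 = 0
        · have c2 : k / 2 ^ j = 2 * (k / 2 ^ j / 2) := by omega
          have c3 : (y m / 2 ^ j = k / 2 ^ j + 1) ↔ (y m / 2 ^ j = 2 * (k / 2 ^ j / 2) + 1) := by omega
          rw [if_pos c2]
          by_cases c4 : y m / 2 ^ j = k / 2 ^ j + 1
          · rw [if_pos ⟨c4, c1⟩, if_pos (c3.mp c4)]; ring
          · rw [if_neg (fun h => c4 h.1), if_neg (fun h => c4 (c3.mpr h))]; ring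
        · have c2 : ¬ k / 2 ^ j = 2 * (k / 2 ^ j / 2) := by omega
          rw [if_neg (fun h => c1 h.2), if_neg c2]; ring
      · intro h _ hne
        have : ¬ k / 2 ^ j = 2 * h := by omega
        simp only [hbb, if_neg this]; ring
      · intro hnot
        exfalso
        apply hnot
        rw [hH, Finset.mem_range]
        calc k / 2 ^ j / 2 ≤ k := (Nat.div_le_self _ _).trans (Nat.div_le_self _ _)
          _ < 2 ^ J := by omega
    rw [Finset.sum_congr rfl fun m hm => Finset.sum_congr rfl fun k hk => h1 m hm k hk]
    have h5 : ∀ m ∈ Finset.range M, (∑ k ∈ Finset.range K, ∑ j ∈ Finset.range J, ∑ h ∈ H,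
        aa j h m * bb j h k * ew q ((m : ZMod q) * (k : ZMod q))) =
        ∑ j ∈ Finset.range J, ∑ h ∈ H, ∑ k ∈ Finset.range K,
        aa j h m * bb j h k * ew q ((m : ZMod q) * (k : ZMod q)) := by
      intro m _
      rw [Finset.sum_comm]
      exact Finset.sum_congr rfl fun j _ => Finset.sum_comm
    rw [Finset.sum_congr rfl h5, Finset.sum_comm]
    exact Finset.sum_congr rfl fun j _ => Finset.sum_comm
  simp only [e1]
  -- bound per level
  have e2 : ∀ j ∈ Finset.range J, ∑ q ∈ S, ∑ h ∈ H, 3 * (Real.sqrt (VQ q M (aa j h)) * Real.sqrt (VQ q K (bb j h)))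
      ≤ 3 / Q0 * (Real.sqrt (ΔM * ∑ m ∈ Finset.range M, a m ^ 2) * Real.sqrt (ΔK * ∑ k ∈ Finset.range K, b k ^ 2)) := by
    intro j _
    have var : ∀ (N : ℕ) (Δ : ℝ) (s : ℕ → ℝ) (z : ℕ → ℕ → ℝ), 0 ≤ Δ →
        8 * N + 2 * ((Q ^ 2 : ℕ) : ℝ) * (1 + Real.log ((Q ^ 2 : ℕ) : ℝ)) ≤ Δ →
        (∀ n, ∑ h ∈ H, z h n ^ 2 ≤ s n ^ 2) →
        ∑ x ∈ S ×ˢ H, VQ x.1 N (z x.2) ≤ (Δ * ∑ n ∈ Finset.range N, s n ^ 2) / Q0 := by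
      intro N Δ s z hΔ0 hΔ hz
      rw [Finset.sum_product_right, le_div_iff₀ hQ0, Finset.sum_mul]
      calc ∑ h ∈ H, (∑ q ∈ S, VQ q N (z h)) * Q0 ≤ ∑ h ∈ H, Δ * ∑ n ∈ Finset.range N, z h n ^ 2 := by
            refine Finset.sum_le_sum fun h _ => ?_
            have l1 := large_sieve Q N hQ1 S hS hQ (z h)
            have l2 : (∑ q ∈ S, VQ q N (z h)) * Q0 ≤ ∑ q ∈ S, q * VQ q N (z h) := by
              rw [Finset.sum_mul]
              refine Finset.sum_le_sum fun q hq => ?_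
              rw [mul_comm]
              exact mul_le_mul_of_nonneg_right (hSQ0 q hq) (VQ_nonneg _ _ _)
            refine l2.trans (l1.trans ?_)
            gcongr
        _ = Δ * ∑ n ∈ Finset.range N, ∑ h ∈ H, z h n ^ 2 := by
            rw [← Finset.mul_sum, Finset.sum_comm]
        _ ≤ Δ * ∑ n ∈ Finset.range N, s n ^ 2 := by gcongr; exact hz _
    have v1 := var M ΔM a (aa j) hΔM0 hΔM (by
      intro m
      have : ∀ h ∈ H, aa j h m ^ 2 = if h = y m / 2 ^ j / 2 then aa j h m ^ 2 else 0 := by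
        intro h _
        split_ifs with c
        · rfl
        · have : ¬ y m / 2 ^ j = 2 * h + 1 := by omega
          simp only [haa, if_neg this]; ring
      rw [Finset.sum_congr rfl this, Finset.sum_ite_eq']
      split_ifs
      · simp only [haa]; split_ifs
        · exact le_rfl
        · simp; positivity
      · positivity)
    have v2 := var K ΔK b (bb j) hΔK0 hΔK (by
      intro m
      have : ∀ h ∈ H, bb j h m ^ 2 = if h = m / 2 ^ j / 2 then bb j h m ^ 2 else 0 := by
        intro h _
        split_ifs with c
        · rfl
        · have : ¬ m / 2 ^ j = 2 * h := by omega
          simp only [hbb, if_neg this]; ring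
      rw [Finset.sum_congr rfl this, Finset.sum_ite_eq']
      split_ifs
      · simp only [hbb]; split_ifs
        · exact le_rfl
        · simp; positivity
      · positivity)
    have c1 := Real.sum_sqrt_mul_sqrt_le (S ×ˢ H) (f := fun x => VQ x.1 M (aa j x.2)) (g := fun x => VQ x.1 K (bb j x.2))
      (fun x => VQ_nonneg _ _ _) (fun x => VQ_nonneg _ _ _)
    rw [Finset.sum_product] at c1
    simp only [← Finset.mul_sum]
    calc 3 * ∑ q ∈ S, ∑ h ∈ H, Real.sqrt (VQ q M (aa j h)) * Real.sqrt (VQ q K (bb j h))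
        ≤ 3 * (Real.sqrt ((ΔM * ∑ m ∈ Finset.range M, a m ^ 2) / Q0) * Real.sqrt ((ΔK * ∑ k ∈ Finset.range K, b k ^ 2) / Q0)) := by
          refine mul_le_mul_of_nonneg_left (c1.trans ?_) (by norm_num)
          gcongr
      _ = _ := by
          rw [Real.sqrt_div' _ hQ0.le, Real.sqrt_div' _ hQ0.le, div_mul_div_comm, Real.mul_self_sqrt hQ0.le]
          ring
  calc ∑ q ∈ S, |∑ j ∈ Finset.range J, ∑ h ∈ H, ∑ m ∈ Finset.range M, ∑ k ∈ Finset.range K,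
        aa j h m * bb j h k * ew q ((m : ZMod q) * (k : ZMod q))|
      ≤ ∑ q ∈ S, ∑ j ∈ Finset.range J, ∑ h ∈ H, 3 * (Real.sqrt (VQ q M (aa j h)) * Real.sqrt (VQ q K (bb j h))) := by
        refine Finset.sum_le_sum fun q hq => (Finset.abs_sum_le_sum_abs _ _).trans (Finset.sum_le_sum fun j _ =>
          (Finset.abs_sum_le_sum_abs _ _).trans (Finset.sum_le_sum fun h _ => bilinear q M K (hS q hq) _ _))
    _ = ∑ j ∈ Finset.range J, ∑ q ∈ S, ∑ h ∈ H, 3 * (Real.sqrt (VQ q M (aa j h)) * Real.sqrt (VQ q K (bb j h))) := Finset.sum_comm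
    _ ≤ ∑ j ∈ Finset.range J, _ := Finset.sum_le_sum e2
    _ = _ := by rw [Finset.sum_const, Finset.card_range, nsmul_eq_mul]


/-- Twisted sum of `f` up to `x`. -/
noncomputable def EE (q x : ℕ) (f : ArithmeticFunction ℝ) : ℝ :=
  ∑ n ∈ Finset.range (x + 1), f n * ew q (n : ZMod q)

/-- Truncation of an arithmetic function. -/
noncomputable def trunc (U : ℕ) (f : ArithmeticFunction ℝ) : ArithmeticFunction ℝ :=
  ⟨fun n => if n ≤ U then f n else 0, by simp⟩

lemma trunc_apply (U : ℕ) (f : ArithmeticFunction ℝ) (n : ℕ) :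
    trunc U f n = if n ≤ U then f n else 0 := rfl

lemma EE_add (q x : ℕ) (f g : ArithmeticFunction ℝ) : EE q x (f + g) = EE q x f + EE q x g := by
  unfold EE
  rw [← Finset.sum_add_distrib]
  refine Finset.sum_congr rfl fun n _ => ?_
  rw [ArithmeticFunction.add_apply]; ring

lemma EE_sub (q x : ℕ) (f g : ArithmeticFunction ℝ) : EE q x (f - g) = EE q x f - EE q x g := by
  have := EE_add q x (f - g) g
  rw [sub_add_cancel] at this
  linarith

lemma af_sub_apply (f g : ArithmeticFunction ℝ) (n : ℕ) : (f - g) n = f n - g n := by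
  have := congrArg (fun h : ArithmeticFunction ℝ => h n) (sub_add_cancel f g)
  simp only [ArithmeticFunction.add_apply] at this
  linarith

lemma range_to_Ioc (x : ℕ) (h : ℕ → ℝ) (h0 : h 0 = 0) :
    ∑ n ∈ Finset.range (x + 1), h n = ∑ n ∈ Finset.Ioc 0 x, h n := by
  symm
  apply Finset.sum_subset
  · intro n hn; simp at hn ⊢; omega
  · intro n hn hn'
    simp at hn hn'
    have : n = 0 := by omega
    rw [this, h0]

lemma EE_mul (q x : ℕ) (f g : ArithmeticFunction ℝ) :
    EE q x (f * g) = ∑ m ∈ Finset.range (x + 1), ∑ k ∈ Finset.range (x / m + 1),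
      f m * g k * ew q ((m : ZMod q) * (k : ZMod q)) := by
  set w : ℕ → ℝ := fun n => ew q (n : ZMod q) with hw
  unfold EE
  rw [range_to_Ioc _ _ (by simp), range_to_Ioc _ _ (by simp)]
  have h2 : ∀ m ∈ Finset.Ioc 0 x, ∑ k ∈ Finset.range (x / m + 1), f m * g k * ew q ((m : ZMod q) * (k : ZMod q))
      = ∑ k ∈ Finset.Ioc 0 x, if m * k ≤ x then f m * g k * w (m * k) else 0 := by
    intro m hm
    rw [Finset.mem_Ioc] at hm
    rw [range_to_Ioc _ _ (by simp), ← Finset.sum_filter]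
    refine Finset.sum_congr ?_ fun k _ => by simp [hw]
    ext k
    simp only [Finset.mem_Ioc, Finset.mem_filter]
    rw [Nat.le_div_iff_mul_le hm.1, mul_comm k m]
    constructor
    · rintro ⟨h, h'⟩
      exact ⟨⟨h, le_trans (Nat.le_mul_of_pos_left k hm.1) h'⟩, h'⟩
    · rintro ⟨⟨h, _⟩, h'⟩
      exact ⟨h, h'⟩
  rw [Finset.sum_congr rfl h2]
  have h3 : ∀ n ∈ Finset.Ioc 0 x, (f * g) n * ew q (n : ZMod q) =
      ∑ m ∈ Finset.Ioc 0 x, ∑ k ∈ Finset.Ioc 0 x, if m * k = n then f m * g k * w (m * k) else 0 := by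
    intro n hn
    rw [Finset.mem_Ioc] at hn
    rw [ArithmeticFunction.mul_apply, Nat.divisorsAntidiagonal_eq_prod_filter_of_le hn.1.ne' hn.2,
      Finset.sum_filter, Finset.sum_product, Finset.sum_mul]
    refine Finset.sum_congr rfl fun m _ => ?_
    rw [Finset.sum_mul]
    refine Finset.sum_congr rfl fun k _ => ?_
    split_ifs with h
    · simp only at h; rw [h]
    · simp
  rw [Finset.sum_congr rfl h3, Finset.sum_comm]
  refine Finset.sum_congr rfl fun m hm => ?_
  rw [Finset.sum_comm]
  refine Finset.sum_congr rfl fun k hk => ?_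
  rw [Finset.sum_ite_eq]
  rw [Finset.mem_Ioc] at hm hk
  have : 0 < m * k := Nat.mul_pos hm.1 hk.1
  refine if_congr ?_ rfl rfl
  simp [Finset.mem_Ioc]; omega

lemma vaughan (U V : ℕ) : ArithmeticFunction.vonMangoldt =
    trunc V ArithmeticFunction.vonMangoldt
    + trunc U (ArithmeticFunction.moebius : ArithmeticFunction ℝ) * ArithmeticFunction.log
    - (trunc U (ArithmeticFunction.moebius : ArithmeticFunction ℝ) * trunc V ArithmeticFunction.vonMangoldt) * (ArithmeticFunction.zeta : ArithmeticFunction ℝ)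
    + ((ArithmeticFunction.moebius : ArithmeticFunction ℝ) - trunc U (ArithmeticFunction.moebius : ArithmeticFunction ℝ)) *
      ((ArithmeticFunction.vonMangoldt - trunc V ArithmeticFunction.vonMangoldt) * (ArithmeticFunction.zeta : ArithmeticFunction ℝ)) := by
  have h1 : (ArithmeticFunction.moebius : ArithmeticFunction ℝ) * (ArithmeticFunction.zeta : ArithmeticFunction ℝ) = 1 :=
    ArithmeticFunction.coe_moebius_mul_coe_zeta
  have h2 := ArithmeticFunction.vonMangoldt_mul_zeta
  rw [← h2]
  generalize (ArithmeticFunction.moebius : ArithmeticFunction ℝ) = m at *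
  generalize (ArithmeticFunction.zeta : ArithmeticFunction ℝ) = z at *
  generalize (ArithmeticFunction.vonMangoldt) = L at *
  generalize trunc U m = m1
  generalize trunc V L = l1
  linear_combination (l1 - L) * h1

lemma range_sum_zmod (q : ℕ) [NeZero q] (h : ZMod q → ℝ) :
    ∑ i ∈ Finset.range q, h (i : ZMod q) = ∑ c, h c := by
  refine Finset.sum_bij (fun i _ => (i : ZMod q)) (by simp) ?_ ?_ (by simp)
  · intro a ha b hb hab
    simp at ha hb
    rw [ZMod.natCast_eq_natCast_iff, Nat.ModEq, Nat.mod_eq_of_lt ha, Nat.mod_eq_of_lt hb] at hab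
    exact hab
  · intro c _
    exact ⟨c.val, by simp [ZMod.val_lt], by simp⟩

lemma periodic_bound (q : ℕ) [NeZero q] (h : ZMod q → ℝ) (h0 : ∑ c, h c = 0) (y : ℕ) :
    |∑ k ∈ Finset.range y, h (k : ZMod q)| ≤ ∑ c, |h c| := by
  induction y using Nat.strong_induction_on with
  | _ y ih =>
    by_cases hy : y < q
    · refine (Finset.abs_sum_le_sum_abs _ _).trans ?_
      rw [← range_sum_zmod q (fun c => |h c|)]
      exact Finset.sum_le_sum_of_subset_of_nonneg (Finset.range_mono hy.le) fun _ _ _ => abs_nonneg _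
    · have hq : 0 < q := Nat.pos_of_ne_zero (NeZero.ne q)
      have := ih (y - q) (by omega)
      have e : y = (y - q) + q := by omega
      rw [e, Finset.sum_range_add]
      have : ∑ i ∈ Finset.range q, h (((y - q + i : ℕ)) : ZMod q) = 0 := by
        rw [← h0, ← Equiv.sum_comp (Equiv.addLeft ((y - q : ℕ) : ZMod q)) h, ← range_sum_zmod q]
        refine Finset.sum_congr rfl fun i _ => by simp
      rw [this, add_zero]
      assumption

lemma ew_partial (q : ℕ) (hq : q.Prime) (m y : ℕ) :
    |∑ k ∈ Finset.range y, ew q ((m : ZMod q) * (k : ZMod q))| ≤ 2 := by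
  have : Fact q.Prime := ⟨hq⟩
  have : NeZero q := ⟨hq.ne_zero⟩
  have hq2 : (2 : ℝ) ≤ q := by exact_mod_cast hq.two_le
  by_cases hm : (m : ZMod q) = 0
  · rw [hm]
    simp [ew]
  · have hs : ∑ c, ew q ((m : ZMod q) * c) = 0 := by
      rw [← ew_sum q]
      exact Equiv.sum_comp (Equiv.mulLeft₀ _ hm) (ew q)
    refine (periodic_bound q (fun c => ew q ((m : ZMod q) * c)) hs y).trans ?_
    have e : ∑ c, |ew q ((m : ZMod q) * c)| = ∑ c, |ew q c| :=
      Equiv.sum_comp (Equiv.mulLeft₀ _ hm) (fun c => |ew q c|)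
    rw [e]
    have hk : 0 ≤ 1 / ((q : ℝ) - 1) := by apply div_nonneg <;> linarith
    have h1 : ∀ c, |ew q c| ≤ 2 * (if c = 1 then 1 else 0) - ew q c := by
      intro c
      unfold ew
      by_cases c0 : c = 0
      · subst c0; simp
      · by_cases c1 : c = 1
        · subst c1
          simp only [if_true, one_ne_zero, if_false]
          rw [abs_of_nonneg]
          · linarith
          · have : 1 / ((q : ℝ) - 1) ≤ 1 := by rw [div_le_one] <;> linarith
            linarith
        · simp only [c0, c1, if_false]
          rw [zero_sub, abs_neg, abs_of_nonneg hk]; linarith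
    refine (Finset.sum_le_sum fun c _ => h1 c).trans ?_
    rw [Finset.sum_sub_distrib, ew_sum, ← Finset.mul_sum]
    simp

lemma abel_bound (a w : ℕ → ℝ) (B : ℝ) (ha0 : a 0 = 0) (ha : Monotone a)
    (hw : ∀ y, |∑ k ∈ Finset.range y, w k| ≤ B) (y : ℕ) :
    |∑ k ∈ Finset.range (y + 1), a k * w k| ≤ 2 * B * a y := by
  have key : ∀ y, |∑ k ∈ Finset.range (y + 1), a k * w k - a y * ∑ k ∈ Finset.range (y + 1), w k| ≤ B * a y := by
    intro y
    induction y with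
    | zero => simp [ha0]
    | succ y ih =>
      rw [Finset.sum_range_succ, Finset.sum_range_succ w]
      set T := ∑ k ∈ Finset.range (y + 1), a k * w k
      have hP := hw (y + 1)
      set P := ∑ k ∈ Finset.range (y + 1), w k
      have e : T + a (y + 1) * w (y + 1) - a (y + 1) * (P + w (y + 1)) = (T - a y * P) - (a (y + 1) - a y) * P := by ring
      rw [e]
      have hm := ha (Nat.le_succ y)
      have h2 : |(a (y + 1) - a y) * P| ≤ (a (y + 1) - a y) * B := by
        rw [abs_mul, abs_of_nonneg (sub_nonneg.mpr hm)]
        exact mul_le_mul_of_nonneg_left hP (sub_nonneg.mpr hm)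
      have := abs_sub (T - a y * P) ((a (y + 1) - a y) * P)
      linarith
  have h1 := key y
  have hay : 0 ≤ a y := ha0 ▸ ha (Nat.zero_le y)
  have h2 : |a y * ∑ k ∈ Finset.range (y + 1), w k| ≤ a y * B := by
    rw [abs_mul, abs_of_nonneg hay]
    exact mul_le_mul_of_nonneg_left (hw _) hay
  have h3 := abs_add_le (∑ k ∈ Finset.range (y + 1), a k * w k - a y * ∑ k ∈ Finset.range (y + 1), w k) (a y * ∑ k ∈ Finset.range (y + 1), w k)
  rw [sub_add_cancel] at h3
  linarith

lemma log_partial (q : ℕ) (hq : q.Prime) (m y x : ℕ) (hyx : y ≤ x) :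
    |∑ k ∈ Finset.range (y + 1), ArithmeticFunction.log k * ew q ((m : ZMod q) * (k : ZMod q))| ≤ 4 * Real.log x := by
  have hmono : Monotone fun k : ℕ => Real.log (k : ℝ) := by
    intro a b hab
    rcases Nat.eq_zero_or_pos a with h | h
    · subst h; simp only [Nat.cast_zero, Real.log_zero]; exact Real.log_natCast_nonneg b
    · exact Real.log_le_log (by exact_mod_cast h) (by exact_mod_cast hab)
  have := abel_bound (fun k : ℕ => Real.log (k : ℝ)) (fun k => ew q ((m : ZMod q) * (k : ZMod q))) 2 (by simp) hmono
    (fun y => ew_partial q hq m y) y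
  simp only [ArithmeticFunction.log_apply]
  have h2 := hmono hyx
  simp only at h2
  linarith

lemma type_one (q x Y : ℕ) (F G : ℝ) (hF : 0 ≤ F) (hG : 0 ≤ G) (f g : ArithmeticFunction ℝ)
    (hf0 : ∀ m, Y < m → f m = 0) (hf : ∀ m ≤ x, |f m| ≤ F)
    (hg : ∀ m y : ℕ, y ≤ x → |∑ k ∈ Finset.range (y + 1), g k * ew q ((m : ZMod q) * (k : ZMod q))| ≤ G) :
    |EE q x (f * g)| ≤ Y * (F * G) := by
  rw [EE_mul, range_to_Ioc _ _ (by simp)]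
  have h1 : ∀ m ∈ Finset.Ioc 0 x, |∑ k ∈ Finset.range (x / m + 1), f m * g k * ew q ((m : ZMod q) * (k : ZMod q))|
      ≤ if m ∈ Finset.Ioc 0 Y then F * G else 0 := by
    intro m hm
    rw [Finset.mem_Ioc] at hm
    simp only [mul_assoc]
    rw [← Finset.mul_sum, abs_mul]
    split_ifs with h
    · exact mul_le_mul (hf m hm.2) (hg m _ (Nat.div_le_self _ _)) (abs_nonneg _) hF
    · rw [Finset.mem_Ioc] at h
      rw [hf0 m (by omega)]; simp
  refine (Finset.abs_sum_le_sum_abs _ _).trans ((Finset.sum_le_sum h1).trans ?_)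
  rw [← Finset.sum_filter, Finset.sum_const, nsmul_eq_mul]
  gcongr
  refine (Finset.card_le_card (t := Finset.Ioc 0 Y) ?_).trans (by simp)
  intro m hm
  exact (Finset.mem_filter.mp hm).2


/-- Real-valued Moebius function. -/
noncomputable abbrev muR : ArithmeticFunction ℝ := (ArithmeticFunction.moebius : ArithmeticFunction ℝ)

/-- The large part of Moebius. -/
noncomputable def muBig (U : ℕ) : ArithmeticFunction ℝ := muR - trunc U muR

/-- The divisor sum of the large part of von Mangoldt. -/
noncomputable def bBig (V : ℕ) : ArithmeticFunction ℝ :=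
  (ArithmeticFunction.vonMangoldt - trunc V ArithmeticFunction.vonMangoldt) * (ArithmeticFunction.zeta : ArithmeticFunction ℝ)

lemma muR_abs (n : ℕ) : |muR n| ≤ 1 := by
  rw [ArithmeticFunction.intCoe_apply]
  exact_mod_cast ArithmeticFunction.abs_moebius_le_one

lemma muBig_apply (U n : ℕ) : muBig U n = if n ≤ U then 0 else muR n := by
  unfold muBig
  rw [af_sub_apply, trunc_apply]
  split_ifs <;> simp

lemma muBig_abs (U n : ℕ) : |muBig U n| ≤ 1 := by
  rw [muBig_apply]
  split_ifs
  · simp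
  · exact muR_abs n

lemma lamBig_apply (V n : ℕ) : (ArithmeticFunction.vonMangoldt - trunc V ArithmeticFunction.vonMangoldt : ArithmeticFunction ℝ) n =
    if n ≤ V then 0 else ArithmeticFunction.vonMangoldt n := by
  rw [af_sub_apply, trunc_apply]
  split_ifs <;> simp

lemma bBig_apply (V n : ℕ) : bBig V n = ∑ d ∈ n.divisors, if d ≤ V then 0 else ArithmeticFunction.vonMangoldt d := by
  unfold bBig
  rw [ArithmeticFunction.coe_mul_zeta_apply]
  exact Finset.sum_congr rfl fun d _ => lamBig_apply V d

lemma bBig_nonneg (V n : ℕ) : 0 ≤ bBig V n := by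
  rw [bBig_apply]
  refine Finset.sum_nonneg fun d _ => ?_
  split_ifs
  · exact le_rfl
  · exact ArithmeticFunction.vonMangoldt_nonneg

lemma bBig_le (V n : ℕ) : bBig V n ≤ Real.log n := by
  rw [bBig_apply, ← ArithmeticFunction.vonMangoldt_sum]
  refine Finset.sum_le_sum fun d _ => ?_
  split_ifs
  · exact ArithmeticFunction.vonMangoldt_nonneg
  · exact le_rfl

lemma bBig_zero (V n : ℕ) (h : n ≤ V) : bBig V n = 0 := by
  rw [bBig_apply]
  refine Finset.sum_eq_zero fun d hd => ?_
  rw [if_pos ((Nat.divisor_le hd).trans h)]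

lemma log_nat_mono {a b : ℕ} (hab : a ≤ b) : Real.log (a : ℝ) ≤ Real.log (b : ℝ) := by
  rcases Nat.eq_zero_or_pos a with h | h
  · subst h; simp only [Nat.cast_zero, Real.log_zero]; exact Real.log_natCast_nonneg b
  · exact Real.log_le_log (by exact_mod_cast h) (by exact_mod_cast hab)

lemma vaughan_one (q x U : ℕ) (hq : q.Prime) (hU : 1 ≤ U) :
    |EE q x ArithmeticFunction.vonMangoldt - EE q x (muBig U * bBig U)| ≤ 7 * (U : ℝ) ^ 2 * Real.log x := by
  have : Fact q.Prime := ⟨hq⟩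
  have hL : 0 ≤ Real.log (x : ℝ) := Real.log_natCast_nonneg x
  have hU1 : (1 : ℝ) ≤ U := by exact_mod_cast hU
  have e : EE q x ArithmeticFunction.vonMangoldt - EE q x (muBig U * bBig U) =
    EE q x (trunc U ArithmeticFunction.vonMangoldt) + EE q x (trunc U muR * ArithmeticFunction.log)
     - EE q x ((trunc U muR * trunc U ArithmeticFunction.vonMangoldt) * (ArithmeticFunction.zeta : ArithmeticFunction ℝ)) := by
    have := congrArg (EE q x) (vaughan U U)
    rw [EE_add, EE_sub, EE_add] at this
    unfold muBig bBig
    linarith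
  have htr : ∀ m, |trunc U muR m| ≤ 1 := by
    intro m
    rw [trunc_apply]
    split_ifs
    · exact muR_abs m
    · simp
  have h1 : |EE q x (trunc U ArithmeticFunction.vonMangoldt)| ≤ U * Real.log x := by
    unfold EE
    rw [range_to_Ioc _ _ (by simp)]
    refine (Finset.abs_sum_le_sum_abs _ _).trans ?_
    have : ∀ n ∈ Finset.Ioc 0 x, |trunc U ArithmeticFunction.vonMangoldt n * ew q (n : ZMod q)| ≤
        if n ∈ Finset.Ioc 0 U then Real.log x else 0 := by
      intro n hn
      rw [Finset.mem_Ioc] at hn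
      rw [abs_mul, trunc_apply]
      by_cases h : n ≤ U
      · rw [if_pos h, if_pos (Finset.mem_Ioc.mpr ⟨hn.1, h⟩), abs_of_nonneg ArithmeticFunction.vonMangoldt_nonneg]
        calc _ ≤ Real.log n * 1 := mul_le_mul ArithmeticFunction.vonMangoldt_le_log (ew_abs_le q _) (abs_nonneg _) (Real.log_natCast_nonneg n)
          _ ≤ Real.log x := by rw [mul_one]; exact log_nat_mono hn.2
      · rw [if_neg h, if_neg (fun h' => h (Finset.mem_Ioc.mp h').2)]; simp
    refine (Finset.sum_le_sum this).trans ?_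
    rw [← Finset.sum_filter, Finset.sum_const, nsmul_eq_mul]
    gcongr
    refine (Finset.card_le_card (t := Finset.Ioc 0 U) ?_).trans (by simp)
    intro m hm
    exact (Finset.mem_filter.mp hm).2
  have h2 := type_one q x U 1 (4 * Real.log x) zero_le_one (by positivity) (trunc U muR) ArithmeticFunction.log
    (fun m hm => by rw [trunc_apply, if_neg (by omega)]) (fun m _ => htr m)
    (fun m y hy => log_partial q hq m y x hy)
  have h3 := type_one q x (U * U) (Real.log x) 2 hL (by norm_num) (trunc U muR * trunc U ArithmeticFunction.vonMangoldt)
    (ArithmeticFunction.zeta : ArithmeticFunction ℝ)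
    (fun m hm => by
      rw [ArithmeticFunction.mul_apply]
      refine Finset.sum_eq_zero fun p hp => ?_
      rw [Nat.mem_divisorsAntidiagonal] at hp
      rw [trunc_apply, trunc_apply]
      by_cases c1 : p.1 ≤ U
      · by_cases c2 : p.2 ≤ U
        · have := Nat.mul_le_mul c1 c2
          omega
        · rw [if_neg c2, mul_zero]
      · rw [if_neg c1, zero_mul])
    (fun m hm => by
      rw [ArithmeticFunction.mul_apply]
      refine (Finset.abs_sum_le_sum_abs _ _).trans ?_
      refine le_trans ?_ (log_nat_mono hm)
      rw [← ArithmeticFunction.vonMangoldt_sum, ← Nat.sum_divisorsAntidiagonal' (fun _ j => ArithmeticFunction.vonMangoldt j)]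
      refine Finset.sum_le_sum fun p _ => ?_
      rw [abs_mul]
      have : |trunc U ArithmeticFunction.vonMangoldt p.2| ≤ ArithmeticFunction.vonMangoldt p.2 := by
        rw [trunc_apply]
        split_ifs
        · rw [abs_of_nonneg ArithmeticFunction.vonMangoldt_nonneg]
        · rw [abs_zero]; exact ArithmeticFunction.vonMangoldt_nonneg
      calc _ ≤ 1 * ArithmeticFunction.vonMangoldt p.2 := mul_le_mul (htr _) this (abs_nonneg _) zero_le_one
        _ = _ := one_mul _)
    (fun m y _ => by
      refine le_trans (le_of_eq ?_) (ew_partial q hq m (y + 1))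
      congr 1
      refine Finset.sum_congr rfl fun k _ => ?_
      rcases Nat.eq_zero_or_pos k with h | h
      · subst h; simp [ew]
      · rw [ArithmeticFunction.natCoe_apply, ArithmeticFunction.zeta_apply_ne h.ne']; simp)
  rw [e]
  have t1 := abs_sub (EE q x (trunc U ArithmeticFunction.vonMangoldt) + EE q x (trunc U muR * ArithmeticFunction.log))
    (EE q x ((trunc U muR * trunc U ArithmeticFunction.vonMangoldt) * (ArithmeticFunction.zeta : ArithmeticFunction ℝ)))
  have t2 := abs_add_le (EE q x (trunc U ArithmeticFunction.vonMangoldt)) (EE q x (trunc U muR * ArithmeticFunction.log))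
  push_cast at h3
  have h4 : (U : ℝ) * Real.log x ≤ (U : ℝ) ^ 2 * Real.log x := by
    gcongr; nlinarith
  nlinarith

lemma dyadic_sum (I x : ℕ) (hI : x < 2 ^ I) (F : ℕ → ℝ) (h0 : F 0 = 0) (hx : ∀ m, x < m → F m = 0) :
    ∑ m ∈ Finset.range (x + 1), F m =
      ∑ i ∈ Finset.range I, ∑ m ∈ Finset.range (2 ^ (i + 1)), if 2 ^ i ≤ m then F m else 0 := by
  have h1 : ∑ m ∈ Finset.range (x + 1), F m = ∑ m ∈ Finset.range (2 ^ I), F m := by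
    apply Finset.sum_subset
    · exact Finset.range_mono hI
    · intro m _ hm
      exact hx m (by simp at hm; omega)
  rw [h1]
  clear hI h1
  induction I with
  | zero => simp [h0]
  | succ I ih =>
    rw [Finset.sum_range_succ, ← ih]
    have e : (2 : ℕ) ^ (I + 1) = 2 ^ I + 2 ^ I := by ring
    rw [e, Finset.sum_range_add, Finset.sum_range_add]
    have z : ∑ m ∈ Finset.range (2 ^ I), (if 2 ^ I ≤ m then F m else 0) = 0 := by
      refine Finset.sum_eq_zero fun m hm => ?_
      rw [Finset.mem_range] at hm
      rw [if_neg (by omega)]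
    rw [z, zero_add]
    congr 1
    refine Finset.sum_congr rfl fun m _ => ?_
    rw [if_pos (by omega)]

lemma vaughan_two (Q x U J : ℕ) (hQ1 : 1 ≤ Q) (hU : 1 ≤ U) (S : Finset ℕ) (hS : ∀ q ∈ S, q.Prime) (hQ : ∀ q ∈ S, q ≤ Q)
    (Q0 : ℝ) (hQ0 : 0 < Q0) (hSQ0 : ∀ q ∈ S, Q0 ≤ q) (hJ : x + 1 < 2 ^ J) (D : ℝ)
    (hD : 2 * ((Q ^ 2 : ℕ) : ℝ) * (1 + Real.log ((Q ^ 2 : ℕ) : ℝ)) ≤ D) :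
    ∑ q ∈ S, |EE q x (muBig U * bBig U)| ≤
      J * (J * (3 / Q0 * Real.sqrt (4 * x * Real.log x ^ 2 * (256 * x + 64 * D * (x / U) + D ^ 2)))) := by
  have hl : 0 ≤ Real.log ((Q ^ 2 : ℕ) : ℝ) := Real.log_nonneg (by exact_mod_cast Nat.one_le_pow _ _ hQ1)
  have hD0 : 0 ≤ D := le_trans (by positivity) hD
  have hU1 : (1 : ℝ) ≤ U := by exact_mod_cast hU
  have hL : 0 ≤ Real.log (x : ℝ) := Real.log_natCast_nonneg x
  set R := J * (3 / Q0 * Real.sqrt (4 * x * Real.log x ^ 2 * (256 * x + 64 * D * (x / U) + D ^ 2))) with hR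
  have hR0 : 0 ≤ R := by positivity
  set aa : ℕ → ℕ → ℝ := fun i m => if 2 ^ i ≤ m then muBig U m else 0 with haa
  have haa1 : ∀ i m, aa i m ^ 2 ≤ 1 := by
    intro i m
    simp only [haa]
    split_ifs
    · rw [← sq_abs]; exact pow_le_one₀ (abs_nonneg _) (muBig_abs _ _)
    · norm_num
  -- dyadic decomposition
  have e1 : ∀ q, EE q x (muBig U * bBig U) = ∑ i ∈ Finset.range J,
      ∑ m ∈ Finset.range (2 ^ (i + 1)), ∑ k ∈ Finset.range (x / 2 ^ i + 1),
        if k < x / m + 1 then aa i m * bBig U k * ew q ((m : ZMod q) * (k : ZMod q)) else 0 := by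
    intro q
    rw [EE_mul, dyadic_sum J x (by omega) _ (by simp)]
    · refine Finset.sum_congr rfl fun i _ => Finset.sum_congr rfl fun m _ => ?_
      split_ifs with h
      · have hle : x / m ≤ x / 2 ^ i := Nat.div_le_div_left h (by positivity)
        rw [← Finset.sum_filter]
        refine Finset.sum_congr ?_ fun k _ => by simp only [haa, if_pos h]
        ext k
        simp only [Finset.mem_range, Finset.mem_filter]
        omega
      · symm
        refine Finset.sum_eq_zero fun k _ => ?_
        simp only [haa, if_neg h]
        simp
    · intro m hm
      rw [Nat.div_eq_of_lt hm]
      simp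
  have e2 : ∀ i ∈ Finset.range J, ∑ q ∈ S, |∑ m ∈ Finset.range (2 ^ (i + 1)), ∑ k ∈ Finset.range (x / 2 ^ i + 1),
        if k < x / m + 1 then aa i m * bBig U k * ew q ((m : ZMod q) * (k : ZMod q)) else 0| ≤ R := by
    intro i _
    by_cases c1 : 2 ^ (i + 1) ≤ U
    · refine le_trans (le_of_eq ?_) hR0
      refine Finset.sum_eq_zero fun q _ => ?_
      rw [abs_eq_zero]
      refine Finset.sum_eq_zero fun m hm => Finset.sum_eq_zero fun k _ => ?_
      rw [Finset.mem_range] at hm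
      have : aa i m = 0 := by
        simp only [haa]
        rw [muBig_apply, if_pos (show m ≤ U by omega)]; simp
      rw [this]; simp
    · by_cases c2 : x / 2 ^ i ≤ U
      · refine le_trans (le_of_eq ?_) hR0
        refine Finset.sum_eq_zero fun q _ => ?_
        rw [abs_eq_zero]
        refine Finset.sum_eq_zero fun m hm => Finset.sum_eq_zero fun k hk => ?_
        rw [Finset.mem_range] at hk
        rw [bBig_zero U k (by omega)]; simp
      · push Not at c1 c2
        have hxi : x / 2 ^ i ≤ x := Nat.div_le_self _ _
        have T := type_two Q (2 ^ (i + 1)) (x / 2 ^ i + 1) J hQ1 S hS hQ Q0 hQ0 hSQ0 (aa i) (bBig U) (fun m => x / m + 1)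
          (fun m _ => by have := Nat.div_le_self x m; omega) (by omega)
          (8 * ((2 ^ (i + 1) : ℕ) : ℝ) + D) (8 * ((x / 2 ^ i + 1 : ℕ) : ℝ) + D) (by linarith) (by linarith)
        refine T.trans ?_
        rw [hR]
        have hmul : 2 ^ (i + 1) * (x / 2 ^ i + 1) ≤ 4 * x := by
          have h1 : 2 ^ i * (x / 2 ^ i) ≤ x := Nat.mul_div_le _ _
          have h2 : 2 ^ i ≤ x := by
            refine le_trans ?_ h1
            exact Nat.le_mul_of_pos_right _ (by omega)
          rw [pow_succ]; nlinarith
        have hK : U ≤ x / 2 ^ i + 1 := by omega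
        have hKx : x / 2 ^ i + 1 ≤ x + 1 := by omega
        clear T
        generalize x / 2 ^ i + 1 = K at *
        generalize 2 ^ (i + 1) = M at *
        have hMr : (U : ℝ) ≤ M := by exact_mod_cast c1.le
        have hKr : (U : ℝ) ≤ K := by exact_mod_cast hK
        have hmulr : (M : ℝ) * K ≤ 4 * x := by exact_mod_cast hmul
        have hA : ∑ m ∈ Finset.range M, aa i m ^ 2 ≤ M := by
          refine (Finset.sum_le_sum fun m _ => haa1 i m).trans ?_
          simp
        have hB : ∑ k ∈ Finset.range K, bBig U k ^ 2 ≤ K * Real.log x ^ 2 := by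
          have : ∀ k ∈ Finset.range K, bBig U k ^ 2 ≤ Real.log x ^ 2 := by
            intro k hk
            rw [Finset.mem_range] at hk
            refine pow_le_pow_left₀ (bBig_nonneg _ _) ((bBig_le U k).trans (log_nat_mono ?_)) 2
            omega
          refine (Finset.sum_le_sum this).trans ?_
          simp
        rw [← Real.sqrt_mul (by positivity)]
        refine mul_le_mul_of_nonneg_left (mul_le_mul_of_nonneg_left (Real.sqrt_le_sqrt ?_) (by positivity)) (by positivity)
        have hx0 : (0 : ℝ) ≤ x := Nat.cast_nonneg _
        have hM4 : (M : ℝ) ≤ 4 * (x / U) := by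
          rw [← mul_div_assoc, le_div_iff₀ (by linarith)]
          nlinarith
        have hK4 : (K : ℝ) ≤ 4 * (x / U) := by
          rw [← mul_div_assoc, le_div_iff₀ (by linarith)]
          nlinarith
        calc (8 * (M : ℝ) + D) * (∑ m ∈ Finset.range M, aa i m ^ 2) * ((8 * (K : ℝ) + D) * ∑ k ∈ Finset.range K, bBig U k ^ 2)
            ≤ (8 * (M : ℝ) + D) * M * ((8 * (K : ℝ) + D) * (K * Real.log x ^ 2)) := by gcongr
          _ = (M * K) * Real.log x ^ 2 * (64 * (M * K) + 8 * D * (M + K) + D ^ 2) := by ring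
          _ ≤ (4 * x) * Real.log x ^ 2 * (64 * (4 * x) + 8 * D * (4 * (x / U) + 4 * (x / U)) + D ^ 2) := by gcongr
          _ = _ := by ring
  simp only [e1]
  calc _ ≤ ∑ q ∈ S, ∑ i ∈ Finset.range J, |∑ m ∈ Finset.range (2 ^ (i + 1)), ∑ k ∈ Finset.range (x / 2 ^ i + 1),
        if k < x / m + 1 then aa i m * bBig U k * ew q ((m : ZMod q) * (k : ZMod q)) else 0| :=
        Finset.sum_le_sum fun q _ => Finset.abs_sum_le_sum_abs _ _
    _ = ∑ i ∈ Finset.range J, ∑ q ∈ S, |∑ m ∈ Finset.range (2 ^ (i + 1)), ∑ k ∈ Finset.range (x / 2 ^ i + 1),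
        if k < x / m + 1 then aa i m * bBig U k * ew q ((m : ZMod q) * (k : ZMod q)) else 0| := Finset.sum_comm
    _ ≤ ∑ i ∈ Finset.range J, R := Finset.sum_le_sum e2
    _ = J * R := by simp


lemma EE_lower (q x : ℕ) (hq : q.Prime) (hx : 1 ≤ x)
    (hpos : 0 ≤ Chebyshev.psi x - Real.log x - 2 * Real.sqrt x * Real.log x) :
    (Chebyshev.psi x - Real.log x - 2 * Real.sqrt x * Real.log x) / q
      - (((Finset.range (x + 1)).filter fun p => p.Prime ∧ q ∣ p - 1).card : ℝ) * Real.log x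
      - 2 * Real.sqrt x * Real.log x ≤ |EE q x ArithmeticFunction.vonMangoldt| := by
  have hf : Fact q.Prime := ⟨hq⟩
  have hq2 : (2 : ℝ) ≤ q := by exact_mod_cast hq.two_le
  set W := Chebyshev.psi x - Chebyshev.theta x with hW
  have hWle : W ≤ 2 * Real.sqrt x * Real.log x := Chebyshev.psi_sub_theta_le (by exact_mod_cast hx)
  have hWe : W = ∑ n ∈ Finset.range (x + 1), if ¬ n.Prime then ArithmeticFunction.vonMangoldt n else 0 := by
    rw [hW, Chebyshev.psi_sub_theta_eq_sum_not_prime, Nat.floor_natCast, Finset.sum_filter, range_to_Ioc _ _ (by simp)]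
  have hpsi : Chebyshev.psi x = ∑ n ∈ Finset.range (x + 1), ArithmeticFunction.vonMangoldt n := by
    rw [Chebyshev.psi, Nat.floor_natCast, range_to_Ioc _ _ (by simp)]
  set N := (Finset.range (x + 1)).filter fun p => p.Prime ∧ q ∣ p - 1 with hN
  -- sum over class one
  have h1 : ∑ n ∈ Finset.range (x + 1), (if (n : ZMod q) = 1 then ArithmeticFunction.vonMangoldt n else 0)
      ≤ N.card * Real.log x + W := by
    have e : (N.card : ℝ) * Real.log x = ∑ n ∈ Finset.range (x + 1), if n.Prime ∧ q ∣ n - 1 then Real.log x else 0 := by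
      rw [← Finset.sum_filter, Finset.sum_const, nsmul_eq_mul]
    rw [e, hWe, ← Finset.sum_add_distrib]
    refine Finset.sum_le_sum fun n hn => ?_
    rw [Finset.mem_range] at hn
    have hL := Real.log_natCast_nonneg x
    have hv : 0 ≤ ArithmeticFunction.vonMangoldt n := ArithmeticFunction.vonMangoldt_nonneg
    by_cases hp : n.Prime
    · simp only [hp, true_and, not_true, if_false, add_zero]
      by_cases h : (n : ZMod q) = 1
      · have : q ∣ n - 1 := by
          rw [← ZMod.natCast_eq_zero_iff, Nat.cast_sub hp.one_lt.le, h]; simp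
        rw [if_pos h, if_pos this]
        exact ArithmeticFunction.vonMangoldt_le_log.trans (log_nat_mono (by omega))
      · rw [if_neg h]
        split_ifs <;> simp [hL]
    · simp only [hp, false_and, if_false, not_false_eq_true, if_true, zero_add]
      split_ifs <;> simp [hv]
  have h2 : ∑ n ∈ Finset.range (x + 1), (if (n : ZMod q) = 0 then ArithmeticFunction.vonMangoldt n else 0)
      ≤ Real.log x + W := by
    have : ∀ n ∈ Finset.range (x + 1), (if (n : ZMod q) = 0 then ArithmeticFunction.vonMangoldt n else 0) ≤
      (if n = q then Real.log x else 0) + (if ¬ n.Prime then ArithmeticFunction.vonMangoldt n else 0) := by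
      intro n hn
      rw [Finset.mem_range] at hn
      have hL := Real.log_natCast_nonneg x
      have hv : 0 ≤ ArithmeticFunction.vonMangoldt n := ArithmeticFunction.vonMangoldt_nonneg
      by_cases hp : n.Prime
      · simp only [hp, not_true, if_false, add_zero]
        by_cases h : (n : ZMod q) = 0
        · have h' : q = n := (Nat.prime_dvd_prime_iff_eq hq hp).mp ((ZMod.natCast_eq_zero_iff n q).mp h)
          rw [if_pos h, if_pos h'.symm]
          exact ArithmeticFunction.vonMangoldt_le_log.trans (log_nat_mono (by omega))
        · rw [if_neg h]
          split_ifs <;> simp [hL]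
      · simp only [hp, not_false_eq_true, if_true]
        split_ifs <;> linarith
    refine (Finset.sum_le_sum this).trans ?_
    rw [Finset.sum_add_distrib, ← hWe, Finset.sum_ite_eq']
    have hL := Real.log_natCast_nonneg x
    split_ifs <;> linarith
  have h3 : EE q x ArithmeticFunction.vonMangoldt =
      ∑ n ∈ Finset.range (x + 1), (if (n : ZMod q) = 1 then ArithmeticFunction.vonMangoldt n else 0)
      - (Chebyshev.psi x - ∑ n ∈ Finset.range (x + 1), (if (n : ZMod q) = 0 then ArithmeticFunction.vonMangoldt n else 0)) / ((q : ℝ) - 1) := by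
    rw [hpsi, ← Finset.sum_sub_distrib, Finset.sum_div, ← Finset.sum_sub_distrib]
    unfold EE
    refine Finset.sum_congr rfl fun n _ => ?_
    unfold ew
    split_ifs <;> ring
  have h4 : (Chebyshev.psi x - Real.log x - 2 * Real.sqrt x * Real.log x) / q ≤
      (Chebyshev.psi x - ∑ n ∈ Finset.range (x + 1), (if (n : ZMod q) = 0 then ArithmeticFunction.vonMangoldt n else 0)) / ((q : ℝ) - 1) := by
    apply div_le_div₀ <;> linarith
  have h5 := neg_le_abs (EE q x ArithmeticFunction.vonMangoldt)
  linarith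

lemma ev_log (C c : ℝ) (k : ℕ) (hc : 0 < c) : ∀ᶠ x : ℕ in atTop, C * Real.log x ^ k ≤ (x : ℝ) ^ c := by
  have h1 : (fun x : ℝ => C * Real.log x ^ k) =o[atTop] fun x : ℝ => x ^ c := by
    refine Asymptotics.IsLittleO.const_mul_left ?_ C
    have h2 := isLittleO_log_rpow_rpow_atTop (k : ℝ) hc
    refine h2.congr' ?_ (EventuallyEq.refl _ _)
    filter_upwards with x
    exact Real.rpow_natCast _ _
  have h3 := (h1.comp_tendsto tendsto_natCast_atTop_atTop).bound (c := 1) one_pos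
  filter_upwards [h3] with x hx
  simp only [Function.comp, one_mul, Real.norm_eq_abs] at hx
  rw [abs_of_nonneg (Real.rpow_nonneg (Nat.cast_nonneg x) c)] at hx
  exact (le_abs_self _).trans hx


lemma card_S_lower (Q : ℕ) (Q0 : ℝ) (hQ0 : 0 ≤ Q0) (hQ : 2 ≤ Q) :
    (Q * Real.log 2 - Real.log (Q + 1)) / Real.log Q - (Q0 + 1) ≤
      (((Finset.range (Q + 1)).filter fun q : ℕ => q.Prime ∧ Q0 ≤ (q : ℝ)).card : ℝ) := by
  have h1 := Chebyshev.pi_ge Q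
  have h2 : Nat.primeCounting Q ≤ ((Finset.range (Q + 1)).filter fun q : ℕ => q.Prime ∧ Q0 ≤ (q : ℝ)).card + ⌈Q0⌉₊ := by
    rw [Nat.primeCounting, Nat.primeCounting', Nat.count_eq_card_filter_range]
    calc _ ≤ (((Finset.range (Q + 1)).filter fun q : ℕ => q.Prime ∧ Q0 ≤ (q : ℝ)) ∪ Finset.range ⌈Q0⌉₊).card := by
          refine Finset.card_le_card fun p hp => ?_
          rw [Finset.mem_filter] at hp
          rw [Finset.mem_union, Finset.mem_filter]
          by_cases h : Q0 ≤ p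
          · exact Or.inl ⟨hp.1, hp.2, h⟩
          · exact Or.inr (Finset.mem_range.mpr (Nat.lt_ceil.mpr (not_le.mp h)))
      _ ≤ _ := (Finset.card_union_le _ _).trans (by simp)
  have h3 : (Nat.primeCounting Q : ℝ) ≤ (((Finset.range (Q + 1)).filter fun q : ℕ => q.Prime ∧ Q0 ≤ (q : ℝ)).card : ℝ) + ⌈Q0⌉₊ := by
    exact_mod_cast h2
  have h4 := Nat.ceil_lt_add_one hQ0
  linarith

set_option maxHeartbeats 1000000 in
lemma assembly (ρ ε δ : ℝ) (hρ : 0.4 < ρ) (hρ' : ρ < 0.42) (hδ : 0 < δ) (hδ' : δ ≤ 0.01) (hδε : δ ≤ ε) (x : ℕ)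
    (hx : 3 ≤ x) (hL : 100 ≤ Real.log x) (H1 : 1000 * Real.log x ≤ (x : ℝ) ^ (0.05 : ℝ))
    (H2 : 1000 * Real.log x ≤ (x : ℝ) ^ δ) (H3 : 90000 * Real.log x ^ 5 ≤ (x : ℝ) ^ (0.04 : ℝ)) :
    ∃ q : ℕ, q.Prime ∧ (x : ℝ) ^ (ρ - δ) ≤ q ∧ (q : ℝ) ≤ (x : ℝ) ^ ρ ∧
      (x : ℝ) ^ (1 - ρ - ε) ≤ ((Finset.range (x + 1)).filter fun p : ℕ => p.Prime ∧ q ∣ p - 1).card := by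
  by_contra hcon
  push Not at hcon
  set X : ℝ := (x : ℝ) with hX
  set L := Real.log X with hLdef
  have hX3 : (3 : ℝ) ≤ X := by rw [hX]; exact_mod_cast hx
  have hX1 : 1 ≤ X := by linarith
  have hX0 : 0 < X := by linarith
  have pm : ∀ {s t : ℝ}, s ≤ t → X ^ s ≤ X ^ t := fun h => Real.rpow_le_rpow_of_exponent_le hX1 h
  have padd : ∀ s t : ℝ, X ^ s * X ^ t = X ^ (s + t) := fun s t => (Real.rpow_add hX0 s t).symm
  have ppos : ∀ s : ℝ, 0 < X ^ s := fun s => Real.rpow_pos_of_pos hX0 s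
  have hsqrt : Real.sqrt X = X ^ (0.5 : ℝ) := by rw [Real.sqrt_eq_rpow]; norm_num
  have hlog1 : Real.log (X + 1) ≤ 2 * L := by
    have : Real.log (X + 1) ≤ Real.log (X ^ 2) := Real.log_le_log (by linarith) (by nlinarith)
    rw [Real.log_pow] at this
    exact_mod_cast this
  have hlog2 := Real.log_two_gt_d9
  -- F1
  have hsL : Real.sqrt X * L ≤ X ^ (0.55 : ℝ) / 1000 := by
    rw [hsqrt]
    have : X ^ (0.5 : ℝ) * X ^ (0.05 : ℝ) = X ^ (0.55 : ℝ) := by rw [padd]; norm_num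
    have h := mul_le_mul_of_nonneg_left H1 (ppos 0.5).le
    linarith
  have hX55 : X ^ (0.55 : ℝ) ≤ X := by
    have := pm (show (0.55 : ℝ) ≤ 1 by norm_num)
    rwa [Real.rpow_one] at this
  have hX05 : X ^ (0.05 : ℝ) ≤ X := by
    have := pm (show (0.05 : ℝ) ≤ 1 by norm_num)
    rwa [Real.rpow_one] at this
  have F1 : X / 2 ≤ Chebyshev.psi X - L - 2 * Real.sqrt X * L := by
    have := Chebyshev.psi_ge x
    rw [← hX] at this
    have h2 : X * 0.69 ≤ X * Real.log 2 := by gcongr; linarith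
    linarith
  -- U
  set U := ⌊X ^ (0.1 : ℝ)⌋₊ with hU
  have hU01 : 2 ≤ X ^ (0.1 : ℝ) := by
    have := pm (show (0.05 : ℝ) ≤ 0.1 by norm_num)
    linarith
  have hUle : (U : ℝ) ≤ X ^ (0.1 : ℝ) := Nat.floor_le (ppos _).le
  have hUgt : X ^ (0.1 : ℝ) < U + 1 := Nat.lt_floor_add_one _
  have hU1 : 1 ≤ U := by rw [hU]; exact Nat.le_floor (by push_cast; linarith)
  have hU1r : (1 : ℝ) ≤ U := by exact_mod_cast hU1
  have hUge : X ^ (0.1 : ℝ) / 2 ≤ U := by linarith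
  have F3 : 7 * (U : ℝ) ^ 2 * L ≤ X ^ (1 - ρ) / 8 := by
    have h1 : (U : ℝ) ^ 2 ≤ X ^ (0.2 : ℝ) := by
      have : X ^ (0.1 : ℝ) * X ^ (0.1 : ℝ) = X ^ (0.2 : ℝ) := by rw [padd]; norm_num
      rw [← this, sq]; gcongr
    have h2 : X ^ (0.2 : ℝ) * X ^ (0.05 : ℝ) = X ^ (0.25 : ℝ) := by rw [padd]; norm_num
    have h3 := pm (show (0.25 : ℝ) ≤ 1 - ρ by linarith)
    have h4 : (U : ℝ) ^ 2 * L ≤ X ^ (0.2 : ℝ) * L := by gcongr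
    have h5 := mul_le_mul_of_nonneg_left H1 (ppos 0.2).le
    linarith [ppos 0.25]
  -- Q
  set Q := ⌊X ^ ρ⌋₊ with hQ
  set Q0 := X ^ (ρ - δ) with hQ0
  have hQ0pos : 0 < Q0 := ppos _
  have hXρ : 1000 * L ≤ X ^ ρ := H1.trans (pm (by linarith))
  have hQle : (Q : ℝ) ≤ X ^ ρ := Nat.floor_le (ppos _).le
  have hQgt : X ^ ρ < Q + 1 := Nat.lt_floor_add_one _
  have hQ2 : 2 ≤ Q := by rw [hQ]; exact Nat.le_floor (by push_cast; linarith)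
  have hQ2r : (2 : ℝ) ≤ Q := by exact_mod_cast hQ2
  set S := (Finset.range (Q + 1)).filter fun q : ℕ => q.Prime ∧ Q0 ≤ (q : ℝ) with hS
  have hSmem : ∀ q ∈ S, q ≤ Q ∧ q.Prime ∧ Q0 ≤ q := by
    intro q hq
    rw [hS, Finset.mem_filter, Finset.mem_range] at hq
    exact ⟨by omega, hq.2⟩
  have hXρX : X ^ ρ ≤ X := by
    have := pm (show ρ ≤ 1 by linarith)
    rwa [Real.rpow_one] at this
  have F4 : X ^ ρ / (4 * L) ≤ (S.card : ℝ) := by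
    have h1 := card_S_lower Q Q0 hQ0pos.le hQ2
    have hlQ : Real.log Q ≤ L := Real.log_le_log (by linarith) (by linarith)
    have hlQ0 : 0 < Real.log Q := Real.log_pos (by linarith)
    have hlQ1 : Real.log (Q + 1) ≤ 2 * L := (Real.log_le_log (by linarith) (by linarith)).trans hlog1
    have h2 : X ^ ρ / 2 ≤ Q * Real.log 2 - Real.log (Q + 1) := by
      have : (X ^ ρ - 1) * 0.69 ≤ Q * Real.log 2 := by gcongr <;> linarith
      linarith
    have h3 : X ^ ρ / 2 / L ≤ (Q * Real.log 2 - Real.log (Q + 1)) / Real.log Q := by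
      apply div_le_div₀ <;> linarith [ppos ρ]
    have h4 : Q0 ≤ X ^ ρ / (1000 * L) := by
      rw [le_div_iff₀ (by linarith)]
      have : Q0 * X ^ δ = X ^ ρ := by rw [hQ0, padd]; congr 1; ring
      rw [← this]
      gcongr
    have h5 : 1 ≤ X ^ ρ / (1000 * L) := by
      rw [le_div_iff₀ (by linarith)]; linarith
    have h6 : X ^ ρ / 2 / L = X ^ ρ / (4 * L) + 250 * (X ^ ρ / (1000 * L)) := by
      field_simp; ring
    linarith
  -- lower bound for each q
  have F5 : ∀ q ∈ S, X ^ (1 - ρ) / 8 ≤ |EE q x (muBig U * bBig U)| := by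
    intro q hq
    obtain ⟨hqQ, hqp, hq0⟩ := hSmem q hq
    have hqr : (q : ℝ) ≤ X ^ ρ := le_trans (by exact_mod_cast hqQ) hQle
    have hN := hcon q hqp hq0 hqr
    have h1 := EE_lower q x hqp (by omega) (by rw [← hX]; linarith)
    rw [← hX, ← hLdef] at h1
    have h2 : X ^ (1 - ρ) / 2 ≤ (Chebyshev.psi X - L - 2 * Real.sqrt X * L) / q := by
      have hq0' : (0 : ℝ) < q := by exact_mod_cast hqp.pos
      rw [le_div_iff₀ hq0']
      have : X ^ (1 - ρ) * X ^ ρ = X := by rw [padd]; simp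
      have : X ^ (1 - ρ) * q ≤ X ^ (1 - ρ) * X ^ ρ := by have := ppos (1 - ρ); gcongr
      linarith
    have h3 : (((Finset.range (x + 1)).filter fun p : ℕ => p.Prime ∧ q ∣ p - 1).card : ℝ) * L ≤ X ^ (1 - ρ) / 1000 := by
      have e1 : X ^ (1 - ρ - ε) ≤ X ^ (1 - ρ - δ) := pm (by linarith)
      have e2 : X ^ (1 - ρ - δ) * X ^ δ = X ^ (1 - ρ) := by rw [padd]; congr 1; ring
      have e3 := mul_le_mul_of_nonneg_left H2 (ppos (1 - ρ - δ)).le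
      have e4 : (((Finset.range (x + 1)).filter fun p : ℕ => p.Prime ∧ q ∣ p - 1).card : ℝ) * L ≤ X ^ (1 - ρ - δ) * L := by
        gcongr; linarith
      linarith
    have h4 : X ^ (0.55 : ℝ) ≤ X ^ (1 - ρ) := pm (by linarith)
    have h5 := vaughan_one q x U hqp hU1
    rw [← hX, ← hLdef] at h5
    have h6 := abs_sub_abs_le_abs_sub (EE q x ArithmeticFunction.vonMangoldt) (EE q x (muBig U * bBig U))
    linarith [ppos (1 - ρ)]
  -- upper bound
  set J := Nat.log 2 (x + 1) + 1 with hJ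
  have hJlt : x + 1 < 2 ^ J := Nat.lt_pow_succ_log_self (by norm_num) _
  have hJle : (J : ℝ) ≤ 4 * L := by
    have h1 : 2 ^ Nat.log 2 (x + 1) ≤ x + 1 := Nat.pow_log_le_self 2 (by omega)
    have h2 : ((2 : ℝ) ^ Nat.log 2 (x + 1)) ≤ X + 1 := by rw [hX]; exact_mod_cast h1
    have h3 := Real.log_le_log (by positivity) h2
    rw [Real.log_pow] at h3
    have h4 : (Nat.log 2 (x + 1) : ℝ) * 0.69 ≤ Nat.log 2 (x + 1) * Real.log 2 := by gcongr; linarith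
    rw [hJ]; push_cast
    linarith
  set D := 4 * X ^ (2 * ρ) * L with hD
  have hQsq : ((Q ^ 2 : ℕ) : ℝ) ≤ X ^ (2 * ρ) := by
    push_cast
    have : X ^ ρ * X ^ ρ = X ^ (2 * ρ) := by rw [padd]; congr 1; ring
    rw [← this, sq]; gcongr
  have hlQsq : Real.log ((Q ^ 2 : ℕ) : ℝ) ≤ L := by
    refine Real.log_le_log (by positivity) (hQsq.trans ?_)
    have := pm (show 2 * ρ ≤ 1 by linarith)
    rwa [Real.rpow_one] at this
  have hDle : 2 * ((Q ^ 2 : ℕ) : ℝ) * (1 + Real.log ((Q ^ 2 : ℕ) : ℝ)) ≤ D := by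
    calc _ ≤ 2 * X ^ (2 * ρ) * (2 * L) := by
          have := Real.log_natCast_nonneg (Q ^ 2)
          gcongr; linarith
      _ = D := by rw [hD]; ring
  have T := vaughan_two Q x U J (by omega) hU1 S (fun q hq => (hSmem q hq).2.1) (fun q hq => (hSmem q hq).1)
    Q0 hQ0pos (fun q hq => (hSmem q hq).2.2) hJlt D hDle
  rw [← hX, ← hLdef] at T
  have hlow : (S.card : ℝ) * (X ^ (1 - ρ) / 8) ≤ ∑ q ∈ S, |EE q x (muBig U * bBig U)| := by
    have := Finset.sum_le_sum F5
    rwa [Finset.sum_const, nsmul_eq_mul] at this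
  have hsq : Real.sqrt (4 * X * L ^ 2 * (256 * X + 64 * D * (X / U) + D ^ 2)) ≤ 56 * L ^ 2 * X ^ (ρ + 0.95) := by
    apply Real.sqrt_le_iff.mpr
    refine ⟨by have := ppos (ρ + 0.95); positivity, ?_⟩
    set Y := X ^ (2 * ρ + 0.9) with hY
    have hYp : 0 < Y := ppos _
    have hL1 : 1 ≤ L := by linarith
    have hLL : L ≤ L ^ 2 := by nlinarith
    have a1 : 256 * X ≤ 256 * L ^ 2 * Y := by
      have : X ≤ Y := by
        have := pm (show 1 ≤ 2 * ρ + 0.9 by linarith)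
        rwa [Real.rpow_one] at this
      have : (1 : ℝ) * X ≤ L ^ 2 * Y := by gcongr; linarith
      linarith
    have a2 : 64 * D * (X / U) ≤ 512 * L ^ 2 * Y := by
      have h1 : X / U ≤ 2 * X ^ (0.9 : ℝ) := by
        rw [div_le_iff₀ (by linarith)]
        have : X ^ (0.9 : ℝ) * X ^ (0.1 : ℝ) = X := by rw [padd]; norm_num
        have h9 := mul_le_mul_of_nonneg_left hUge (ppos 0.9).le
        linarith
      have h2 : X ^ (2 * ρ) * X ^ (0.9 : ℝ) = Y := by rw [padd]
      calc 64 * D * (X / U) ≤ 64 * D * (2 * X ^ (0.9 : ℝ)) := by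
            have : 0 ≤ D := by have := ppos (2 * ρ); rw [hD]; positivity
            gcongr
        _ = 512 * L * (X ^ (2 * ρ) * X ^ (0.9 : ℝ)) := by rw [hD]; ring
        _ = 512 * L * Y := by rw [h2]
        _ ≤ _ := by gcongr
    have a3 : D ^ 2 ≤ 16 * L ^ 2 * Y := by
      have h1 : X ^ (2 * ρ) * X ^ (2 * ρ) ≤ Y := by rw [padd]; exact pm (by linarith)
      calc D ^ 2 = 16 * L ^ 2 * (X ^ (2 * ρ) * X ^ (2 * ρ)) := by rw [hD]; ring
        _ ≤ _ := by gcongr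
    have h3 : X ^ (ρ + 0.95) * X ^ (ρ + 0.95) = X * Y := by
      rw [padd, hY]
      nth_rewrite 2 [← Real.rpow_one X]
      rw [padd]; congr 1; ring
    calc _ ≤ 4 * X * L ^ 2 * (784 * L ^ 2 * Y) := by gcongr; linarith
      _ = 56 ^ 2 * L ^ 4 * (X * Y) := by ring
      _ = (56 * L ^ 2 * X ^ (ρ + 0.95)) ^ 2 := by rw [← h3]; ring
  have hup : J * (J * (3 / Q0 * Real.sqrt (4 * X * L ^ 2 * (256 * X + 64 * D * (X / U) + D ^ 2)))) ≤
      2688 * L ^ 4 * X ^ (0.96 : ℝ) := by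
    have h1 : X ^ (ρ + 0.95) / Q0 ≤ X ^ (0.96 : ℝ) := by
      rw [hQ0, ← Real.rpow_sub hX0]; exact pm (by linarith)
    calc _ ≤ (4 * L) * ((4 * L) * (3 / Q0 * (56 * L ^ 2 * X ^ (ρ + 0.95)))) := by gcongr
      _ = 2688 * L ^ 4 * (X ^ (ρ + 0.95) / Q0) := by ring
      _ ≤ _ := by gcongr
  have hfin : X / (32 * L) ≤ 2688 * L ^ 4 * X ^ (0.96 : ℝ) := by
    have h1 : X ^ ρ * X ^ (1 - ρ) = X := by rw [padd]; simp
    have hLp : 0 < L := by linarith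
    calc X / (32 * L) = X ^ ρ / (4 * L) * (X ^ (1 - ρ) / 8) := by
          rw [div_mul_div_comm, h1]; congr 1; ring
      _ ≤ (S.card : ℝ) * (X ^ (1 - ρ) / 8) := by have := ppos (1 - ρ); gcongr
      _ ≤ _ := hlow.trans (T.trans hup)
  rw [div_le_iff₀ (by linarith)] at hfin
  have h1 : X ^ (0.96 : ℝ) * X ^ (0.04 : ℝ) = X := by rw [padd]; norm_num
  have h2 := mul_le_mul_of_nonneg_left H3 (ppos 0.96).le
  have h3 : 0 < L ^ 5 * X ^ (0.96 : ℝ) := by have := ppos 0.96; positivity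
  nlinarith

lemma primesAP_main : PrimesAP (Real.sqrt 2 - 1) := by
  intro ε hε
  have hs1 : (1.4 : ℝ) < Real.sqrt 2 := by
    rw [Real.lt_sqrt (by norm_num)]; norm_num
  have hs2 : Real.sqrt 2 < 1.42 := by
    rw [Real.sqrt_lt' (by norm_num)]; norm_num
  set ρ := Real.sqrt 2 - 1 with hρ
  have hδ : 0 < min ε 0.01 := lt_min hε (by norm_num)
  have hL : ∀ᶠ x : ℕ in atTop, 100 ≤ Real.log (x : ℝ) :=
    (Real.tendsto_log_atTop.comp tendsto_natCast_atTop_atTop).eventually_ge_atTop 100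
  filter_upwards [eventually_ge_atTop 3, hL, ev_log 1000 0.05 1 (by norm_num), ev_log 1000 (min ε 0.01) 1 hδ,
    ev_log 90000 0.04 5 (by norm_num)] with x h3 h100 H1 H2 H3
  rw [pow_one] at H1 H2
  obtain ⟨q, hq, hq0, hq1, hq2⟩ := assembly ρ ε (min ε 0.01) (by linarith) (by linarith) hδ (min_le_right _ _) (min_le_left _ _)
    x h3 h100 H1 H2 H3
  refine ⟨q, hq, le_trans ?_ hq0, hq1, hq2⟩
  refine Real.rpow_le_rpow_of_exponent_le (by exact_mod_cast (by omega : 1 ≤ x)) ?_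
  have := min_le_left ε (0.01 : ℝ)
  linarith

theorem limsup_extremalF :
    limsup
        (fun n : ℕ => Real.log (extremalF n) / ((Real.log n) ^ 2 / Real.log (Real.log n)))
        atTop = (3 - 2 * Real.sqrt 2) / 4 := by
  exact limsup_of_primesAP primesAP_main
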